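/- Let P be a simple polygon and let x, u, v, w be four distinct points in the interior of P such that {x, u, v, w} together with the vertices of P is in strong general position. If the triples (x,u,v), (x,v,w) and (x,w,u) are each in geodesic counterclockwise order with respect to P, then the triple (u,v,w) is in geodesic counterclockwise order with respect to P. -/

import Mathlib

open scoped RealInnerProductSpace ENNReal Classical

noncomputable section

/-- Points of the Euclidean plane. -/
abbrev Pt : Type := EuclideanSpace ℝ (Fin 2)

/-- The planar determinant `det (u, v)` of two vectors. -/
def det2 (u v : Pt) : ℝ := u 0 * v 1 - u 1 * v 0

/-- No three of the points of `S` are collinear. -/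
def NoThreeCollinear (S : Set Pt) : Prop :=
  ∀ p ∈ S, ∀ q ∈ S, ∀ r ∈ S, p ≠ q → p ≠ r → q ≠ r → det2 (q - p) (r - p) ≠ 0

/-- `S` is in strong general position: no three points are collinear and for any four
distinct points `p₁ p₂ p₃ p₄` the line through `p₁,p₂` is not parallel to the line
through `p₃,p₄`. -/
def StrongGenPos (S : Set Pt) : Prop :=
  NoThreeCollinear S ∧
    ∀ p₁ ∈ S, ∀ p₂ ∈ S, ∀ p₃ ∈ S, ∀ p₄ ∈ S,
      p₁ ≠ p₂ → p₁ ≠ p₃ → p₁ ≠ p₄ → p₂ ≠ p₃ → p₂ ≠ p₄ → p₃ ≠ p₄ →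
        det2 (p₂ - p₁) (p₄ - p₃) ≠ 0

/-- A simple polygon, given by a cyclic sequence of `n ≥ 3` distinct vertices
(encoded as an `n`-periodic function `ℕ → Pt`), such that no point of the plane lies on
more than two closed edges, and the only points lying on exactly two edges are vertices. -/
structure SimplePolygon where
  n : ℕ
  three_le : 3 ≤ n
  vtx : ℕ → Pt
  periodic : ∀ i, vtx (i + n) = vtx i
  inj : ∀ i < n, ∀ j < n, vtx i = vtx j → i = j
  simple : ∀ x : Pt, {i | i < n ∧ x ∈ segment ℝ (vtx i) (vtx (i + 1))}.ncard ≤ 2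
  vtx_of_two : ∀ x : Pt,
    {i | i < n ∧ x ∈ segment ℝ (vtx i) (vtx (i + 1))}.ncard = 2 → ∃ i < n, x = vtx i

namespace SimplePolygon

/-- The boundary of a simple polygon: the union of its closed edges. -/
def boundary (P : SimplePolygon) : Set Pt :=
  ⋃ i ∈ Finset.range P.n, segment ℝ (P.vtx i) (P.vtx (i + 1))

/-- The interior of a simple polygon: the union of the bounded connected components of the
complement of the boundary. -/
def interior (P : SimplePolygon) : Set Pt :=
  {x | x ∉ P.boundary ∧ Bornology.IsBounded (connectedComponentIn P.boundaryᶜ x)}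

/-- A simple polygon, regarded as a point set: boundary together with interior. -/
def region (P : SimplePolygon) : Set Pt := P.boundary ∪ P.interior

/-- The set of vertices of the polygon. -/
def vertexSet (P : SimplePolygon) : Set Pt := {x | ∃ i < P.n, x = P.vtx i}

/-- Twice the shoelace signed area. -/
def shoelace (P : SimplePolygon) : ℝ := ∑ i ∈ Finset.range P.n, det2 (P.vtx i) (P.vtx (i + 1))

/-- The vertices are listed in counterclockwise order (positive shoelace signed area). -/
def CCW (P : SimplePolygon) : Prop := 0 < P.shoelace

/-- The vertex `vtx (i+1)` is a convex vertex:
`det (v_{i+1} − v_i, v_{i+2} − v_{i+1}) > 0` (vertices listed counterclockwise). -/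
def ConvexAt (P : SimplePolygon) (i : ℕ) : Prop :=
  0 < det2 (P.vtx (i + 1) - P.vtx i) (P.vtx (i + 2) - P.vtx (i + 1))

/-- The number of convex vertices of the polygon. -/
def numConvex (P : SimplePolygon) : ℕ := {i | i < P.n ∧ P.ConvexAt i}.ncard

/-- Continuous paths from `s` to `t` staying inside the polygon. -/
def pathsIn (P : SimplePolygon) (s t : Pt) : Set (ℝ → Pt) :=
  {γ | ContinuousOn γ (Set.Icc 0 1) ∧ γ 0 = s ∧ γ 1 = t ∧ γ '' Set.Icc (0 : ℝ) 1 ⊆ P.region}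

/-- The geodesic distance between `s` and `t` inside the polygon: the infimum of the
lengths (total variations) of continuous paths in the polygon from `s` to `t`. -/
def geodDist (P : SimplePolygon) (s t : Pt) : ℝ≥0∞ :=
  ⨅ γ ∈ P.pathsIn s t, eVariationOn γ (Set.Icc 0 1)

end SimplePolygon

/-- Length of a polygonal path through a list of points. -/
def polylineLen : List Pt → ℝ
  | [] => 0
  | [_] => 0
  | a :: b :: l => dist a b + polylineLen (b :: l)

/-- The polygonal path through a list of points, as a point set. -/
def polylineSet : List Pt → Set Pt
  | [] => ∅
  | [a] => {a}
  | a :: b :: l => segment ℝ a b ∪ polylineSet (b :: l)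

/-- `L` is the vertex sequence of the geodesic from `s` to `t` inside the polygon `P`:
a polygonal path inside `P` from `s` to `t`, with consecutive vertices distinct, with no
three consecutive vertices collinear, whose length realizes the geodesic distance. -/
def SimplePolygon.IsGeodesicChain (P : SimplePolygon) (s t : Pt) (L : List Pt) : Prop :=
  L.head? = some s ∧ L.getLast? = some t ∧ List.Chain' (· ≠ ·) L ∧
  (∀ i, i + 2 < L.length →
      det2 (L.getD (i + 1) 0 - L.getD i 0) (L.getD (i + 2) 0 - L.getD i 0) ≠ 0) ∧
  polylineSet L ⊆ P.region ∧
  ENNReal.ofReal (polylineLen L) = P.geodDist s t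

/-- The triple `(p,q,r)` is in geodesic counterclockwise order with respect to `P`:
writing the geodesics `π(p,q) = ⟨p = v₀, …, v_k = q⟩` and `π(p,r) = ⟨p = u₀, …, u_{k'} = r⟩`
and taking the smallest index `i > 0` with `v_i ≠ u_i`, we have
`det (v_i − v_{i−1}, u_i − v_{i−1}) > 0`. -/
def geodesicCCW (P : SimplePolygon) (p q r : Pt) : Prop :=
  ∃ L M : List Pt, P.IsGeodesicChain p q L ∧ P.IsGeodesicChain p r M ∧
    ∃ i : ℕ, 0 < i ∧ (∀ j < i, L[j]? = M[j]?) ∧ L[i]? ≠ M[i]? ∧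
      ∃ a b c : Pt, L[i - 1]? = some a ∧ L[i]? = some b ∧ M[i]? = some c ∧
        0 < det2 (b - a) (c - a)

/-- The triple `(p,q,r)` is in geodesic clockwise order with respect to `P`. -/
def geodesicCW (P : SimplePolygon) (p q r : Pt) : Prop :=
  ∃ L M : List Pt, P.IsGeodesicChain p q L ∧ P.IsGeodesicChain p r M ∧
    ∃ i : ℕ, 0 < i ∧ (∀ j < i, L[j]? = M[j]?) ∧ L[i]? ≠ M[i]? ∧
      ∃ a b c : Pt, L[i - 1]? = some a ∧ L[i]? = some b ∧ M[i]? = some c ∧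
        det2 (b - a) (c - a) < 0

/-- `C ⊆ P` is geodesically convex: for all `p, q ∈ C` the geodesic connecting them
stays inside `C`. -/
def GeodesicallyConvex (P : SimplePolygon) (C : Set Pt) : Prop :=
  C ⊆ P.region ∧ ∀ p ∈ C, ∀ q ∈ C, ∀ L, P.IsGeodesicChain p q L → polylineSet L ⊆ C

/-- The geodesic hull `CH_P(U)`: the intersection of all geodesically convex subsets of `P`
containing `U`. -/
def geodesicHull (P : SimplePolygon) (U : Set Pt) : Set Pt :=
  ⋂₀ {C | GeodesicallyConvex P C ∧ U ⊆ C}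

/-- `E_P(S)`: the set of points of `S` lying on the (topological) boundary of the geodesic
hull of `S` with respect to `P`. -/
def extremeSet (P : SimplePolygon) (S : Set Pt) : Set Pt :=
  {x ∈ S | x ∈ frontier (geodesicHull P S)}

/-- `B` is separable from `R`: there is a simple polygon with at most `|B|` convex vertices
whose interior contains all points of `R` and which contains no point of `B`. -/
def Separable (B R : Finset Pt) : Prop :=
  ∃ P : SimplePolygon, P.CCW ∧ P.numConvex ≤ B.card ∧
    (∀ r ∈ R, r ∈ P.interior) ∧ ∀ b ∈ B, b ∉ P.region

/-! ### Plane linear algebra -/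

theorem Pt.ext' {p q : Pt} (h0 : p 0 = q 0) (h1 : p 1 = q 1) : p = q := by
  ext i
  fin_cases i
  · exact h0
  · exact h1

theorem det2_swap (u v : Pt) : det2 v u = -det2 u v := by
  simp only [det2]; ring

theorem eq_smul_of_det2_eq_zero {u v : Pt} (hu : u ≠ 0) (h : det2 u v = 0) :
    ∃ t : ℝ, v = t • u := by
  simp only [det2] at h
  by_cases h0 : u 0 = 0
  · have h1 : u 1 ≠ 0 := fun h1 => hu (Pt.ext' (by simpa using h0) (by simpa using h1))
    refine ⟨v 1 / u 1, Pt.ext' ?_ ?_⟩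
    · have : v 0 = 0 := by
        rw [h0] at h
        have : u 1 * v 0 = 0 := by linarith
        simpa [h1] using this
      simp [h0, this]
    · simp [h1]
  · refine ⟨v 0 / u 0, Pt.ext' ?_ ?_⟩
    · simp [h0]
    · simp only [PiLp.smul_apply, smul_eq_mul]
      field_simp
      linarith

/-- Coordinates of a vector with respect to a basis of the plane. -/
theorem eq_comb_of_det2_ne_zero {u v : Pt} (h : det2 u v ≠ 0) (w : Pt) :
    w = (det2 w v / det2 u v) • u + (det2 u w / det2 u v) • v := by
  refine Pt.ext' ?_ ?_ <;>
  · simp only [PiLp.add_apply, PiLp.smul_apply, smul_eq_mul]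
    rw [div_mul_eq_mul_div, div_mul_eq_mul_div, ← add_div, eq_div_iff h]
    simp only [det2]; ring

theorem exists_det2_pos {u : Pt} (hu : u ≠ 0) : ∃ v : Pt, 0 < det2 u v := by
  refine ⟨!₂[-u 1, u 0], ?_⟩
  have : 0 < u 0 * u 0 + u 1 * u 1 := by
    by_contra h
    have h0 : u 0 = 0 := by nlinarith [mul_self_nonneg (u 0), mul_self_nonneg (u 1)]
    have h1 : u 1 = 0 := by nlinarith [mul_self_nonneg (u 0), mul_self_nonneg (u 1)]
    exact hu (Pt.ext' (by simpa using h0) (by simpa using h1))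
  simp [det2]; linarith

/-! ### Polylines -/

theorem polylineLen_nonneg : ∀ L : List Pt, 0 ≤ polylineLen L
  | [] => le_rfl
  | [_] => le_rfl
  | _ :: b :: l => add_nonneg dist_nonneg (polylineLen_nonneg (b :: l))

theorem polylineLen_append (A : List Pt) (a : Pt) (B : List Pt) :
    polylineLen (A ++ a :: B) = polylineLen (A ++ [a]) + polylineLen (a :: B) := by
  induction A with
  | nil => simp [polylineLen]
  | cons c A ih =>
    cases A with
    | nil => simp [polylineLen]
    | cons d A =>
      simp only [List.cons_append, polylineLen] at ih ⊢
      rw [ih]; ring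

theorem mem_polylineSet_head (a : Pt) (l : List Pt) : a ∈ polylineSet (a :: l) := by
  cases l with
  | nil => simp [polylineSet]
  | cons b l => exact Or.inl (left_mem_segment ℝ a b)

theorem polylineSet_append (A : List Pt) (a : Pt) (B : List Pt) :
    polylineSet (A ++ a :: B) = polylineSet (A ++ [a]) ∪ polylineSet (a :: B) := by
  induction A with
  | nil =>
    simp only [List.nil_append, polylineSet]
    exact (Set.union_eq_right.2 (Set.singleton_subset_iff.2 (mem_polylineSet_head a B))).symm
  | cons c A ih =>
    cases A with
    | nil =>
      simp only [List.cons_append, List.nil_append, polylineSet]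
      rw [Set.union_assoc]
      congr 1
    | cons d A =>
      simp only [List.cons_append, polylineSet] at ih ⊢
      rw [ih, Set.union_assoc]

theorem subset_polylineSet {c : Pt} {L : List Pt} (h : c ∈ L) : c ∈ polylineSet L := by
  obtain ⟨A, B, rfl⟩ := List.append_of_mem h
  rw [polylineSet_append]
  exact Or.inr (mem_polylineSet_head c B)

theorem polylineLen_reverse (L : List Pt) : polylineLen L.reverse = polylineLen L := by
  induction L with
  | nil => rfl
  | cons a l ih =>
    cases l with
    | nil => rfl
    | cons b l =>
      rw [List.reverse_cons, List.reverse_cons, List.append_assoc, List.singleton_append,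
        polylineLen_append, ← List.reverse_cons, ih]
      simp only [polylineLen, dist_comm b a]; ring

theorem polylineSet_reverse (L : List Pt) : polylineSet L.reverse = polylineSet L := by
  induction L with
  | nil => rfl
  | cons a l ih =>
    cases l with
    | nil => rfl
    | cons b l =>
      rw [List.reverse_cons, List.reverse_cons, List.append_assoc, List.singleton_append,
        polylineSet_append, ← List.reverse_cons, ih]
      simp only [polylineSet, segment_symm ℝ b a]
      have hb := mem_polylineSet_head b l
      ext y
      have := left_mem_segment ℝ a b
      have h2 := right_mem_segment ℝ a b
      simp only [Set.mem_union, Set.mem_singleton_iff]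
      constructor
      · rintro (h | h | rfl) <;> simp_all
      · rintro (h | h) <;> simp_all

theorem segment_subset_union_segment {a b z : Pt} (hz : z ∈ segment ℝ a b) :
    segment ℝ a b ⊆ segment ℝ a z ∪ segment ℝ z b := by
  rw [segment_eq_image'] at hz
  obtain ⟨t, ⟨ht0, ht1⟩, rfl⟩ := hz
  rw [segment_eq_image']
  rintro _ ⟨s, ⟨hs0, hs1⟩, rfl⟩
  rcases le_or_gt s t with h | h
  · left
    rw [segment_eq_image']
    rcases ht0.eq_or_lt with h0 | h0
    · exact ⟨0, by simp, by simp [← h0, le_antisymm (h0 ▸ h) hs0]⟩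
    · refine ⟨s / t, ⟨by positivity, (div_le_one h0).2 h⟩, ?_⟩
      simp only [add_sub_cancel_left, smul_smul, div_mul_cancel₀ _ h0.ne']
  · right
    rw [segment_eq_image']
    have h1 : 0 < 1 - t := by linarith
    refine ⟨(s - t) / (1 - t), ⟨div_nonneg (by linarith) h1.le, (div_le_one h1).2 (by linarith)⟩, ?_⟩
    have : b - (a + t • (b - a)) = (1 - t) • (b - a) := by module
    simp only [this, smul_smul, div_mul_cancel₀ _ h1.ne']
    module

theorem isCompact_segment (a b : Pt) : IsCompact (segment ℝ a b) := by
  rw [segment_eq_image_lineMap]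
  exact isCompact_Icc.image AffineMap.lineMap_continuous

theorem isCompact_polylineSet : ∀ L : List Pt, IsCompact (polylineSet L)
  | [] => isCompact_empty
  | [_] => isCompact_singleton
  | a :: b :: l => (isCompact_segment a b).union (isCompact_polylineSet (b :: l))

/-- The first point of a polyline in a closed set can be inserted as a vertex. -/
theorem exists_first_split {L : List Pt} {Z : Set Pt} (hZ : IsClosed Z)
    (hz : (polylineSet L ∩ Z).Nonempty) (hc : List.IsChain (· ≠ ·) L) :
    ∃ (A B : List Pt) (z : Pt), z ∈ Z ∧ (∀ y ∈ polylineSet (A ++ [z]), y ∈ Z → y = z) ∧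
      polylineSet (A ++ z :: B) = polylineSet L ∧
      polylineLen (A ++ z :: B) = polylineLen L ∧ (A ++ z :: B).head? = L.head? ∧
      (A ++ z :: B).getLast? = L.getLast? ∧ List.IsChain (· ≠ ·) (A ++ z :: B) := by
  induction L with
  | nil => simp [polylineSet] at hz
  | cons a l ih =>
    cases l with
    | nil =>
      obtain ⟨z, hz, hzZ⟩ := hz
      simp only [polylineSet, Set.mem_singleton_iff] at hz
      subst hz
      exact ⟨[], [], z, hzZ, by simp [polylineSet]⟩
    | cons b l =>
      by_cases hs : (segment ℝ a b ∩ Z).Nonempty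
      · obtain ⟨z, ⟨hzs, hzZ⟩, hmin⟩ := ((isCompact_segment a b).inter_right hZ).exists_isMinOn hs
          (f := fun y => dist a y) (by fun_prop)
        have hfirst : ∀ y ∈ segment ℝ a z, y ∈ Z → y = z := by
          intro y hy hyZ
          have h1 : dist a z ≤ dist a y := hmin
            ⟨(convex_segment a b).segment_subset (left_mem_segment ℝ a b) hzs hy, hyZ⟩
          have h2 := dist_add_dist_of_mem_segment hy
          exact dist_le_zero.1 (by linarith)
        by_cases hza : z = a
        · subst hza
          exact ⟨[], b :: l, z, hzZ, by simpa [polylineSet] using hc⟩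
        by_cases hzb : z = b
        · subst hzb
          exact ⟨[a], l, z, hzZ, by simpa [polylineSet] using hfirst, by simp [hc]⟩
        refine ⟨[a], b :: l, z, hzZ, ?_, ?_⟩
        · intro y hy
          simp only [List.cons_append, List.nil_append, polylineSet, Set.mem_union,
            Set.mem_singleton_iff] at hy
          rcases hy with hy | hy
          · exact hfirst y hy
          · exact fun _ => hy
        rw [List.isChain_cons_cons] at hc
        simp only [List.cons_append, List.nil_append, polylineSet, polylineLen, List.head?_cons,
          List.isChain_cons_cons, true_and]
        refine ⟨?_, ?_, by simp, fun h => hza h.symm, hzb, hc.2⟩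
        · rw [← Set.union_assoc]
          congr 1
          apply Set.Subset.antisymm
          · exact Set.union_subset
              ((convex_segment a b).segment_subset (left_mem_segment ℝ a b) hzs)
              ((convex_segment a b).segment_subset hzs (right_mem_segment ℝ a b))
          · exact segment_subset_union_segment hzs
        · rw [← add_assoc, dist_add_dist_of_mem_segment hzs]
      · have hs' : ∀ y ∈ segment ℝ a b, y ∉ Z := fun y hy hyZ => hs ⟨y, hy, hyZ⟩
        have hzl : (polylineSet (b :: l) ∩ Z).Nonempty := by
          obtain ⟨y, hy | hy, hyZ⟩ := hz
          · exact absurd hyZ (hs' y hy)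
          · exact ⟨y, hy, hyZ⟩
        obtain ⟨A, B, z, h1, h2, h3, h4, h5, h6, h7⟩ := ih hzl hc.tail
        have hhead : (A ++ [z]).head? = some b := by
          rw [← List.head?_cons (a := b) (l := l), ← h5]
          cases A <;> rfl
        obtain ⟨D, hD⟩ := List.head?_eq_some_iff.1 hhead
        obtain ⟨C, hC⟩ := List.head?_eq_some_iff.1 (h5.trans (List.head?_cons (a := b)))
        refine ⟨a :: A, B, z, h1, ?_, ?_⟩
        · intro y hy hyZ
          rw [List.cons_append, hD] at hy
          rcases hy with hy | hy
          · exact absurd hyZ (hs' y hy)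
          · rw [← hD] at hy
            exact h2 y hy hyZ
        rw [List.cons_append]
        rw [hC] at h3 h4 h6 h7 ⊢
        simp only [polylineSet, polylineLen, h3, h4, List.head?_cons, true_and]
        refine ⟨by simpa using h6, ?_⟩
        rw [List.isChain_cons_cons] at hc ⊢
        exact ⟨hc.1, h7⟩

/-- A point of a polyline can be inserted as a vertex. -/
theorem exists_split_at {L : List Pt} {z : Pt} (hz : z ∈ polylineSet L)
    (hc : List.IsChain (· ≠ ·) L) :
    ∃ A B : List Pt, polylineSet (A ++ z :: B) = polylineSet L ∧
      polylineLen (A ++ z :: B) = polylineLen L ∧ (A ++ z :: B).head? = L.head? ∧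
      (A ++ z :: B).getLast? = L.getLast? ∧ List.IsChain (· ≠ ·) (A ++ z :: B) := by
  obtain ⟨A, B, w, hw, -, h⟩ := exists_first_split (isClosed_singleton (x := z)) ⟨z, hz, rfl⟩ hc
  obtain rfl : w = z := hw
  exact ⟨A, B, h⟩

/-! ### Shortest polylines -/

/-- `L` is a shortest polyline from `s` to `t` among all polylines contained in `R`. -/
structure IsShortest (R : Set Pt) (s t : Pt) (L : List Pt) : Prop where
  head : L.head? = some s
  last : L.getLast? = some t
  subset : polylineSet L ⊆ R
  le : ∀ M : List Pt, M.head? = some s → M.getLast? = some t → polylineSet M ⊆ R →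
    polylineLen L ≤ polylineLen M

theorem head?_append_cons_eq {A : List Pt} {a : Pt} {B C : List Pt} :
    (A ++ a :: B).head? = (A ++ a :: C).head? := by
  cases A <;> simp

theorem getLast?_append_cons_eq {A C : List Pt} {a : Pt} {B : List Pt} :
    (A ++ a :: B).getLast? = (C ++ a :: B).getLast? := by
  simp [List.getLast?_append, List.getLast?_cons]

namespace IsShortest

variable {R : Set Pt} {s t a : Pt} {L A B : List Pt}

theorem reverse (h : IsShortest R s t L) : IsShortest R t s L.reverse where
  head := by rw [List.head?_reverse, h.last]
  last := by rw [List.getLast?_reverse, h.head]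
  subset := by rw [polylineSet_reverse]; exact h.subset
  le M h1 h2 h3 := by
    rw [polylineLen_reverse, ← polylineLen_reverse M]
    exact h.le _ (by rw [List.head?_reverse, h2]) (by rw [List.getLast?_reverse, h1])
      (by rwa [polylineSet_reverse])

theorem left (h : IsShortest R s t (A ++ a :: B)) : IsShortest R s a (A ++ [a]) where
  head := head?_append_cons_eq.trans h.head
  last := by simp
  subset := (polylineSet_append A a B ▸ Set.subset_union_left).trans h.subset
  le M h1 h2 h3 := by
    obtain ⟨M, rfl⟩ := List.getLast?_eq_some_iff.1 h2
    have := h.le (M ++ a :: B) (head?_append_cons_eq.trans h1)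
      (getLast?_append_cons_eq.trans h.last) (by
        rw [polylineSet_append]
        exact Set.union_subset h3
          ((polylineSet_append A a B ▸ Set.subset_union_right).trans h.subset))
    rw [polylineLen_append A, polylineLen_append M] at this
    linarith

theorem right (h : IsShortest R s t (A ++ a :: B)) : IsShortest R a t (a :: B) where
  head := rfl
  last := (getLast?_append_cons_eq (A := []).trans h.last)
  subset := (polylineSet_append A a B ▸ Set.subset_union_right).trans h.subset
  le M h1 h2 h3 := by
    obtain ⟨M, rfl⟩ := List.head?_eq_some_iff.1 h1
    have := h.le (A ++ a :: M) (head?_append_cons_eq.trans h.head)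
      (getLast?_append_cons_eq (C := []).trans h2) (by
        rw [polylineSet_append]
        exact Set.union_subset
          ((polylineSet_append A a B ▸ Set.subset_union_left).trans h.subset) h3)
    rw [polylineLen_append A a B, polylineLen_append A a M] at this
    linarith

/-- Insert a point of a shortest polyline as a vertex. -/
theorem exists_split (h : IsShortest R s t L) (hc : List.IsChain (· ≠ ·) L) {z : Pt}
    (hz : z ∈ polylineSet L) :
    ∃ A B : List Pt, IsShortest R s t (A ++ z :: B) ∧ List.IsChain (· ≠ ·) (A ++ z :: B) ∧
      polylineSet (A ++ z :: B) = polylineSet L := by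
  obtain ⟨A, B, h1, h2, h3, h4, h5⟩ := exists_split_at hz hc
  exact ⟨A, B, ⟨h3.trans h.head, h4.trans h.last, h1 ▸ h.subset, fun M => h2 ▸ h.le M⟩, h5, h1⟩

/-- A shortest polyline does not come back to its starting point. -/
theorem notMem_tail {b : Pt} {l : List Pt} (h : IsShortest R s t (a :: b :: l)) (hab : a ≠ b)
    (hc : List.IsChain (· ≠ ·) (b :: l)) : a ∉ polylineSet (b :: l) := by
  intro ha
  obtain ⟨A, B, h1, h2, -, h4, -⟩ := exists_split_at ha hc
  have hs : s = a := by have := h.head; simp at this; exact this.symm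
  subst hs
  have := h.le (s :: B) rfl (by
    rw [← h.last, List.getLast?_cons_cons, ← h4]
    exact getLast?_append_cons_eq (A := [])) (by
    refine Set.Subset.trans ?_ h.subset
    refine Set.Subset.trans ?_ (Set.subset_union_right (s := segment ℝ s b))
    rw [← h1, polylineSet_append]
    exact Set.subset_union_right)
  have h3 := polylineLen_nonneg (A ++ [s])
  rw [polylineLen_append] at h2
  simp only [polylineLen] at this
  have := dist_pos.2 hab
  linarith

/-- The two parts of a shortest polyline meet only at the splitting vertex. -/
theorem inter_eq (h : IsShortest R s t (A ++ a :: B)) (hc : List.IsChain (· ≠ ·) (A ++ a :: B))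
    {z : Pt} (h1 : z ∈ polylineSet (A ++ [a])) (h2 : z ∈ polylineSet (a :: B)) : z = a := by
  by_contra hza
  have hcl : List.IsChain (· ≠ ·) (A ++ [a]) := by
    rw [List.isChain_append] at hc ⊢
    exact ⟨hc.1, by simp, by simpa using hc.2.2⟩
  have hcr : List.IsChain (· ≠ ·) (a :: B) := (List.isChain_append.1 hc).2.1
  obtain ⟨A1, B1, p1, p2, p3, p4, p5⟩ := exists_split_at h1 hcl
  obtain ⟨A2, B2, q1, q2, q3, q4, q5⟩ := exists_split_at h2 hcr
  have := h.le (A1 ++ z :: B2)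
    (by rw [← h.head]; exact head?_append_cons_eq.trans (p3.trans head?_append_cons_eq))
    (by rw [← h.last]; exact getLast?_append_cons_eq.trans
          (q4.trans (getLast?_append_cons_eq (A := []))))
    (by
      refine Set.Subset.trans ?_ h.subset
      rw [polylineSet_append, polylineSet_append A]
      refine Set.union_subset_union ?_ ?_
      · rw [← p1, polylineSet_append A1 z B1]; exact Set.subset_union_left
      · rw [← q1, polylineSet_append]; exact Set.subset_union_right)
  rw [polylineLen_append, polylineLen_append A1 z B2, ← p2, ← q2, polylineLen_append A1 z B1,
    polylineLen_append A2] at this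
  have h3 := polylineLen_nonneg (z :: B1)
  have h4 := polylineLen_nonneg (A2 ++ [z])
  have h5 : 0 < polylineLen (z :: B1) := by
    cases B1 with
    | nil =>
      rw [List.getLast?_append, List.getLast?_append] at p4
      simp at p4
      exact absurd p4 hza
    | cons b B1 =>
      have : z ≠ b := ((List.isChain_append.1 p5).2.1.rel)
      have := dist_pos.2 this
      have := polylineLen_nonneg (b :: B1)
      simp only [polylineLen]; linarith
  linarith

/-- Two shortest polylines through a common point of a third one can be spliced. -/
theorem splice (h : IsShortest R s t (A ++ a :: B)) {X Y : List Pt}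
    (h1 : IsShortest R s a (X ++ [a])) (h2 : IsShortest R a t (a :: Y)) :
    IsShortest R s t (X ++ a :: Y) where
  head := head?_append_cons_eq.trans h1.head
  last := getLast?_append_cons_eq (C := []).trans h2.last
  subset := by rw [polylineSet_append]; exact Set.union_subset h1.subset h2.subset
  le M m1 m2 m3 := by
    have l1 := h1.le _ h.left.head h.left.last h.left.subset
    have l2 := h2.le _ h.right.head h.right.last h.right.subset
    have := h.le M m1 m2 m3
    rw [polylineLen_append] at this ⊢
    linarith

theorem middle {z b : Pt} (h : IsShortest R s t (A ++ z :: a :: b :: B)) :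
    IsShortest R z b [z, a, b] := by
  have h1 := h.right
  rw [show z :: a :: b :: B = [z, a] ++ b :: B from rfl] at h1
  exact h1.left

end IsShortest

/-! ### Winding angles -/

/-- The point of the complex plane with the same coordinates. -/
def Pt.toComplex (p : Pt) : ℂ := ⟨p 0, p 1⟩

theorem Pt.toComplex_injective : Function.Injective Pt.toComplex := fun _ _ h =>
  Pt.ext' (congrArg Complex.re h) (congrArg Complex.im h)

theorem Pt.continuous_toComplex : Continuous Pt.toComplex := by
  have : Pt.toComplex = fun p : Pt => ((p 0 : ℝ) : ℂ) + ((p 1 : ℝ) : ℂ) * Complex.I := by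
    funext p
    apply Complex.ext <;> simp [Pt.toComplex]
  rw [this]
  fun_prop

/-- The quotient whose argument is the angle under which the segment `a b` is seen from `y`. -/
def viewQuot (a b y : Pt) : ℂ := (b.toComplex - y.toComplex) / (a.toComplex - y.toComplex)

/-- The signed angle under which the segment `a b` is seen from `y`. -/
def viewAngle (a b y : Pt) : ℝ := (viewQuot a b y).arg

theorem toComplex_sub_ne_zero {a y : Pt} (h : y ≠ a) : a.toComplex - y.toComplex ≠ 0 :=
  sub_ne_zero.2 fun h' => h (Pt.toComplex_injective h').symm

theorem viewQuot_im (a b y : Pt) :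
    (viewQuot a b y).im = det2 (b - a) (y - a) / Complex.normSq (a.toComplex - y.toComplex) := by
  simp only [viewQuot, Complex.div_im, Pt.toComplex, Complex.sub_re, Complex.sub_im, det2,
    PiLp.sub_apply]
  rw [← sub_div]
  congr 1
  ring

theorem continuousAt_viewQuot {a b y : Pt} (h : y ≠ a) : ContinuousAt (viewQuot a b) y := by
  unfold viewQuot
  exact (continuousAt_const.sub Pt.continuous_toComplex.continuousAt).div
    (continuousAt_const.sub Pt.continuous_toComplex.continuousAt) (toComplex_sub_ne_zero h)

theorem viewQuot_mem_slitPlane {a b y : Pt} (h : y ∉ segment ℝ a b) :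
    viewQuot a b y ∈ Complex.slitPlane := by
  have hya : y ≠ a := by rintro rfl; exact h (left_mem_segment ℝ _ _)
  rw [Complex.mem_slitPlane_iff]
  by_contra! hq
  obtain ⟨h1, h2⟩ := hq
  apply h
  set t := (viewQuot a b y).re with ht
  have hq : viewQuot a b y = (t : ℂ) := Complex.ext rfl h2
  have h3 : b.toComplex - y.toComplex = t * (a.toComplex - y.toComplex) := by
    rw [← hq, viewQuot, div_mul_cancel₀ _ (toComplex_sub_ne_zero hya)]
  have hre := congrArg Complex.re h3
  have him := congrArg Complex.im h3
  simp [Pt.toComplex] at hre him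
  have hp : 0 < 1 - t := by linarith
  refine ⟨-t / (1 - t), 1 / (1 - t), div_nonneg (by linarith) hp.le, by positivity, ?_, ?_⟩
  · field_simp; ring
  · refine Pt.ext' ?_ ?_ <;>
    · simp only [PiLp.add_apply, PiLp.smul_apply, smul_eq_mul]
      field_simp
      linarith

theorem continuousAt_viewAngle {a b y : Pt} (h : y ∉ segment ℝ a b) :
    ContinuousAt (viewAngle a b) y := by
  have hya : y ≠ a := by rintro rfl; exact h (left_mem_segment ℝ _ _)
  exact (Complex.continuousAt_arg (viewQuot_mem_slitPlane h)).comp (continuousAt_viewQuot hya)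

theorem viewAngle_coe {a b y : Pt} (h : y ∉ segment ℝ a b) :
    (viewAngle a b y : Real.Angle) =
      (b.toComplex - y.toComplex).arg - (a.toComplex - y.toComplex).arg := by
  have hya : y ≠ a := by rintro rfl; exact h (left_mem_segment ℝ _ _)
  have hyb : y ≠ b := by rintro rfl; exact h (right_mem_segment ℝ _ _)
  exact Complex.arg_div_coe_angle (toComplex_sub_ne_zero hyb) (toComplex_sub_ne_zero hya)

theorem viewAngle_symm {a b y : Pt} (h : y ∉ segment ℝ a b) :
    viewAngle b a y = -viewAngle a b y := by
  have : viewQuot b a y = (viewQuot a b y)⁻¹ := by simp [viewQuot]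
  rw [viewAngle, this, Complex.arg_inv, if_neg, viewAngle]
  exact (Complex.mem_slitPlane_iff_arg.1 (viewQuot_mem_slitPlane h)).1

theorem tendsto_viewAngle_cocompact (a b : Pt) :
    Filter.Tendsto (viewAngle a b) (Filter.cocompact Pt) (nhds 0) := by
  have h1 : Filter.Tendsto (fun y : Pt => a.toComplex - y.toComplex) (Filter.cocompact Pt)
      (Filter.cocompact ℂ) := by
    rw [← Metric.cobounded_eq_cocompact, ← Metric.cobounded_eq_cocompact,
      ← tendsto_norm_atTop_iff_cobounded]
    have h : Filter.Tendsto (fun y : Pt => ‖y - a‖) (Bornology.cobounded Pt) Filter.atTop :=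
      (Metric.tendsto_dist_right_cobounded_atTop a).congr fun y => dist_eq_norm y a
    refine h.congr fun y => ?_
    rw [EuclideanSpace.norm_eq, Complex.norm_eq_sqrt_sq_add_sq]
    congr 1
    simp [Pt.toComplex, Fin.sum_univ_two]
    ring
  have h2 : Filter.Tendsto (viewQuot a b) (Filter.cocompact Pt) (nhds 1) := by
    have h3 : Filter.Tendsto (fun y : Pt => 1 + (b.toComplex - a.toComplex) *
        (a.toComplex - y.toComplex)⁻¹) (Filter.cocompact Pt) (nhds (1 + (b.toComplex -
          a.toComplex) * 0)) :=
      tendsto_const_nhds.add (tendsto_const_nhds.mul ((Filter.tendsto_inv₀_cobounded (α := ℂ)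
        |>.comp (by rwa [Metric.cobounded_eq_cocompact]))))
    simp only [mul_zero, add_zero] at h3
    refine h3.congr' ?_
    have : ∀ᶠ y in Filter.cocompact Pt, y ∈ ({a} : Set Pt)ᶜ :=
      isCompact_singleton.compl_mem_cocompact
    filter_upwards [this] with y hy
    have := toComplex_sub_ne_zero (a := a) (y := y) hy
    rw [viewQuot]
    field_simp
    ring
  have := (Complex.continuousAt_arg Complex.one_mem_slitPlane).tendsto.comp h2
  rwa [Complex.arg_one] at this

theorem viewQuot_of_mem_openSegment {a b m : Pt} (hab : a ≠ b) (hm : m ∈ openSegment ℝ a b) :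
    (viewQuot a b m).re < 0 ∧ (viewQuot a b m).im = 0 := by
  obtain ⟨s, t, hs, ht, hst, rfl⟩ := hm
  have hq : viewQuot a b (s • a + t • b) = ((-(s / t) : ℝ) : ℂ) := by
    have hne : s • a + t • b ≠ a := by
      intro h
      have : t • (b - a) = 0 := by
        have hs' : s = 1 - t := by linarith
        rw [← sub_eq_zero.2 h, hs']; module
      rcases smul_eq_zero.1 this with h | h
      · exact ht.ne' h
      · exact hab (sub_eq_zero.1 h).symm
    rw [viewQuot, div_eq_iff (toComplex_sub_ne_zero hne)]
    have hs' : s = 1 - t := by linarith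
    apply Complex.ext <;>
    · simp [Pt.toComplex]
      field_simp
      rw [hs']; ring
  rw [hq]
  refine ⟨?_, Complex.ofReal_im _⟩
  rw [Complex.ofReal_re]
  have : 0 < s / t := by positivity
  linarith

theorem tendsto_viewAngle_left {a b m : Pt} (hab : a ≠ b) (hm : m ∈ openSegment ℝ a b) :
    Filter.Tendsto (viewAngle a b) (nhdsWithin m {y | 0 < det2 (b - a) (y - a)})
      (nhds Real.pi) := by
  obtain ⟨h1, h2⟩ := viewQuot_of_mem_openSegment hab hm
  have hma : m ≠ a := by
    rintro rfl; exact hab (left_mem_openSegment_iff.1 hm)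
  refine (Complex.tendsto_arg_nhdsWithin_im_nonneg_of_re_neg_of_im_zero h1 h2).comp ?_
  refine tendsto_nhdsWithin_iff.2 ⟨(continuousAt_viewQuot hma).mono_left nhdsWithin_le_nhds, ?_⟩
  filter_upwards [self_mem_nhdsWithin] with y hy
  show 0 ≤ _
  rw [viewQuot_im]
  exact div_nonneg (le_of_lt hy) (Complex.normSq_nonneg _)

theorem tendsto_viewAngle_right {a b m : Pt} (hab : a ≠ b) (hm : m ∈ openSegment ℝ a b) :
    Filter.Tendsto (viewAngle a b) (nhdsWithin m {y | det2 (b - a) (y - a) < 0})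
      (nhds (-Real.pi)) := by
  obtain ⟨h1, h2⟩ := viewQuot_of_mem_openSegment hab hm
  have hma : m ≠ a := by
    rintro rfl; exact hab (left_mem_openSegment_iff.1 hm)
  refine (Complex.tendsto_arg_nhdsWithin_im_neg_of_re_neg_of_im_zero h1 h2).comp ?_
  refine tendsto_nhdsWithin_iff.2 ⟨(continuousAt_viewQuot hma).mono_left nhdsWithin_le_nhds, ?_⟩
  filter_upwards [self_mem_nhdsWithin] with y hy
  show _ < 0
  rw [viewQuot_im]
  have hya : y ≠ a := by
    rintro rfl
    simp [det2] at hy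
  exact div_neg_of_neg_of_pos hy (Complex.normSq_pos.2 (toComplex_sub_ne_zero hya))

/-- The total signed angle under which a polyline is seen from `y`. -/
def polylineAngle : List Pt → Pt → ℝ
  | [], _ => 0
  | [_], _ => 0
  | a :: b :: l, y => viewAngle a b y + polylineAngle (b :: l) y

theorem polylineAngle_append (A : List Pt) (a : Pt) (B : List Pt) (y : Pt) :
    polylineAngle (A ++ a :: B) y = polylineAngle (A ++ [a]) y + polylineAngle (a :: B) y := by
  induction A with
  | nil => simp [polylineAngle]
  | cons c A ih =>
    cases A with
    | nil => simp [polylineAngle]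
    | cons d A =>
      simp only [List.cons_append, polylineAngle] at ih ⊢
      rw [ih]; ring

theorem polylineAngle_reverse {L : List Pt} {y : Pt} (h : y ∉ polylineSet L) :
    polylineAngle L.reverse y = -polylineAngle L y := by
  induction L with
  | nil => simp [polylineAngle]
  | cons a l ih =>
    cases l with
    | nil => simp [polylineAngle]
    | cons b l =>
      simp only [polylineSet, Set.mem_union, not_or] at h
      rw [List.reverse_cons, List.reverse_cons, List.append_assoc, List.singleton_append,
        polylineAngle_append, ← List.reverse_cons, ih h.2]
      simp only [polylineAngle, viewAngle_symm h.1]; ring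

theorem continuousAt_polylineAngle {L : List Pt} {y : Pt} (h : y ∉ polylineSet L) :
    ContinuousAt (polylineAngle L) y := by
  induction L with
  | nil => exact continuousAt_const
  | cons a l ih =>
    cases l with
    | nil => exact continuousAt_const
    | cons b l =>
      simp only [polylineSet, Set.mem_union, not_or] at h
      exact (continuousAt_viewAngle h.1).add (ih h.2)

theorem polylineAngle_coe {L : List Pt} {s t y : Pt} (h : y ∉ polylineSet L)
    (hs : L.head? = some s) (ht : L.getLast? = some t) :
    (polylineAngle L y : Real.Angle) =
      (t.toComplex - y.toComplex).arg - (s.toComplex - y.toComplex).arg := by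
  induction L generalizing s with
  | nil => simp at hs
  | cons a l ih =>
    cases l with
    | nil =>
      simp at hs ht
      subst hs ht
      simp [polylineAngle]
    | cons b l =>
      simp only [polylineSet, Set.mem_union, not_or] at h
      simp only [List.head?_cons, Option.some.injEq] at hs
      subst hs
      rw [List.getLast?_cons_cons] at ht
      simp only [polylineAngle, Real.Angle.coe_add]
      rw [viewAngle_coe h.1, ih h.2 rfl ht]
      abel

theorem tendsto_polylineAngle_cocompact (L : List Pt) :
    Filter.Tendsto (polylineAngle L) (Filter.cocompact Pt) (nhds 0) := by
  induction L with
  | nil => exact tendsto_const_nhds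
  | cons a l ih =>
    cases l with
    | nil => exact tendsto_const_nhds
    | cons b l =>
      have := (tendsto_viewAngle_cocompact a b).add ih
      rw [add_zero] at this
      exact this

/-! ### Extreme points of open sets bounded by polylines -/

/-- Near `e`, the set `K` is contained in the two rays from `e` with directions `d₁`, `d₂`. -/
def LocRays (K : Set Pt) (e d₁ d₂ : Pt) : Prop :=
  ∃ r > 0, ∀ y ∈ K, dist y e < r → ∃ t : ℝ, 0 ≤ t ∧ (y = e + t • d₁ ∨ y = e + t • d₂)

/-- The open sector at `e` spanned by `d₁`, `d₂` contains points outside `R` close to `e`. -/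
def Tight (R : Set Pt) (e d₁ d₂ : Pt) : Prop :=
  ∀ ε > 0, ∃ α β : ℝ, 0 < α ∧ α < ε ∧ 0 < β ∧ β < ε ∧ e + α • d₁ + β • d₂ ∉ R

/-- Near `e`, the set `K` lies on a line, or on two rays spanning a tight sector. -/
def GoodAt (R K : Set Pt) (e : Pt) : Prop :=
  ∃ d₁ d₂ : Pt, d₁ ≠ 0 ∧ LocRays K e d₁ d₂ ∧
    (d₂ = -d₁ ∨ (det2 d₁ d₂ ≠ 0 ∧ Tight R e d₁ d₂))

theorem LocRays.symm {K : Set Pt} {e d₁ d₂ : Pt} (h : LocRays K e d₁ d₂) :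
    LocRays K e d₂ d₁ := by
  obtain ⟨r, hr, h⟩ := h
  refine ⟨r, hr, fun y hy hd => ?_⟩
  obtain ⟨t, ht, h⟩ := h y hy hd
  exact ⟨t, ht, h.symm⟩

theorem Tight.symm {R : Set Pt} {e d₁ d₂ : Pt} (h : Tight R e d₁ d₂) : Tight R e d₂ d₁ := by
  intro ε hε
  obtain ⟨α, β, h1, h2, h3, h4, h5⟩ := h ε hε
  exact ⟨β, α, h3, h4, h1, h2, by rwa [add_right_comm]⟩

theorem LocRays.congr {K K' : Set Pt} {e d₁ d₂ : Pt} (h : LocRays K e d₁ d₂)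
    (hK : ∃ r > 0, ∀ y ∈ K', dist y e < r → y ∈ K) : LocRays K' e d₁ d₂ := by
  obtain ⟨r, hr, h⟩ := h
  obtain ⟨r', hr', h'⟩ := hK
  exact ⟨min r r', lt_min hr hr', fun y hy hd =>
    h y (h' y hy (hd.trans_le (min_le_right _ _))) (hd.trans_le (min_le_left _ _))⟩

theorem GoodAt.congr {R K K' : Set Pt} {e : Pt} (h : GoodAt R K e)
    (hK : ∃ r > 0, ∀ y ∈ K', dist y e < r → y ∈ K) : GoodAt R K' e := by
  obtain ⟨d₁, d₂, h1, h2, h3⟩ := h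
  exact ⟨d₁, d₂, h1, h2.congr hK, h3⟩

theorem convex_det2_pos (d e : Pt) : Convex ℝ {y : Pt | 0 < det2 d (y - e)} := by
  intro x hx y hy a b ha hb hab
  simp only [Set.mem_ofPred_eq] at *
  have : det2 d (a • x + b • y - e) = a * det2 d (x - e) + b * det2 d (y - e) := by
    obtain rfl : b = 1 - a := by linarith
    simp [det2]; ring
  rw [this]
  rcases ha.eq_or_lt with rfl | ha'
  · have : b = 1 := by linarith
    rw [this]; linarith
  · exact add_pos_of_pos_of_nonneg (mul_pos ha' hx) (mul_nonneg hb hy.le)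

/-- A half disc in `D` prevents its centre from being extreme. -/
theorem not_extreme_of_half_disc {D : Set Pt} {e d : Pt} (hd : d ≠ 0) {r : ℝ} (hr : 0 < r)
    (h : Metric.ball e r ∩ {y | 0 < det2 d (y - e)} ⊆ D) :
    e ∉ (convexHull ℝ (closure D)).extremePoints ℝ := by
  intro he
  obtain ⟨v, hv⟩ := exists_det2_pos hd
  have key : ∀ t : ℝ, |t| * ‖d‖ < r → e + t • d ∈ closure D := by
    intro t ht
    have hc : Filter.Tendsto (fun ε : ℝ => e + t • d + ε • v) (nhdsWithin 0 (Set.Ioi 0))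
        (nhds (e + t • d)) := by
      have : Continuous fun ε : ℝ => e + t • d + ε • v := by fun_prop
      have := this.tendsto 0
      simp only [zero_smul, add_zero] at this
      exact this.mono_left nhdsWithin_le_nhds
    refine mem_closure_of_tendsto hc ?_
    have hb : e + t • d ∈ Metric.ball e r := by
      rw [Metric.mem_ball, dist_eq_norm, add_sub_cancel_left, norm_smul]; exact ht
    filter_upwards [hc.eventually (Metric.isOpen_ball.mem_nhds hb), self_mem_nhdsWithin]
      with ε h1 h2
    refine h ⟨h1, ?_⟩
    have h3 : det2 d (e + t • d + ε • v - e) = ε * det2 d v := by simp [det2]; ring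
    rw [Set.mem_ofPred_eq, h3]
    exact mul_pos h2 hv
  have hdn : 0 < ‖d‖ := norm_pos_iff.2 hd
  set t := r / (2 * ‖d‖) with ht
  have htp : 0 < t := by positivity
  have htd : t * ‖d‖ < r := by rw [ht]; field_simp; norm_num
  have m1 := subset_convexHull ℝ _ (key t (by rwa [abs_of_pos htp]))
  have m2 := subset_convexHull ℝ _ (key (-t) (by rwa [abs_neg, abs_of_pos htp]))
  have := he.2 m1 m2 ⟨1 / 2, 1 / 2, by norm_num, by norm_num, by norm_num, by module⟩
  have h0 : t • d = 0 := by simpa using this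
  exact (smul_ne_zero htp.ne' hd) h0

/-- A convex set off `K` is inside or outside of `D`. -/
theorem subset_or_disjoint_of_convex {D K W : Set Pt} (hD : IsOpen D)
    (hco : IsOpen (Dᶜ \ K)) (hW : Convex ℝ W) (hWK : Disjoint W K) : W ⊆ D ∨ Disjoint W D := by
  by_contra! h
  obtain ⟨h1, h2⟩ := h
  rw [Set.not_disjoint_iff] at h2
  obtain ⟨y, hy, hyD⟩ := h2
  apply h1
  refine hW.isPreconnected.subset_left_of_subset_union hD hco ?_ ?_ ⟨y, hy, hyD⟩
  · exact Set.disjoint_left.2 fun z hz hz' => hz'.1 hz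
  · intro z hz
    by_cases hzD : z ∈ D
    · exact Or.inl hzD
    · exact Or.inr ⟨hzD, Set.disjoint_left.1 hWK hz⟩

theorem mem_of_extreme {D K : Set Pt} (hD : IsOpen D) (hco : IsOpen (Dᶜ \ K)) {e : Pt}
    (he : e ∈ (convexHull ℝ (closure D)).extremePoints ℝ) : e ∈ K := by
  have hcl : e ∈ closure D := extremePoints_convexHull_subset he
  by_contra hK
  by_cases heD : e ∈ D
  · obtain ⟨r, hr, hb⟩ := Metric.isOpen_iff.1 hD e heD
    have h0 : (!₂[1, 0] : Pt) ≠ 0 := by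
      intro h
      have := congrArg (fun p : Pt => p 0) h
      simp at this
    exact not_extreme_of_half_disc h0 hr (Set.inter_subset_left.trans hb) he
  · obtain ⟨z, hz, hz'⟩ := mem_closure_iff.1 hcl _ hco ⟨heD, hK⟩
    exact absurd hz' hz.1

/-- An open set with points on the boundary of an open half plane has points in it. -/
theorem exists_mem_det2_pos {D : Set Pt} (hD : IsOpen D) {d e y : Pt} (hd : d ≠ 0) (hy : y ∈ D)
    (h : 0 ≤ det2 d (y - e)) : ∃ z ∈ D, 0 < det2 d (z - e) := by
  obtain ⟨v, hv⟩ := exists_det2_pos hd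
  have hc : Filter.Tendsto (fun ε : ℝ => y + ε • v) (nhdsWithin 0 (Set.Ioi 0)) (nhds y) := by
    have : Continuous fun ε : ℝ => y + ε • v := by fun_prop
    have := this.tendsto 0
    simp only [zero_smul, add_zero] at this
    exact this.mono_left nhdsWithin_le_nhds
  obtain ⟨ε, h1, h2⟩ := ((hc.eventually (hD.mem_nhds hy)).and self_mem_nhdsWithin).exists
  refine ⟨y + ε • v, h1, ?_⟩
  have h3 : det2 d (y + ε • v - e) = det2 d (y - e) + ε * det2 d v := by simp [det2]; ring
  rw [h3]
  exact add_pos_of_nonneg_of_pos h (mul_pos h2 hv)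

theorem det2_neg_left (u v : Pt) : det2 (-u) v = -det2 u v := by simp [det2]; ring

theorem det2_neg_right (u v : Pt) : det2 u (-v) = -det2 u v := by simp [det2]; ring

theorem det2_self (u : Pt) : det2 u u = 0 := by simp [det2]; ring

theorem det2_smul_right (u v : Pt) (t : ℝ) : det2 u (t • v) = t * det2 u v := by
  simp [det2]; ring

theorem det2_smul_left (u v : Pt) (t : ℝ) : det2 (t • u) v = t * det2 u v := by
  simp [det2]; ring

/-- At an extreme point, `D` does not contain points of an open half plane missing `K`. -/
theorem half_disc_disjoint {D K : Set Pt} (hD : IsOpen D)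
    (hco : IsOpen (Dᶜ \ K)) {e : Pt} (he : e ∈ (convexHull ℝ (closure D)).extremePoints ℝ)
    {d : Pt} (hd : d ≠ 0) {r : ℝ} (hr : 0 < r)
    (hK : ∀ y ∈ K, dist y e < r → det2 d (y - e) ≤ 0) :
    ∀ y ∈ D, dist y e < r → det2 d (y - e) < 0 := by
  have hcv : Convex ℝ (Metric.ball e r ∩ {y : Pt | 0 < det2 d (y - e)}) :=
    (convex_ball e r).inter (convex_det2_pos d e)
  have hdis : Disjoint (Metric.ball e r ∩ {y : Pt | 0 < det2 d (y - e)}) D := by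
    refine (subset_or_disjoint_of_convex hD hco hcv ?_).resolve_left fun h =>
      not_extreme_of_half_disc hd hr h he
    exact Set.disjoint_left.2 fun y hy hyK => (hK y hyK hy.1).not_gt hy.2
  intro y hy hyr
  by_contra! h
  obtain ⟨z, hz, hz'⟩ := exists_mem_det2_pos (hD.inter Metric.isOpen_ball) hd
    (⟨hy, hyr⟩ : y ∈ D ∩ Metric.ball e r) h
  exact Set.disjoint_left.1 hdis ⟨hz.2, hz'⟩ hz.1

theorem exists_mem_near_extreme {D : Set Pt} {e : Pt}
    (he : e ∈ (convexHull ℝ (closure D)).extremePoints ℝ) {r : ℝ} (hr : 0 < r) :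
    ∃ y ∈ D, dist y e < r := by
  obtain ⟨y, hy, h⟩ := Metric.mem_closure_iff.1 (extremePoints_convexHull_subset he) r hr
  exact ⟨y, hy, by rwa [dist_comm]⟩

theorem extreme_not_straight {D K : Set Pt} (hD : IsOpen D)
    (hco : IsOpen (Dᶜ \ K)) {e : Pt} (he : e ∈ (convexHull ℝ (closure D)).extremePoints ℝ)
    {d : Pt} (hd : d ≠ 0) : ¬ LocRays K e d (-d) := by
  rintro ⟨r, hr, h⟩
  have hz : ∀ y ∈ K, dist y e < r → det2 d (y - e) = 0 := by
    intro y hy hyr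
    obtain ⟨t, -, rfl | rfl⟩ := h y hy hyr <;>
    simp [det2_smul_right, det2_neg_right, det2_self]
  obtain ⟨y, hy, hyr⟩ := exists_mem_near_extreme he hr
  have h1 := half_disc_disjoint hD hco he hd hr (fun y hy hyr => (hz y hy hyr).le) y hy hyr
  have h2 := half_disc_disjoint hD hco he (neg_ne_zero.2 hd) hr
    (fun y hy hyr => by rw [det2_neg_left, hz y hy hyr, neg_zero]) y hy hyr
  rw [det2_neg_left] at h2
  linarith

/-- At an extreme point with two non-parallel boundary rays, `D` is locally the convex sector. -/
theorem extreme_local {D K : Set Pt} (hD : IsOpen D)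
    (hco : IsOpen (Dᶜ \ K)) {e : Pt} (he : e ∈ (convexHull ℝ (closure D)).extremePoints ℝ)
    {d₁ d₂ : Pt} (hd : 0 < det2 d₁ d₂) (h : LocRays K e d₁ d₂) :
    ∃ r > 0, ∀ y, dist y e < r → (y ∈ D ↔ 0 < det2 d₁ (y - e) ∧ 0 < det2 (y - e) d₂) := by
  obtain ⟨r, hr, h⟩ := h
  have hd1 : d₁ ≠ 0 := by rintro rfl; simp [det2] at hd
  have hd2 : d₂ ≠ 0 := by rintro rfl; simp [det2] at hd
  have h1 : ∀ y ∈ D, dist y e < r → 0 < det2 d₁ (y - e) := by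
    intro y hy hyr
    have := half_disc_disjoint hD hco he (neg_ne_zero.2 hd1) hr (fun y hy hyr => ?_) y hy hyr
    · rw [det2_neg_left] at this; linarith
    · obtain ⟨t, ht, rfl | rfl⟩ := h y hy hyr
      · simp [det2_smul_right, det2_neg_left, det2_self]
      · simp only [add_sub_cancel_left, det2_smul_right, det2_neg_left]
        nlinarith
  have h2 : ∀ y ∈ D, dist y e < r → 0 < det2 (y - e) d₂ := by
    intro y hy hyr
    have := half_disc_disjoint hD hco he hd2 hr (fun y hy hyr => ?_) y hy hyr
    · rw [det2_swap] at this; linarith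
    · obtain ⟨t, ht, rfl | rfl⟩ := h y hy hyr
      · simp only [add_sub_cancel_left, det2_smul_right]
        rw [det2_swap]
        nlinarith
      · simp [det2_smul_right, det2_self]
  refine ⟨r, hr, fun y hyr => ⟨fun hy => ⟨h1 y hy hyr, h2 y hy hyr⟩, fun hy => ?_⟩⟩
  have hcv : Convex ℝ (Metric.ball e r ∩
      ({y : Pt | 0 < det2 d₁ (y - e)} ∩ {y : Pt | 0 < det2 (-d₂) (y - e)})) :=
    (convex_ball e r).inter ((convex_det2_pos _ e).inter (convex_det2_pos _ e))
  have hsw : ∀ y, det2 (-d₂) (y - e) = det2 (y - e) d₂ := fun y => by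
    rw [det2_neg_left, ← det2_swap]
  obtain ⟨z, hz, hzr⟩ := exists_mem_near_extreme he hr
  have hdis : Disjoint (Metric.ball e r ∩
      ({y : Pt | 0 < det2 d₁ (y - e)} ∩ {y : Pt | 0 < det2 (-d₂) (y - e)})) K := by
    refine Set.disjoint_left.2 fun y hy hyK => ?_
    obtain ⟨hy1, hy2, hy3⟩ := hy
    obtain ⟨t, ht, rfl | rfl⟩ := h y hyK hy1
    · simp [det2_smul_right, det2_self] at hy2
    · simp [det2_smul_right, det2_neg_left, det2_self] at hy3
  rcases subset_or_disjoint_of_convex hD hco hcv hdis with hs | hs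
  · exact hs ⟨hyr, hy.1, by rw [Set.mem_ofPred_eq, hsw]; exact hy.2⟩
  · exact absurd hz (Set.disjoint_left.1 hs
      ⟨hzr, h1 z hz hzr, by rw [Set.mem_ofPred_eq, hsw]; exact h2 z hz hzr⟩)

theorem det2_sector {d₁ d₂ e : Pt} {α β : ℝ} :
    det2 d₁ (e + α • d₁ + β • d₂ - e) = β * det2 d₁ d₂ ∧
      det2 (e + α • d₁ + β • d₂ - e) d₂ = α * det2 d₁ d₂ := by
  constructor <;> simp [det2] <;> ring

theorem exists_sector_near {e d₁ d₂ : Pt} {r : ℝ} (hr : 0 < r) :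
    ∃ ε > 0, ∀ α β : ℝ, 0 < α → α < ε → 0 < β → β < ε → dist (e + α • d₁ + β • d₂) e < r := by
  refine ⟨r / (‖d₁‖ + ‖d₂‖ + 1), by positivity, fun α β h1 h2 h3 h4 => ?_⟩
  rw [dist_eq_norm, show e + α • d₁ + β • d₂ - e = α • d₁ + β • d₂ by abel]
  refine (norm_add_le _ _).trans_lt ?_
  rw [norm_smul, norm_smul, Real.norm_of_nonneg h1.le, Real.norm_of_nonneg h3.le]
  rw [lt_div_iff₀ (by positivity)] at h2 h4
  have := norm_nonneg d₁
  have := norm_nonneg d₂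
  rcases le_total α β with h | h
  · nlinarith
  · nlinarith

/-- Extreme points of a subset of `R` are not good. -/
theorem extreme_not_goodAt {R D K : Set Pt} (hD : IsOpen D)
    (hco : IsOpen (Dᶜ \ K)) (hDR : D ⊆ R) {e : Pt}
    (he : e ∈ (convexHull ℝ (closure D)).extremePoints ℝ) : ¬ GoodAt R K e := by
  rintro ⟨d₁, d₂, h1, h2, rfl | ⟨h3, h4⟩⟩
  · exact extreme_not_straight hD hco he h1 h2
  · wlog h5 : 0 < det2 d₁ d₂ generalizing d₁ d₂
    · refine this d₂ d₁ ?_ h2.symm ?_ h4.symm ?_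
      · rintro rfl; simp [det2] at h3
      · rw [det2_swap]; exact neg_ne_zero.2 h3
      · rw [det2_swap]
        rcases h3.lt_or_gt with h | h
        · linarith
        · exact absurd h h5
    obtain ⟨r, hr, h6⟩ := extreme_local hD hco he h5 h2
    obtain ⟨ε, hε, h7⟩ := exists_sector_near (e := e) (d₁ := d₁) (d₂ := d₂) hr
    obtain ⟨α, β, a1, a2, b1, b2, h8⟩ := h4 ε hε
    refine h8 (hDR ((h6 _ (h7 α β a1 a2 b1 b2)).2 ?_))
    rw [det2_sector.1, det2_sector.2]
    exact ⟨mul_pos b1 h5, mul_pos a1 h5⟩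

/-- A bounded nonempty open set has an extreme point of its hull avoiding two given points. -/
theorem exists_extreme {D : Set Pt} (hD : IsOpen D) (hb : Bornology.IsBounded D)
    (hne : D.Nonempty) (p q : Pt) :
    ∃ e ∈ (convexHull ℝ (closure D)).extremePoints ℝ, e ≠ p ∧ e ≠ q := by
  obtain ⟨u, hu, hu'⟩ : ∃ u : Pt, u ≠ 0 ∧ det2 u q = det2 u p := by
    by_cases hpq : p = q
    · refine ⟨!₂[1, 0], ?_, by rw [hpq]⟩
      intro h
      have := congrArg (fun p : Pt => p 0) h
      simp at this
    · refine ⟨q - p, sub_ne_zero.2 (Ne.symm hpq), ?_⟩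
      simp [det2]; ring
  obtain ⟨z, hz, hz'⟩ : ∃ z ∈ D, det2 u z ≠ det2 u p := by
    obtain ⟨y, hy⟩ := hne
    by_contra! h
    obtain ⟨z, hz, hz'⟩ := exists_mem_det2_pos (e := y) hD hu hy (by simp [det2])
    have := (h z hz).trans (h y hy).symm
    simp only [det2, PiLp.sub_apply] at hz' this
    linarith
  wlog hpos : det2 u p < det2 u z generalizing u
  · refine this (-u) (neg_ne_zero.2 hu) ?_ ?_ ?_ <;> simp only [det2_neg_left]
    · rw [hu']
    · exact fun h => hz' (neg_injective h)
    · exact neg_lt_neg (lt_of_le_of_ne (not_lt.1 hpos) hz')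
  have hlim : ∀ x : Pt, det2 u x < det2 u z → ∀ᶠ T : ℝ in Filter.atTop,
      dist x (T • !₂[u 1, -u 0]) < dist z (T • !₂[u 1, -u 0]) := by
    intro x hx
    filter_upwards [Filter.eventually_gt_atTop (((x 0) ^ 2 + (x 1) ^ 2 - (z 0) ^ 2 - (z 1) ^ 2) /
      (2 * (det2 u z - det2 u x)))] with T hT
    rw [div_lt_iff₀ (by linarith)] at hT
    rw [EuclideanSpace.dist_eq, EuclideanSpace.dist_eq]
    apply Real.sqrt_lt_sqrt (by positivity)
    simp [Fin.sum_univ_two, Real.dist_eq, sq_abs, det2] at hT ⊢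
    linarith
  obtain ⟨T, hT1, hT2⟩ := ((hlim p hpos).and (hlim q (by rwa [hu']))).exists
  set c : Pt := T • !₂[u 1, -u 0]
  obtain ⟨e, he, hmax⟩ := hb.isCompact_closure.exists_isMaxOn (hne.mono subset_closure)
    (f := fun y => dist y c) (by fun_prop)
  have hze : dist z c ≤ dist e c := hmax (subset_closure hz)
  refine ⟨e, mem_extremePoints_iff_left.2 ⟨subset_convexHull ℝ _ he, ?_⟩, ?_, ?_⟩
  · have hCb : convexHull ℝ (closure D) ⊆ Metric.closedBall c (dist e c) :=
      convexHull_min (fun y hy => hmax hy) (convex_closedBall _ _)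
    intro x₁ hx₁ x₂ hx₂ hx
    by_contra hne'
    have h12 : x₁ ≠ x₂ := by
      rintro rfl
      rw [openSegment_same] at hx
      exact hne' hx.symm
    exact lt_irrefl _ (Metric.mem_ball.1
      (openSegment_subset_ball_of_ne (hCb hx₁) (hCb hx₂) h12 hx))
  · rintro rfl; exact absurd hze hT1.not_ge
  · rintro rfl; exact absurd hze hT2.not_ge

/-! ### Winding functions of closed polylines -/

/-- `F` is a continuous multiple of the winding number of a closed curve with trace `K`,
where `K` is contained in `R`. -/
structure IsLoop (R K : Set Pt) (F : Pt → ℝ) : Prop where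
  isClosed : IsClosed K
  subset : K ⊆ R
  cont : ∀ y ∉ K, ContinuousAt F y
  coe : ∀ y ∉ K, (F y : Real.Angle) = 0
  lim : Filter.Tendsto F (Filter.cocompact Pt) (nhds 0)

/-- The complement of `R` is connected and unbounded. -/
def FullSet (R : Set Pt) : Prop := IsPreconnected Rᶜ ∧ ¬ Bornology.IsBounded Rᶜ

namespace IsLoop

variable {R K : Set Pt} {F : Pt → ℝ}

theorem neg (h : IsLoop R K F) : IsLoop R K fun y => -F y where
  isClosed := h.isClosed
  subset := h.subset
  cont y hy := (h.cont y hy).neg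
  coe y hy := by rw [Real.Angle.coe_neg, h.coe y hy, neg_zero]
  lim := by simpa using h.lim.neg

theorem two_pi_le (h : IsLoop R K F) {y : Pt} (hy : y ∉ K) (hF : 0 < F y) :
    2 * Real.pi ≤ F y := by
  obtain ⟨n, hn⟩ := Real.Angle.coe_eq_zero_iff.1 (h.coe y hy)
  rw [zsmul_eq_mul] at hn
  have hpi := Real.pi_pos
  have h1 : 0 < n := by
    have : (0 : ℝ) < n := by
      by_contra! hc
      nlinarith
    exact_mod_cast this
  have h2 : (1 : ℝ) ≤ n := by exact_mod_cast h1
  nlinarith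

theorem eventually_cocompact (h : IsLoop R K F) :
    ∀ᶠ y in Filter.cocompact Pt, y ∉ K → F y ≤ 0 := by
  filter_upwards [h.lim.eventually (gt_mem_nhds Real.two_pi_pos)] with y hy hK
  by_contra! hc
  exact hy.not_ge (h.two_pi_le hK hc)

theorem nonpos_of_notMem (h : IsLoop R K F) (hR : FullSet R) {y : Pt} (hy : y ∉ R) :
    F y ≤ 0 := by
  by_contra! hc
  obtain ⟨y₀, h1, h2⟩ : ∃ y₀ ∈ Rᶜ, F y₀ ≤ 0 := by
    by_contra! hn
    apply hR.2
    have := h.eventually_cocompact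
    rw [← Metric.cobounded_eq_cocompact] at this
    rw [Bornology.isBounded_def]
    filter_upwards [this] with z hz hz'
    exact (hn z hz').not_ge (hz fun hK => hz' (h.subset hK))
  have hcont : ContinuousOn F Rᶜ := fun z hz =>
    (h.cont z fun hK => hz (h.subset hK)).continuousWithinAt
  have hpi := Real.pi_pos
  have := h.two_pi_le (fun hK => hy (h.subset hK)) hc
  obtain ⟨z, hz, hFz⟩ := hR.1.intermediate_value h1 hy hcont
    (⟨by linarith, by linarith⟩ : Real.pi ∈ Set.Icc (F y₀) (F y))
  have := h.coe z fun hK => hz (h.subset hK)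
  rw [hFz] at this
  exact Real.Angle.pi_ne_zero this

theorem isOpen_pos (h : IsLoop R K F) : IsOpen {y | y ∉ K ∧ 0 < F y} := by
  rw [isOpen_iff_mem_nhds]
  rintro y ⟨hy, hF⟩
  filter_upwards [h.isClosed.isOpen_compl.mem_nhds hy,
    (h.cont y hy).eventually (lt_mem_nhds hF)] with z h1 h2
  exact ⟨h1, h2⟩

theorem isOpen_nonpos (h : IsLoop R K F) : IsOpen ({y | y ∉ K ∧ 0 < F y}ᶜ \ K) := by
  rw [isOpen_iff_mem_nhds]
  rintro y ⟨h1, hy⟩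
  have hF : F y < 2 * Real.pi := by
    by_contra! hc
    exact h1 ⟨hy, Real.two_pi_pos.trans_le hc⟩
  filter_upwards [h.isClosed.isOpen_compl.mem_nhds hy,
    (h.cont y hy).eventually (gt_mem_nhds hF)] with z h2 h3
  exact ⟨fun h4 => h3.not_ge (h.two_pi_le h4.1 h4.2), h2⟩

theorem isBounded_pos (h : IsLoop R K F) : Bornology.IsBounded {y | y ∉ K ∧ 0 < F y} := by
  have := h.eventually_cocompact
  rw [← Metric.cobounded_eq_cocompact] at this
  rw [Bornology.isBounded_def]
  filter_upwards [this] with y hy hy'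
  exact (hy hy'.1).not_gt hy'.2

theorem pos_subset (h : IsLoop R K F) (hR : FullSet R) : {y | y ∉ K ∧ 0 < F y} ⊆ R := by
  rintro y ⟨-, hy⟩
  by_contra hc
  exact (h.nonpos_of_notMem hR hc).not_gt hy

/-- If all points of the curve but three are good and `F` is positive somewhere, then the third
one is an extreme point of the hull of the positive part. -/
theorem extreme_of_pos (h : IsLoop R K F) (hR : FullSet R) {a p q : Pt}
    (hg : ∀ e ∈ K, e ≠ a → e ≠ p → e ≠ q → GoodAt R K e) (hne : ∃ y ∉ K, 0 < F y) :
    a ∈ (convexHull ℝ (closure {y | y ∉ K ∧ 0 < F y})).extremePoints ℝ := by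
  obtain ⟨e, he, hp, hq⟩ := exists_extreme h.isOpen_pos h.isBounded_pos hne p q
  by_cases hea : e = a
  · rwa [← hea]
  · exact absurd (hg e (mem_of_extreme h.isOpen_pos h.isOpen_nonpos he) hea hp hq)
      (extreme_not_goodAt h.isOpen_pos h.isOpen_nonpos (h.pos_subset hR) he)

theorem nonpos (h : IsLoop R K F) (hR : FullSet R) {p q : Pt}
    (hg : ∀ e ∈ K, e ≠ p → e ≠ q → GoodAt R K e) {y : Pt} (hy : y ∉ K) : F y ≤ 0 := by
  by_contra! hc
  obtain ⟨e, he, hp, hq⟩ := exists_extreme h.isOpen_pos h.isBounded_pos ⟨y, hy, hc⟩ p q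
  exact extreme_not_goodAt h.isOpen_pos h.isOpen_nonpos (h.pos_subset hR) he
    (hg e (mem_of_extreme h.isOpen_pos h.isOpen_nonpos he) hp hq)

theorem eq_zero (h : IsLoop R K F) (hR : FullSet R) {p q : Pt}
    (hg : ∀ e ∈ K, e ≠ p → e ≠ q → GoodAt R K e) {y : Pt} (hy : y ∉ K) : F y = 0 :=
  le_antisymm (h.nonpos hR hg hy) (by linarith [h.neg.nonpos hR hg hy])

end IsLoop

/-- The winding angle jumps when crossing a segment. -/
theorem exists_jump {a b m : Pt} (hab : a ≠ b) (hm : m ∈ openSegment ℝ a b) {F G : Pt → ℝ}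
    (hF : ∀ y, F y = viewAngle a b y + G y) (hG : ContinuousAt G m) :
    ∃ r > 0, ∀ y z, dist y m < r → dist z m < r → 0 < det2 (b - a) (y - a) →
      det2 (b - a) (z - a) < 0 → F z < F y := by
  have hpi := Real.pi_pos
  have h1 := (tendsto_viewAngle_left hab hm).add (hG.tendsto.mono_left nhdsWithin_le_nhds)
  have h2 := (tendsto_viewAngle_right hab hm).add (hG.tendsto.mono_left nhdsWithin_le_nhds)
  have e1 := h1.eventually (lt_mem_nhds (show G m < Real.pi + G m by linarith))
  have e2 := h2.eventually (gt_mem_nhds (show -Real.pi + G m < G m by linarith))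
  rw [Filter.Eventually, Metric.mem_nhdsWithin_iff] at e1 e2
  obtain ⟨r₁, hr₁, e1⟩ := e1
  obtain ⟨r₂, hr₂, e2⟩ := e2
  refine ⟨min r₁ r₂, lt_min hr₁ hr₂, fun y z hy hz hy' hz' => ?_⟩
  have k1 := e1 ⟨hy.trans_le (min_le_left _ _), hy'⟩
  have k2 := e2 ⟨hz.trans_le (min_le_right _ _), hz'⟩
  rw [hF, hF]
  exact lt_trans k2 k1

/-! ### Local structure of shortest polylines -/

theorem exists_ball_disjoint {K : Set Pt} (hK : IsClosed K) {e : Pt} (he : e ∉ K) :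
    ∃ r > 0, ∀ y ∈ K, ¬ dist y e < r := by
  obtain ⟨r, hr, h⟩ := Metric.isOpen_iff.1 hK.isOpen_compl e he
  exact ⟨r, hr, fun y hy hd => h hd hy⟩

theorem exists_subset_of_union {K L : Set Pt} (hL : IsClosed L) {e : Pt} (he : e ∉ L) :
    ∃ r > 0, ∀ y ∈ K ∪ L, dist y e < r → y ∈ K := by
  obtain ⟨r, hr, h⟩ := exists_ball_disjoint hL he
  exact ⟨r, hr, fun y hy hd => hy.resolve_right fun hy' => h y hy' hd⟩

theorem isChain_left {A B : List Pt} {a : Pt} (h : List.IsChain (· ≠ ·) (A ++ a :: B)) :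
    List.IsChain (· ≠ ·) (A ++ [a]) := by
  rw [List.isChain_append] at h ⊢
  refine ⟨h.1, List.isChain_singleton _, fun x hx y hy => h.2.2 x hx y ?_⟩
  simpa using hy

theorem isChain_ne_reverse {L : List Pt} (h : List.IsChain (· ≠ ·) L) :
    List.IsChain (· ≠ ·) L.reverse := by
  rw [List.isChain_reverse]
  exact h.imp fun _ _ => Ne.symm

/-- In a shortest polyline, a corner is tight. -/
theorem tight_of_isShortest {R : Set Pt} {z a b : Pt} (h : IsShortest R z b [z, a, b])
    (hdet : det2 (z - a) (b - a) ≠ 0) : Tight R a (z - a) (b - a) := by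
  intro ε hε
  obtain ⟨δ, hδ0, hδ'⟩ := exists_between (lt_min hε one_pos)
  have hδε : δ < ε := hδ'.trans_le (min_le_left _ _)
  have hδ1 : δ < 1 := hδ'.trans_le (min_le_right _ _)
  have hsub := h.subset
  simp only [polylineSet, Set.union_subset_iff] at hsub
  obtain ⟨hza, hab, -⟩ := hsub
  have hp : a + δ • (z - a) ∈ segment ℝ z a :=
    ⟨δ, 1 - δ, hδ0.le, by linarith, by ring, by module⟩
  have hq : a + δ • (b - a) ∈ segment ℝ a b :=
    ⟨1 - δ, δ, by linarith, hδ0.le, by ring, by module⟩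
  by_contra! hc
  have hpq : segment ℝ (a + δ • (z - a)) (a + δ • (b - a)) ⊆ R := by
    rintro _ ⟨s, t, hs, ht, hst, rfl⟩
    rcases hs.eq_or_lt with rfl | hs
    · obtain rfl : t = 1 := by linarith
      simpa using hab hq
    rcases ht.eq_or_lt with rfl | ht
    · obtain rfl : s = 1 := by linarith
      simpa using hza hp
    have := hc (δ * s) (δ * t) (mul_pos hδ0 hs)
      ((mul_le_of_le_one_right hδ0.le (by linarith)).trans_lt hδε) (mul_pos hδ0 ht)
      ((mul_le_of_le_one_right hδ0.le (by linarith)).trans_lt hδε)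
    convert this using 1
    obtain rfl : s = 1 - t := by linarith
    module
  have hle := h.le [z, a + δ • (z - a), a + δ • (b - a), b] rfl rfl (by
    simp only [polylineSet, Set.union_subset_iff, Set.singleton_subset_iff]
    exact ⟨((convex_segment z a).segment_subset (left_mem_segment ℝ z a) hp).trans hza, hpq,
      ((convex_segment a b).segment_subset hq (right_mem_segment ℝ a b)).trans hab,
      hab (right_mem_segment ℝ a b)⟩)
  simp only [polylineLen, add_zero] at hle
  have e1 : dist z (a + δ • (z - a)) = (1 - δ) * dist z a := by
    rw [dist_eq_norm, dist_eq_norm, show z - (a + δ • (z - a)) = (1 - δ) • (z - a) by module,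
      norm_smul, Real.norm_of_nonneg (by linarith)]
  have e2 : dist (a + δ • (z - a)) (a + δ • (b - a)) = δ * dist z b := by
    rw [dist_eq_norm, dist_eq_norm,
      show a + δ • (z - a) - (a + δ • (b - a)) = δ • (z - b) by module,
      norm_smul, Real.norm_of_nonneg (by linarith)]
  have e3 : dist (a + δ • (b - a)) b = (1 - δ) * dist a b := by
    rw [dist_eq_norm, dist_eq_norm, show a + δ • (b - a) - b = (1 - δ) • (a - b) by module,
      norm_smul, Real.norm_of_nonneg (by linarith)]
  rw [e1, e2, e3] at hle
  have heq : dist z a + dist a b = dist z b := by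
    refine le_antisymm (le_of_mul_le_mul_left ?_ hδ0) (dist_triangle _ _ _)
    linarith
  have hseg : a ∈ segment ℝ z b := mem_segment_iff_wbtw.2 (dist_add_dist_eq_iff.1 heq)
  obtain ⟨s, t, hs, ht, hst, ha⟩ := hseg
  apply hdet
  obtain rfl : s = 1 - t := by linarith
  have e4 : z - a = t • (z - b) := by rw [← ha]; module
  have e5 : b - a = (-(1 - t)) • (z - b) := by rw [← ha]; module
  rw [e4, e5, det2_smul_left, det2_smul_right, det2_self, mul_zero, mul_zero]

namespace IsShortest

variable {R S : Set Pt} {s t t' a b c : Pt} {L M A B C : List Pt}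

/-- Near its starting point a shortest polyline is a ray. -/
theorem exists_ray (h : IsShortest R s t (a :: b :: A))
    (hc : List.IsChain (· ≠ ·) (a :: b :: A)) :
    ∃ r > 0, ∀ y ∈ polylineSet (a :: b :: A), dist y a < r →
      ∃ u : ℝ, 0 ≤ u ∧ y = a + u • (b - a) := by
  rw [List.isChain_cons_cons] at hc
  obtain ⟨r, hr, hd⟩ := exists_ball_disjoint (isCompact_polylineSet (b :: A)).isClosed
    (h.notMem_tail hc.1 hc.2)
  refine ⟨r, hr, fun y hy hyr => ?_⟩
  have hy' := hy.resolve_right fun hy' => hd y hy' hyr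
  rw [segment_eq_image'] at hy'
  obtain ⟨u, hu, rfl⟩ := hy'
  exact ⟨u, hu.1, rfl⟩

/-- All points of a shortest polyline are good. -/
theorem goodAt (h : IsShortest R s t L) (hc : List.IsChain (· ≠ ·) L) {e : Pt}
    (he : e ∈ polylineSet L) : GoodAt R (polylineSet L) e := by
  obtain ⟨A, B, h1, h2, h3⟩ := h.exists_split hc he
  rw [← h3, polylineSet_append, ← polylineSet_reverse (A ++ [e])]
  have hl := h1.left.reverse
  have hr := h1.right
  have hcl := isChain_ne_reverse (isChain_left h2)
  have hcr : List.IsChain (· ≠ ·) (e :: B) := (List.isChain_append.1 h2).2.1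
  have hinter := fun z => h1.inter_eq h2 (z := z)
  rw [← polylineSet_reverse] at hinter
  rcases A.eq_nil_or_concat with rfl | ⟨A, z, rfl⟩
  · rcases B with _ | ⟨b, B⟩
    · have h0 : (!₂[1, 0] : Pt) ≠ 0 := by
        intro h
        have := congrArg (fun p : Pt => p 0) h
        simp at this
      refine ⟨!₂[1, 0], _, h0, ⟨1, one_pos, fun y hy _ => ⟨0, le_rfl, Or.inl ?_⟩⟩, Or.inl rfl⟩
      simpa [polylineSet] using hy
    · obtain ⟨r, hr', hray⟩ := hr.exists_ray hcr
      refine ⟨b - e, _, sub_ne_zero.2 (List.isChain_cons_cons.1 hcr).1.symm, ⟨r, hr',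
        fun y hy hyr => ?_⟩, Or.inl rfl⟩
      have hy' : y ∈ polylineSet (e :: b :: B) := by
        refine hy.elim (fun hy => ?_) id
        rw [show y = e by simpa [polylineSet] using hy]
        exact mem_polylineSet_head _ _
      obtain ⟨u, hu, h⟩ := hray y hy' hyr
      exact ⟨u, hu, Or.inl h⟩
  · have hrev : (A.concat z ++ [e]).reverse = e :: z :: A.reverse := by simp
    rw [hrev] at hl hcl hinter ⊢
    have hze := (List.isChain_cons_cons.1 hcl).1.symm
    obtain ⟨r, hr', hray⟩ := hl.exists_ray hcl
    rcases B with _ | ⟨b, B⟩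
    · refine ⟨z - e, _, sub_ne_zero.2 hze, ⟨r, hr', fun y hy hyr => ?_⟩, Or.inl rfl⟩
      have hy' : y ∈ polylineSet (e :: z :: A.reverse) := by
        refine hy.elim id (fun hy => ?_)
        rw [show y = e by simpa [polylineSet] using hy]
        exact mem_polylineSet_head _ _
      obtain ⟨u, hu, h⟩ := hray y hy' hyr
      exact ⟨u, hu, Or.inl h⟩
    · have hbe := (List.isChain_cons_cons.1 hcr).1.symm
      obtain ⟨r₂, hr₂, hray₂⟩ := hr.exists_ray hcr
      have hloc : LocRays (polylineSet (e :: z :: A.reverse) ∪ polylineSet (e :: b :: B)) e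
          (z - e) (b - e) := by
        refine ⟨min r r₂, lt_min hr' hr₂, fun y hy hyr => ?_⟩
        rcases hy with hy | hy
        · obtain ⟨u, hu, h⟩ := hray y hy (hyr.trans_le (min_le_left _ _))
          exact ⟨u, hu, Or.inl h⟩
        · obtain ⟨u, hu, h⟩ := hray₂ y hy (hyr.trans_le (min_le_right _ _))
          exact ⟨u, hu, Or.inr h⟩
      by_cases hdet : det2 (z - e) (b - e) = 0
      · obtain ⟨u, hu⟩ := eq_smul_of_det2_eq_zero (sub_ne_zero.2 hze) hdet
        have hu0 : u < 0 := by
          by_contra! hu0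
          have hu1 : 0 < u := lt_of_le_of_ne hu0 (by
            rintro rfl
            rw [zero_smul] at hu
            exact hbe (sub_eq_zero.1 hu))
          set w := min u 1 with hw
          have hw0 : 0 < w := lt_min hu1 one_pos
          have m1 : e + w • (z - e) ∈ segment ℝ e z :=
            ⟨1 - w, w, by linarith [min_le_right u 1], hw0.le, by ring, by module⟩
          have m2 : e + w • (z - e) ∈ segment ℝ e b := by
            refine ⟨1 - w / u, w / u, ?_, by positivity, by ring, ?_⟩
            · rw [sub_nonneg, div_le_one hu1]; exact min_le_left _ _
            · rw [show (1 - w / u) • e + (w / u) • b = e + (w / u) • (b - e) by module, hu,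
                smul_smul, div_mul_cancel₀ _ hu1.ne']
          have := hinter _ (Or.inl m1) (Or.inl m2)
          rw [add_eq_left] at this
          exact (smul_ne_zero hw0.ne' (sub_ne_zero.2 hze)) this
        refine ⟨z - e, _, sub_ne_zero.2 hze, ?_, Or.inl rfl⟩
        obtain ⟨r, hr, hl⟩ := hloc
        refine ⟨r, hr, fun y hy hyr => ?_⟩
        obtain ⟨v, hv, rfl | rfl⟩ := hl y hy hyr
        · exact ⟨v, hv, Or.inl rfl⟩
        · refine ⟨v * -u, mul_nonneg hv (by linarith), Or.inr ?_⟩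
          rw [hu]; module
      · refine ⟨z - e, b - e, sub_ne_zero.2 hze, hloc, Or.inr ⟨hdet, ?_⟩⟩
        have h1' : IsShortest R s t (A ++ z :: e :: b :: B) := by simpa using h1
        exact tight_of_isShortest h1'.middle hdet

end IsShortest

/-! ### Uniqueness and branching of shortest polylines -/

theorem exists_near_both_sides {a b m : Pt} (hab : a ≠ b) (hm : det2 (b - a) (m - a) = 0)
    {p : Pt → Prop} (hp : ∀ᶠ y in nhds m, p y) :
    ∃ y z, p y ∧ p z ∧ 0 < det2 (b - a) (y - a) ∧ det2 (b - a) (z - a) < 0 := by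
  obtain ⟨v, hv⟩ := exists_det2_pos (sub_ne_zero.2 hab.symm)
  have key : ∀ w : Pt, ∃ ε : ℝ, 0 < ε ∧ p (m + ε • w) := by
    intro w
    have hc : Filter.Tendsto (fun ε : ℝ => m + ε • w) (nhdsWithin 0 (Set.Ioi 0)) (nhds m) := by
      have : Continuous fun ε : ℝ => m + ε • w := by fun_prop
      have := this.tendsto 0
      simp only [zero_smul, add_zero] at this
      exact this.mono_left nhdsWithin_le_nhds
    obtain ⟨ε, h1, h2⟩ := ((hc.eventually hp).and self_mem_nhdsWithin).exists
    exact ⟨ε, h2, h1⟩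
  have hval : ∀ (ε : ℝ) (w : Pt), det2 (b - a) (m + ε • w - a) = ε * det2 (b - a) w := by
    intro ε w
    have : det2 (b - a) (m + ε • w - a) = det2 (b - a) (m - a) + ε * det2 (b - a) w := by
      simp [det2]; ring
    rw [this, hm, zero_add]
  obtain ⟨ε, h1, h2⟩ := key v
  obtain ⟨δ, h3, h4⟩ := key (-v)
  refine ⟨_, _, h2, h4, ?_, ?_⟩
  · rw [hval]; exact mul_pos h1 hv
  · rw [hval, det2_neg_right]; nlinarith [mul_pos h3 hv]

theorem det2_eq_zero_of_mem_segment {a b y : Pt} (h : y ∈ segment ℝ a b) :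
    det2 (b - a) (y - a) = 0 := by
  rw [segment_eq_image'] at h
  obtain ⟨t, -, rfl⟩ := h
  rw [add_sub_cancel_left, det2_smul_right, det2_self, mul_zero]

theorem ne_left_of_mem_openSegment {a b m : Pt} (hab : a ≠ b) (hm : m ∈ openSegment ℝ a b) :
    m ≠ a := by
  rintro rfl; exact hab (left_mem_openSegment_iff.1 hm)

theorem ne_right_of_mem_openSegment {a b m : Pt} (hab : a ≠ b) (hm : m ∈ openSegment ℝ a b) :
    m ≠ b := by
  rintro rfl; exact hab (right_mem_openSegment_iff.1 hm)

/-- The closed curve formed by two polylines with the same ends. -/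
theorem isLoop_two {R : Set Pt} {s t : Pt} {L M : List Pt} (hL : IsShortest R s t L)
    (hM : IsShortest R s t M) : IsLoop R (polylineSet L ∪ polylineSet M)
      fun y => polylineAngle L y - polylineAngle M y where
  isClosed := ((isCompact_polylineSet L).union (isCompact_polylineSet M)).isClosed
  subset := Set.union_subset hL.subset hM.subset
  cont y hy := (continuousAt_polylineAngle fun h => hy (Or.inl h)).sub
    (continuousAt_polylineAngle fun h => hy (Or.inr h))
  coe y hy := by
    rw [Real.Angle.coe_sub, polylineAngle_coe (fun h => hy (Or.inl h)) hL.head hL.last,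
      polylineAngle_coe (fun h => hy (Or.inr h)) hM.head hM.last, sub_self]
  lim := by
    simpa using (tendsto_polylineAngle_cocompact L).sub (tendsto_polylineAngle_cocompact M)

namespace IsShortest

variable {R S : Set Pt} {s t t' a b c z : Pt} {L M A B C : List Pt}

theorem exists_first_split (h : IsShortest R s t L) (hc : List.IsChain (· ≠ ·) L) {Z : Set Pt}
    (hZ : IsClosed Z) (hne : (polylineSet L ∩ Z).Nonempty) :
    ∃ (A B : List Pt) (z : Pt), z ∈ Z ∧ (∀ y ∈ polylineSet (A ++ [z]), y ∈ Z → y = z) ∧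
      IsShortest R s t (A ++ z :: B) ∧ List.IsChain (· ≠ ·) (A ++ z :: B) ∧
      polylineSet (A ++ z :: B) = polylineSet L := by
  obtain ⟨A, B, z, h1, h2, h3, h4, h5, h6, h7⟩ := _root_.exists_first_split hZ hne hc
  exact ⟨A, B, z, h1, h2, ⟨h5.trans h.head, h6.trans h.last, h3.trans_subset h.subset,
    fun M m1 m2 m3 => h4.trans_le (h.le M m1 m2 m3)⟩, h7, h3⟩

/-- Two shortest polylines do not bound a bigon. -/
theorem not_bigon (hR : FullSet R) (hL : IsShortest R a z (a :: b :: A))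
    (hM : IsShortest R a z M) (hcL : List.IsChain (· ≠ ·) (a :: b :: A))
    (hcM : List.IsChain (· ≠ ·) M)
    (h : ∀ y ∈ polylineSet (a :: b :: A), y ∈ polylineSet M → y = a ∨ y = z) : False := by
  have hloop := isLoop_two hL hM
  have hgood : ∀ e ∈ polylineSet (a :: b :: A) ∪ polylineSet M, e ≠ a → e ≠ z →
      GoodAt R (polylineSet (a :: b :: A) ∪ polylineSet M) e := by
    rintro e (he | he) hea hez
    · exact (hL.goodAt hcL he).congr (exists_subset_of_union (isCompact_polylineSet M).isClosed
        fun he' => (h e he he').elim hea hez)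
    · rw [Set.union_comm]
      exact (hM.goodAt hcM he).congr (exists_subset_of_union (isCompact_polylineSet _).isClosed
        fun he' => (h e he' he).elim hea hez)
  have hab := (List.isChain_cons_cons.1 hcL).1
  have hm : midpoint ℝ a b ∈ openSegment ℝ a b := midpoint_mem_openSegment a b
  set m := midpoint ℝ a b
  have hma := ne_left_of_mem_openSegment hab hm
  have hmb := ne_right_of_mem_openSegment hab hm
  have hmL : m ∈ polylineSet (a :: b :: A) := Or.inl (openSegment_subset_segment ℝ a b hm)
  have hm1 : m ∉ polylineSet (b :: A) := fun h' =>
    hmb (hL.inter_eq (A := [a]) hcL (Or.inl (openSegment_subset_segment ℝ a b hm)) h')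
  have hm2 : m ∉ polylineSet M := by
    intro hmM
    rcases h m hmL hmM with h' | h'
    · exact hma h'
    · apply hm1
      rw [h']
      refine subset_polylineSet (List.mem_of_getLast? ?_)
      rw [← hL.last, List.getLast?_cons_cons]
  obtain ⟨r, hr, hj⟩ := exists_jump hab hm (F := fun y => polylineAngle (a :: b :: A) y -
      polylineAngle M y) (G := fun y => polylineAngle (b :: A) y - polylineAngle M y)
    (fun y => by simp only [polylineAngle]; ring)
    ((continuousAt_polylineAngle hm1).sub (continuousAt_polylineAngle hm2))
  have n1 : ∀ᶠ y in nhds m, dist y m < r := Metric.ball_mem_nhds m hr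
  have n2 : ∀ᶠ y in nhds m, y ∉ polylineSet (b :: A) :=
    (isCompact_polylineSet _).isClosed.isOpen_compl.mem_nhds hm1
  have n3 : ∀ᶠ y in nhds m, y ∉ polylineSet M :=
    (isCompact_polylineSet _).isClosed.isOpen_compl.mem_nhds hm2
  obtain ⟨y, y', ⟨h1, h2, h3⟩, ⟨h1', h2', h3'⟩, h4, h5⟩ := exists_near_both_sides hab
    (det2_eq_zero_of_mem_segment (openSegment_subset_segment ℝ a b hm))
    (n1.and (n2.and n3))
  have key : ∀ y, y ∉ polylineSet (b :: A) → y ∉ polylineSet M → det2 (b - a) (y - a) ≠ 0 →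
      y ∉ polylineSet (a :: b :: A) ∪ polylineSet M := by
    rintro y h1 h2 h3 ((h | h) | h)
    · exact h3 (det2_eq_zero_of_mem_segment h)
    · exact h1 h
    · exact h2 h
  have e1 := hloop.eq_zero hR hgood (key y h2 h3 h4.ne')
  have e2 := hloop.eq_zero hR hgood (key y' h2' h3' h5.ne)
  have := hj y y' h1 h1' h4 h5
  linarith

/-- Two shortest polylines leaving a point in different directions do not meet again. -/
theorem eq_of_mem_of_mem (hR : FullSet R) (hL : IsShortest R a t (a :: b :: A))
    (hM : IsShortest R a t' (a :: c :: B)) (hcL : List.IsChain (· ≠ ·) (a :: b :: A))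
    (hcM : List.IsChain (· ≠ ·) (a :: c :: B)) (hdet : det2 (b - a) (c - a) ≠ 0)
    (h1 : z ∈ polylineSet (a :: b :: A)) (h2 : z ∈ polylineSet (a :: c :: B)) : z = a := by
  by_contra hza
  obtain ⟨r₁, hr₁, hray₁⟩ := hL.exists_ray hcL
  obtain ⟨r₂, hr₂, hray₂⟩ := hM.exists_ray hcM
  have hnear : ∀ y ∈ polylineSet (a :: b :: A), y ∈ polylineSet (a :: c :: B) →
      dist y a < min r₁ r₂ → y = a := by
    intro y hy hy' hyr
    obtain ⟨u, hu, h⟩ := hray₁ y hy (hyr.trans_le (min_le_left _ _))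
    obtain ⟨v, hv, h'⟩ := hray₂ y hy' (hyr.trans_le (min_le_right _ _))
    have : u * det2 (b - a) (c - a) = 0 := by
      rw [← det2_smul_left, show u • (b - a) = v • (c - a) by
        rw [h] at h'; exact add_left_cancel h', det2_smul_left, det2_self, mul_zero]
    have hu : u = 0 := (mul_eq_zero.1 this).resolve_right hdet
    rw [h, hu, zero_smul, add_zero]
  have hr : 0 < min r₁ r₂ := lt_min hr₁ hr₂
  have hZ : IsClosed (polylineSet (a :: c :: B) \ Metric.ball a (min r₁ r₂)) :=
    (isCompact_polylineSet _).isClosed.sdiff Metric.isOpen_ball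
  obtain ⟨A', B', w, hw, hfirst, hsh, hch, hset⟩ := hL.exists_first_split hcL hZ
    ⟨z, h1, h2, fun h => hza (hnear z h1 h2 h)⟩
  have hwa : w ≠ a := by
    rintro rfl; exact hw.2 (Metric.mem_ball_self hr)
  obtain ⟨A'', B'', hsh', hch', hset'⟩ := hM.exists_split hcM hw.1
  have hl := hsh.left
  have hcl := isChain_left hch
  have hsub : polylineSet (A' ++ [w]) ⊆ polylineSet (a :: b :: A) := by
    rw [← hset, polylineSet_append A' w B']; exact Set.subset_union_left
  rcases A' with _ | ⟨a', A'⟩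
  · have : w = a := by simpa using hl.head
    exact hwa this
  have ha' : a' = a := by simpa using hl.head
  subst ha'
  obtain ⟨b', D, hD⟩ : ∃ b' D, A' ++ [w] = b' :: D := by
    cases A' with
    | nil => exact ⟨w, [], rfl⟩
    | cons b' D => exact ⟨b', D ++ [w], rfl⟩
  rw [List.cons_append, hD] at hl hcl hsub hfirst
  refine not_bigon hR hl hsh'.left hcl (isChain_left hch') fun y hy hy' => ?_
  have hyM : y ∈ polylineSet (a' :: c :: B) := by
    rw [← hset', polylineSet_append]; exact Or.inl hy'
  by_cases hyr : dist y a' < min r₁ r₂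
  · exact Or.inl (hnear y (hsub hy) hyM hyr)
  · exact Or.inr (hfirst y hy ⟨hyM, hyr⟩)

end IsShortest

/-- Two lists are either comparable or have a longest common prefix. -/
theorem List.eq_append_or_branch (L M : List Pt) : (∃ X, M = L ++ X) ∨ (∃ X, L = M ++ X) ∨
    ∃ (D : List Pt) (b c : Pt) (A C : List Pt), L = D ++ b :: A ∧ M = D ++ c :: C ∧ b ≠ c := by
  induction L generalizing M with
  | nil => exact Or.inl ⟨M, rfl⟩
  | cons a L ih =>
    cases M with
    | nil => exact Or.inr (Or.inl ⟨a :: L, rfl⟩)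
    | cons b M =>
      by_cases hab : a = b
      · subst hab
        rcases ih M with ⟨X, rfl⟩ | ⟨X, rfl⟩ | ⟨D, b, c, A, C, rfl, rfl, h⟩
        · exact Or.inl ⟨X, rfl⟩
        · exact Or.inr (Or.inl ⟨X, rfl⟩)
        · exact Or.inr (Or.inr ⟨a :: D, b, c, A, C, rfl, rfl, h⟩)
      · exact Or.inr (Or.inr ⟨[], a, b, L, M, rfl, rfl, hab⟩)

/-- Two shortest polylines from a point are either comparable or branch at some vertex. -/
theorem exists_branch {R : Set Pt} {s t t' : Pt} {L M : List Pt} (hL : IsShortest R s t L)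
    (hM : IsShortest R s t' M) : (∃ X, M = L ++ X) ∨ (∃ X, L = M ++ X) ∨
    ∃ (D : List Pt) (a b c : Pt) (A C : List Pt),
      L = D ++ a :: b :: A ∧ M = D ++ a :: c :: C ∧ b ≠ c := by
  rcases List.eq_append_or_branch L M with h | h | ⟨D, b, c, A, C, rfl, rfl, h⟩
  · exact Or.inl h
  · exact Or.inr (Or.inl h)
  · refine Or.inr (Or.inr ?_)
    rcases D.eq_nil_or_concat with rfl | ⟨D, a, rfl⟩
    · have h1 : b = s := by simpa using hL.head
      have h2 : c = s := by simpa using hM.head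
      exact absurd (h1.trans h2.symm) h
    · exact ⟨D, a, b, c, A, C, by simp, by simp, h⟩

theorem det2_ne_zero_of_branch {S : Set Pt} (hS : NoThreeCollinear S) {D A C : List Pt}
    {a b c : Pt} (h1 : ∀ x ∈ D ++ a :: b :: A, x ∈ S) (h2 : ∀ x ∈ D ++ a :: c :: C, x ∈ S)
    (hc1 : List.IsChain (· ≠ ·) (D ++ a :: b :: A)) (hc2 : List.IsChain (· ≠ ·) (D ++ a :: c :: C))
    (hbc : b ≠ c) : det2 (b - a) (c - a) ≠ 0 :=
  hS a (h1 a (by simp)) b (h1 b (by simp)) c (h2 c (by simp))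
    (List.isChain_cons_cons.1 (List.isChain_append.1 hc1).2.1).1
    (List.isChain_cons_cons.1 (List.isChain_append.1 hc2).2.1).1 hbc

namespace IsShortest

variable {R S : Set Pt} {s t t' : Pt} {L M : List Pt}

theorem eq_nil_of_append {X : List Pt} (hL : IsShortest R s t L) (hM : IsShortest R s t (L ++ X))
    (hc : List.IsChain (· ≠ ·) (L ++ X)) : X = [] := by
  obtain ⟨D, hD⟩ := List.getLast?_eq_some_iff.1 hL.last
  subst hD
  rcases X with _ | ⟨b, X⟩
  · rfl
  · rw [List.append_assoc, List.singleton_append] at hM hc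
    have hc' := (List.isChain_append.1 hc).2.1
    rw [List.isChain_cons_cons] at hc'
    refine absurd ?_ (hM.right.notMem_tail hc'.1 hc'.2)
    refine subset_polylineSet (List.mem_of_getLast? ?_)
    rw [← hM.right.last, List.getLast?_cons_cons]

/-- Shortest polylines with vertices in general position are unique. -/
theorem unique (hR : FullSet R) (hS : NoThreeCollinear S) (hL : IsShortest R s t L)
    (hM : IsShortest R s t M) (hcL : List.IsChain (· ≠ ·) L) (hcM : List.IsChain (· ≠ ·) M)
    (hLS : ∀ x ∈ L, x ∈ S) (hMS : ∀ x ∈ M, x ∈ S) : L = M := by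
  rcases exists_branch hL hM with ⟨X, rfl⟩ | ⟨X, rfl⟩ | ⟨D, a, b, c, A, C, rfl, rfl, hbc⟩
  · rw [eq_nil_of_append hL hM hcM, List.append_nil]
  · rw [eq_nil_of_append hM hL hcL, List.append_nil]
  · have hdet := det2_ne_zero_of_branch hS hLS hMS hcL hcM hbc
    have hcL' := (List.isChain_append.1 hcL).2.1
    have hcM' := (List.isChain_append.1 hcM).2.1
    have h1 : t ∈ polylineSet (b :: A) := by
      refine subset_polylineSet (List.mem_of_getLast? ?_)
      rw [← hL.right.last, List.getLast?_cons_cons]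
    have h2 := subset_polylineSet (List.mem_of_getLast? hM.right.last)
    have hta := eq_of_mem_of_mem hR hL.right hM.right hcL' hcM' hdet (Or.inr h1) h2
    rw [List.isChain_cons_cons] at hcL'
    exact (hL.right.notMem_tail hcL'.1 hcL'.2 (hta ▸ h1)).elim

/-- In the union of two shortest polylines from a point, all points but one are good. -/
theorem exists_goodAt_union (hR : FullSet R) (hS : NoThreeCollinear S) (hL : IsShortest R s t L)
    (hM : IsShortest R s t' M) (hcL : List.IsChain (· ≠ ·) L) (hcM : List.IsChain (· ≠ ·) M)
    (hLS : ∀ x ∈ L, x ∈ S) (hMS : ∀ x ∈ M, x ∈ S) :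
    ∃ a, ∀ e ∈ polylineSet L ∪ polylineSet M, e ≠ a →
      GoodAt R (polylineSet L ∪ polylineSet M) e := by
  have hpre : ∀ {L X : List Pt}, L.getLast? ≠ none → polylineSet L ⊆ polylineSet (L ++ X) := by
    intro L X h
    rcases L.eq_nil_or_concat with rfl | ⟨D, a, rfl⟩
    · simp at h
    · rw [List.concat_eq_append, List.append_assoc, List.singleton_append,
        polylineSet_append D a X]
      exact Set.subset_union_left
  rcases exists_branch hL hM with ⟨X, rfl⟩ | ⟨X, rfl⟩ | ⟨D, a, b, c, A, C, rfl, rfl, hbc⟩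
  · rw [Set.union_eq_self_of_subset_left (hpre (by rw [hL.last]; simp))]
    exact ⟨0, fun e he _ => hM.goodAt hcM he⟩
  · rw [Set.union_eq_self_of_subset_right (hpre (by rw [hM.last]; simp))]
    exact ⟨0, fun e he _ => hL.goodAt hcL he⟩
  · have hdet := det2_ne_zero_of_branch hS hLS hMS hcL hcM hbc
    have hcL' := (List.isChain_append.1 hcL).2.1
    have hcM' := (List.isChain_append.1 hcM).2.1
    have e1 := polylineSet_append D a (b :: A)
    have e2 := polylineSet_append D a (c :: C)
    have u1 : polylineSet (D ++ a :: b :: A) ∪ polylineSet (D ++ a :: c :: C) =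
        polylineSet (D ++ a :: b :: A) ∪ polylineSet (a :: c :: C) := by
      rw [e1, e2]
      ext y; simp only [Set.mem_union]; tauto
    have u2 : polylineSet (D ++ a :: b :: A) ∪ polylineSet (D ++ a :: c :: C) =
        polylineSet (D ++ a :: c :: C) ∪ polylineSet (a :: b :: A) := by
      rw [e1, e2]
      ext y; simp only [Set.mem_union]; tauto
    refine ⟨a, fun e he hea => ?_⟩
    by_cases h : e ∈ polylineSet (a :: c :: C)
    · rw [u2]
      refine (hM.goodAt hcM ?_).congr (exists_subset_of_union
        (isCompact_polylineSet _).isClosed fun h' =>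
          hea (eq_of_mem_of_mem hR hL.right hM.right hcL' hcM' hdet h' h))
      rw [e2]; exact Or.inr h
    · rw [u1] at he ⊢
      exact (hL.goodAt hcL (he.resolve_right h)).congr (exists_subset_of_union
        (isCompact_polylineSet _).isClosed h)

end IsShortest

/-! ### Winding of geodesic triangles -/

theorem dist_add_smul_lt {a d : Pt} {r : ℝ} (hr : 0 < r) :
    ∃ t : ℝ, 0 < t ∧ t < 1 ∧ dist (a + t • d) a < r := by
  obtain ⟨ε, hε, h⟩ := exists_sector_near (e := a) (d₁ := d) (d₂ := 0) hr
  refine ⟨min (ε / 2) (1 / 2), lt_min (by linarith) (by norm_num),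
    (min_le_right _ _).trans_lt (by norm_num), ?_⟩
  have := h (min (ε / 2) (1 / 2)) (ε / 2) (lt_min (by linarith) (by norm_num))
    ((min_le_left _ _).trans_lt (by linarith)) (by linarith) (by linarith)
  simpa using this

namespace IsShortest

variable {R S : Set Pt} {p q r a b c : Pt} {A C N D : List Pt}

theorem isLoop_triangle (h₁ : IsShortest R a q (a :: b :: A)) (h₃ : IsShortest R a r (a :: c :: C))
    (h₂ : IsShortest R q r N) :
    IsLoop R (polylineSet (a :: b :: A) ∪ polylineSet N ∪ polylineSet (a :: c :: C))
      fun y => polylineAngle (a :: b :: A) y + polylineAngle N y - polylineAngle (a :: c :: C) y where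
  isClosed := (((isCompact_polylineSet _).union (isCompact_polylineSet _)).union
    (isCompact_polylineSet _)).isClosed
  subset := Set.union_subset (Set.union_subset h₁.subset h₂.subset) h₃.subset
  cont y hy := by
    simp only [Set.mem_union, not_or] at hy
    exact ((continuousAt_polylineAngle hy.1.1).add (continuousAt_polylineAngle hy.1.2)).sub
      (continuousAt_polylineAngle hy.2)
  coe y hy := by
    simp only [Set.mem_union, not_or] at hy
    rw [Real.Angle.coe_sub, Real.Angle.coe_add, polylineAngle_coe hy.1.1 h₁.head h₁.last,
      polylineAngle_coe hy.1.2 h₂.head h₂.last, polylineAngle_coe hy.2 h₃.head h₃.last]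
    abel
  lim := by
    simpa using ((tendsto_polylineAngle_cocompact (a :: b :: A)).add
      (tendsto_polylineAngle_cocompact N)).sub (tendsto_polylineAngle_cocompact (a :: c :: C))

/-- A geodesic triangle with a left turn at `a` winds counterclockwise. -/
theorem triangle_of_apex (hR : FullSet R) (hS : NoThreeCollinear S)
    (h₁ : IsShortest R a q (a :: b :: A)) (h₃ : IsShortest R a r (a :: c :: C))
    (h₂ : IsShortest R q r N)
    (hc₁ : List.IsChain (· ≠ ·) (a :: b :: A)) (hc₃ : List.IsChain (· ≠ ·) (a :: c :: C))
    (hc₂ : List.IsChain (· ≠ ·) N)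
    (hS₁ : ∀ x ∈ a :: b :: A, x ∈ S) (hS₃ : ∀ x ∈ a :: c :: C, x ∈ S) (hS₂ : ∀ x ∈ N, x ∈ S)
    (hdet : 0 < det2 (b - a) (c - a)) (ha : a ∉ polylineSet N) :
    (∀ y ∉ polylineSet (a :: b :: A) ∪ polylineSet N ∪ polylineSet (a :: c :: C),
      0 ≤ polylineAngle (a :: b :: A) y + polylineAngle N y - polylineAngle (a :: c :: C) y) ∧
    ∃ y ∉ polylineSet (a :: b :: A) ∪ polylineSet N ∪ polylineSet (a :: c :: C),
      0 < polylineAngle (a :: b :: A) y + polylineAngle N y - polylineAngle (a :: c :: C) y := by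
  have hloop := isLoop_triangle h₁ h₃ h₂
  have hab := (List.isChain_cons_cons.1 hc₁).1
  have clos : ∀ L, IsClosed (polylineSet L) := fun L => (isCompact_polylineSet L).isClosed
  have hmeet : ∀ z ∈ polylineSet (a :: b :: A), z ∈ polylineSet (a :: c :: C) → z = a :=
    fun z => eq_of_mem_of_mem hR h₁ h₃ hc₁ hc₃ hdet.ne'
  set F : Pt → ℝ := fun y =>
    polylineAngle (a :: b :: A) y + polylineAngle N y - polylineAngle (a :: c :: C) y with hF
  set K := polylineSet (a :: b :: A) ∪ polylineSet N ∪ polylineSet (a :: c :: C) with hK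
  obtain ⟨a₁, ha₁⟩ := exists_goodAt_union hR hS h₁.reverse h₂ (isChain_ne_reverse hc₁) hc₂
    (fun x hx => hS₁ x (List.mem_reverse.1 hx)) hS₂
  obtain ⟨a₂, ha₂⟩ := exists_goodAt_union hR hS h₃.reverse h₂.reverse (isChain_ne_reverse hc₃)
    (isChain_ne_reverse hc₂) (fun x hx => hS₃ x (List.mem_reverse.1 hx))
    (fun x hx => hS₂ x (List.mem_reverse.1 hx))
  simp only [polylineSet_reverse] at ha₁ ha₂
  have hgood : ∀ e ∈ K, e ≠ a → e ≠ a₁ → e ≠ a₂ → GoodAt R K e := by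
    intro e he hea he1 he2
    by_cases h3 : e ∈ polylineSet (a :: c :: C)
    · have h1 : e ∉ polylineSet (a :: b :: A) := fun h => hea (hmeet e h h3)
      have : K = (polylineSet (a :: c :: C) ∪ polylineSet N) ∪ polylineSet (a :: b :: A) := by
        rw [hK]; ext y; simp only [Set.mem_union]; tauto
      rw [this]
      exact (ha₂ e (Or.inl h3) he2).congr (exists_subset_of_union (clos _) h1)
    · exact (ha₁ e (he.resolve_right h3) he1).congr (exists_subset_of_union (clos _) h3)
  -- a point of the first edge close to `a`
  obtain ⟨ρ₁, hρ₁, hray₁⟩ := h₁.exists_ray hc₁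
  obtain ⟨ρ₃, hρ₃, hray₃⟩ := h₃.exists_ray hc₃
  obtain ⟨ρ₂, hρ₂, hN⟩ := exists_ball_disjoint (clos N) ha
  have hloc : LocRays K a (b - a) (c - a) := by
    refine ⟨min ρ₁ (min ρ₂ ρ₃), lt_min hρ₁ (lt_min hρ₂ hρ₃), fun y hy hd => ?_⟩
    rw [lt_min_iff, lt_min_iff] at hd
    rcases hy with (hy | hy) | hy
    · obtain ⟨u, hu, h⟩ := hray₁ y hy hd.1
      exact ⟨u, hu, Or.inl h⟩
    · exact absurd hd.2.1 (hN y hy)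
    · obtain ⟨u, hu, h⟩ := hray₃ y hy hd.2.2
      exact ⟨u, hu, Or.inr h⟩
  have step : ∀ ρ > 0, ∃ y z, y ∉ K ∧ z ∉ K ∧ dist y a < ρ ∧ dist z a < ρ ∧
      0 < det2 (b - a) (y - a) ∧ 0 < det2 (y - a) (c - a) ∧ det2 (b - a) (z - a) < 0 ∧
      F z < F y := by
    intro ρ hρ
    obtain ⟨t, ht0, ht1, htd⟩ := dist_add_smul_lt (a := a) (d := b - a) (lt_min hρ hρ₂)
    rw [lt_min_iff] at htd
    have hm : a + t • (b - a) ∈ openSegment ℝ a b := by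
      rw [openSegment_eq_image']; exact ⟨t, ⟨ht0, ht1⟩, rfl⟩
    have hms : a + t • (b - a) ∈ segment ℝ a b := openSegment_subset_segment ℝ a b hm
    have hmdet : 0 < det2 (a + t • (b - a) - a) (c - a) := by
      rw [add_sub_cancel_left, det2_smul_left]; exact mul_pos ht0 hdet
    generalize a + t • (b - a) = m at *
    have hma := ne_left_of_mem_openSegment hab hm
    have hmb := ne_right_of_mem_openSegment hab hm
    have hm1 : m ∉ polylineSet (b :: A) := fun h' =>
      hmb (h₁.inter_eq (A := [a]) hc₁ (Or.inl hms) h')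
    have hm2 : m ∉ polylineSet N := fun h => hN m h htd.2
    have hm3 : m ∉ polylineSet (a :: c :: C) := fun h => hma (hmeet m (Or.inl hms) h)
    obtain ⟨r, hr, hj⟩ := exists_jump hab hm (F := F)
      (G := fun y => polylineAngle (b :: A) y + polylineAngle N y - polylineAngle (a :: c :: C) y)
      (fun y => by simp only [hF, polylineAngle]; ring)
      (((continuousAt_polylineAngle hm1).add (continuousAt_polylineAngle hm2)).sub
        (continuousAt_polylineAngle hm3))
    have n1 : ∀ᶠ y in nhds m, dist y m < r := Metric.ball_mem_nhds m hr
    have n2 : ∀ᶠ y in nhds m, y ∉ polylineSet (b :: A) := (clos _).isOpen_compl.mem_nhds hm1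
    have n3 : ∀ᶠ y in nhds m, y ∉ polylineSet N := (clos _).isOpen_compl.mem_nhds hm2
    have n4 : ∀ᶠ y in nhds m, y ∉ polylineSet (a :: c :: C) :=
      (clos _).isOpen_compl.mem_nhds hm3
    have n5 : ∀ᶠ y in nhds m, dist y a < ρ := Metric.isOpen_ball.mem_nhds htd.1
    have n6 : ∀ᶠ y in nhds m, 0 < det2 (y - a) (c - a) := by
      have : Continuous fun y : Pt => det2 (y - a) (c - a) := by unfold det2; fun_prop
      exact this.continuousAt.eventually (lt_mem_nhds hmdet)
    obtain ⟨y, z, ⟨y1, y2, y3, y4, y5, y6⟩, ⟨z1, z2, z3, z4, z5, z6⟩, h4, h5⟩ :=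
      exists_near_both_sides hab (det2_eq_zero_of_mem_segment hms)
        (n1.and (n2.and (n3.and (n4.and (n5.and n6)))))
    have key : ∀ y, y ∉ polylineSet (b :: A) → y ∉ polylineSet N →
        y ∉ polylineSet (a :: c :: C) → det2 (b - a) (y - a) ≠ 0 → y ∉ K := by
      rintro y h1 h2 h3 h4 (((h | h) | h) | h)
      · exact h4 (det2_eq_zero_of_mem_segment h)
      · exact h1 h
      · exact h2 h
      · exact h3 h
    exact ⟨y, z, key y y2 y3 y4 h4.ne', key z z2 z3 z4 h5.ne, y5, z5, h4, y6, h5,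
      hj y z y1 z1 h4 h5⟩
  have hnn : ∀ y ∉ K, 0 ≤ F y := by
    by_contra! hneg
    obtain ⟨y₀, hy₀, hy₀'⟩ := hneg
    have hext := hloop.neg.extreme_of_pos hR hgood ⟨y₀, hy₀, by simpa using hy₀'⟩
    obtain ⟨ρ, hρ, hD⟩ := extreme_local hloop.neg.isOpen_pos hloop.neg.isOpen_nonpos hext hdet hloc
    obtain ⟨y, z, hyK, hzK, hy, hz, h1, h2, h3, h4⟩ := step ρ hρ
    have h5 : 0 < -F y := ((hD y hy).2 ⟨h1, h2⟩).2
    have h6 := (hD z hz).1 ⟨hzK, show 0 < -F z by linarith⟩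
    linarith [h6.1]
  obtain ⟨y, z, hyK, hzK, -, -, -, -, -, h4⟩ := step 1 one_pos
  exact ⟨hnn, y, hyK, (hnn z hzK).trans_lt h4⟩

end IsShortest

/-! ### Topology of a simple polygon -/

theorem isPreconnected_outside_square (M : ℝ) :
    IsPreconnected {y : Pt | M < y 0 ∨ M < y 1 ∨ y 0 < -M ∨ y 1 < -M} := by
  have lin : ∀ i : Fin 2, IsLinearMap ℝ fun y : Pt => y i := fun i =>
    ⟨fun x y => by simp, fun c x => by simp⟩
  have h1 : ∀ i : Fin 2, IsPreconnected {y : Pt | M < y i} := fun i =>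
    (convex_halfSpace_gt (lin i) M).isPreconnected
  have h2 : ∀ i : Fin 2, IsPreconnected {y : Pt | y i < -M} := fun i =>
    (convex_halfSpace_lt (lin i) (-M)).isPreconnected
  have h3 := IsPreconnected.union (!₂[-(M + 1) - |M|, -(M + 1) - |M|] : Pt)
    (by simp; linarith [le_abs_self M, neg_abs_le M, abs_nonneg M])
    (by simp; linarith [le_abs_self M, neg_abs_le M, abs_nonneg M]) (h2 0) (h2 1)
  have h4 := IsPreconnected.union (!₂[-(M + 1) - |M|, (M + 1) + |M|] : Pt)
    (by simp; linarith [le_abs_self M, neg_abs_le M, abs_nonneg M])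
    (by simp; left; linarith [le_abs_self M, neg_abs_le M, abs_nonneg M]) (h1 1) h3
  have h5 := IsPreconnected.union (!₂[(M + 1) + |M|, (M + 1) + |M|] : Pt)
    (by simp; linarith [le_abs_self M, neg_abs_le M, abs_nonneg M])
    (by simp; left; linarith [le_abs_self M, neg_abs_le M, abs_nonneg M]) (h1 0) h4
  exact h5

namespace SimplePolygon

variable (P : SimplePolygon)

theorem isCompact_boundary : IsCompact P.boundary :=
  (Finset.range P.n).isCompact_biUnion fun _ _ => isCompact_segment _ _

theorem boundary_subset_region : P.boundary ⊆ P.region := Set.subset_union_left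

theorem interior_subset_region : P.interior ⊆ P.region := Set.subset_union_right

theorem isOpen_interior : IsOpen P.interior := by
  rw [isOpen_iff_mem_nhds]
  rintro x ⟨hx, hb⟩
  have ho := (P.isCompact_boundary.isClosed.isOpen_compl).connectedComponentIn (x := x)
  refine Filter.mem_of_superset (ho.mem_nhds (mem_connectedComponentIn hx)) fun y hy => ?_
  exact ⟨connectedComponentIn_subset _ _ hy, by rwa [← connectedComponentIn_eq hy]⟩

theorem isOpen_compl_region : IsOpen P.regionᶜ := by
  rw [isOpen_iff_mem_nhds]
  intro x hx
  have hxb : x ∈ P.boundaryᶜ := fun h => hx (Or.inl h)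
  have ho := (P.isCompact_boundary.isClosed.isOpen_compl).connectedComponentIn (x := x)
  refine Filter.mem_of_superset (ho.mem_nhds (mem_connectedComponentIn hxb)) fun y hy => ?_
  rintro (h | ⟨-, h⟩)
  · exact connectedComponentIn_subset _ _ hy h
  · exact hx (Or.inr ⟨hxb, by rwa [connectedComponentIn_eq hy]⟩)

theorem isClosed_region : IsClosed P.region := isOpen_compl_iff.1 P.isOpen_compl_region

theorem fullSet_region : FullSet P.region := by
  obtain ⟨M, hM⟩ := P.isCompact_boundary.isBounded.exists_norm_le
  set E := {y : Pt | M < y 0 ∨ M < y 1 ∨ y 0 < -M ∨ y 1 < -M} with hE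
  have hEp : IsPreconnected E := isPreconnected_outside_square M
  have hEb : E ⊆ P.boundaryᶜ := by
    intro y hy hyb
    have h := hM y hyb
    have h0 := (PiLp.norm_apply_le y 0).trans h
    have h1 := (PiLp.norm_apply_le y 1).trans h
    rw [Real.norm_eq_abs, abs_le] at h0 h1
    rcases hy with hy | hy | hy | hy <;> linarith
  have hEunb : ¬ Bornology.IsBounded E := by
    intro hb
    obtain ⟨N, hN⟩ := hb.exists_norm_le
    have h1 := hN (!₂[|M| + |N| + 1, 0]) (Or.inl (by
      simp; linarith [le_abs_self M, abs_nonneg N]))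
    have h2 := (PiLp.norm_apply_le _ 0).trans h1
    rw [Real.norm_eq_abs] at h2
    have h3 := (le_abs_self _).trans h2
    simp at h3
    linarith [le_abs_self N, abs_nonneg M]
  have hcompl : ∀ x ∉ E, ‖x‖ ≤ 2 * |M| := by
    intro x hx
    simp only [hE, Set.mem_ofPred_eq, not_or, not_lt] at hx
    have h0 : |x 0| ≤ |M| := abs_le.2 ⟨by linarith [le_abs_self M], by linarith [le_abs_self M]⟩
    have h1 : |x 1| ≤ |M| := abs_le.2 ⟨by linarith [le_abs_self M], by linarith [le_abs_self M]⟩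
    rw [EuclideanSpace.norm_eq]
    refine Real.sqrt_le_iff.2 ⟨by positivity, ?_⟩
    rw [Fin.sum_univ_two, Real.norm_eq_abs, Real.norm_eq_abs]
    nlinarith [abs_nonneg (x 0), abs_nonneg (x 1), abs_nonneg M]
  obtain ⟨e, he⟩ : E.Nonempty := by
    by_contra h
    exact hEunb (by rw [Set.not_nonempty_iff_eq_empty.1 h]; exact Bornology.isBounded_empty)
  have hcomp : P.regionᶜ = connectedComponentIn P.boundaryᶜ e := by
    have hsub : E ⊆ connectedComponentIn P.boundaryᶜ e :=
      hEp.subset_connectedComponentIn he hEb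
    ext x
    constructor
    · intro hx
      have hxb : x ∈ P.boundaryᶜ := fun h => hx (Or.inl h)
      have hunb : ¬ Bornology.IsBounded (connectedComponentIn P.boundaryᶜ x) :=
        fun h => hx (Or.inr ⟨hxb, h⟩)
      have : ∃ y ∈ connectedComponentIn P.boundaryᶜ x, y ∈ E := by
        by_contra! h
        exact hunb (isBounded_iff_forall_norm_le.2 ⟨_, fun y hy => hcompl y (h y hy)⟩)
      obtain ⟨y, hy, hyE⟩ := this
      rw [connectedComponentIn_eq (hsub hyE), ← connectedComponentIn_eq hy]
      exact mem_connectedComponentIn hxb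
    · rintro hx (h | ⟨-, h⟩)
      · exact connectedComponentIn_subset _ _ hx h
      · rw [← connectedComponentIn_eq hx] at h
        exact hEunb (h.subset hsub)
  refine ⟨?_, ?_⟩
  · rw [hcomp]; exact isPreconnected_connectedComponentIn
  · rw [hcomp]
    exact fun h => hEunb (h.subset (hEp.subset_connectedComponentIn he hEb))

end SimplePolygon

/-! ### Local structure of a simple polygon -/

theorem mem_segment_iff_of_dist_lt {a b y : Pt} (hab : a ≠ b) (h : dist y a < dist a b) :
    y ∈ segment ℝ a b ↔ ∃ t : ℝ, 0 ≤ t ∧ y = a + t • (b - a) := by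
  rw [segment_eq_image']
  constructor
  · rintro ⟨t, ht, rfl⟩
    exact ⟨t, ht.1, rfl⟩
  · rintro ⟨t, ht, rfl⟩
    refine ⟨t, ⟨ht, ?_⟩, rfl⟩
    rw [dist_eq_norm, add_sub_cancel_left, norm_smul, Real.norm_of_nonneg ht,
      ← dist_eq_norm, dist_comm] at h
    exact le_of_mul_le_mul_right (by linarith : t * dist a b ≤ 1 * dist a b) (dist_pos.2 hab)

namespace SimplePolygon

variable (P : SimplePolygon)

theorem vtx_mod (i : ℕ) : P.vtx (i % P.n) = P.vtx i :=
  Function.Periodic.map_mod_nat P.periodic i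

theorem vtx_mod_add_one (i : ℕ) : P.vtx (i % P.n + 1) = P.vtx (i + 1) := by
  rw [← P.vtx_mod (i % P.n + 1), ← P.vtx_mod (i + 1), Nat.mod_add_mod]

theorem n_pos : 0 < P.n := lt_of_lt_of_le (by norm_num) P.three_le

theorem vtx_mem (i : ℕ) : P.vtx i ∈ P.vertexSet :=
  ⟨i % P.n, Nat.mod_lt _ P.n_pos, (P.vtx_mod i).symm⟩

theorem vtx_eq_iff (i j : ℕ) : P.vtx i = P.vtx j ↔ i % P.n = j % P.n := by
  constructor
  · intro h
    rw [← P.vtx_mod i, ← P.vtx_mod j] at h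
    exact P.inj _ (Nat.mod_lt _ P.n_pos) _ (Nat.mod_lt _ P.n_pos) h
  · intro h
    rw [← P.vtx_mod i, ← P.vtx_mod j, h]

/-- The indices of the edges containing a point. -/
def edgesAt (x : Pt) : Set ℕ := {i | i < P.n ∧ x ∈ segment ℝ (P.vtx i) (P.vtx (i + 1))}

theorem mod_mem_edgesAt {x : Pt} {i : ℕ} (h : x ∈ segment ℝ (P.vtx i) (P.vtx (i + 1))) :
    i % P.n ∈ P.edgesAt x :=
  ⟨Nat.mod_lt _ P.n_pos, by rwa [vtx_mod, vtx_mod_add_one]⟩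

theorem finite_edgesAt (x : Pt) : (P.edgesAt x).Finite :=
  (Set.finite_Iio P.n).subset fun _ h => h.1

theorem not_three_edges {x : Pt} {i j k : ℕ} (hi : i ∈ P.edgesAt x) (hj : j ∈ P.edgesAt x)
    (hk : k ∈ P.edgesAt x) (hij : i ≠ j) (hik : i ≠ k) (hjk : j ≠ k) : False := by
  have h := P.simple x
  have h3 : ({i, j, k} : Set ℕ).ncard = 3 := Set.ncard_eq_three.2 ⟨i, j, k, hij, hik, hjk, rfl⟩
  have hs : ({i, j, k} : Set ℕ) ⊆ P.edgesAt x := by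
    rintro l (rfl | rfl | rfl) <;> assumption
  have := Set.ncard_le_ncard hs (P.finite_edgesAt x)
  change (P.edgesAt x).ncard ≤ 2 at h
  omega

theorem mod_ne_mod_add_one (i : ℕ) : i % P.n ≠ (i + 1) % P.n := by
  have h3 := P.three_le
  intro h
  have : (0 : ℕ) ≡ 1 [MOD P.n] := Nat.ModEq.add_left_cancel' i h
  rw [Nat.ModEq, Nat.zero_mod, Nat.mod_eq_of_lt (by omega)] at this
  omega

theorem mod_ne_mod_add_two (i : ℕ) : i % P.n ≠ (i + 2) % P.n := by
  have h3 := P.three_le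
  intro h
  have : (0 : ℕ) ≡ 2 [MOD P.n] := Nat.ModEq.add_left_cancel' i h
  rw [Nat.ModEq, Nat.zero_mod, Nat.mod_eq_of_lt (by omega)] at this
  omega

theorem not_three_consecutive {x : Pt} {i : ℕ} (h₀ : x ∈ segment ℝ (P.vtx i) (P.vtx (i + 1)))
    (h₁ : x ∈ segment ℝ (P.vtx (i + 1)) (P.vtx (i + 2)))
    (h₂ : x ∈ segment ℝ (P.vtx (i + 2)) (P.vtx (i + 3))) : False :=
  P.not_three_edges (P.mod_mem_edgesAt h₀) (P.mod_mem_edgesAt h₁) (P.mod_mem_edgesAt h₂)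
    (P.mod_ne_mod_add_one i) (P.mod_ne_mod_add_two i) (P.mod_ne_mod_add_one (i + 1))

theorem mem_boundary_iff {x : Pt} : x ∈ P.boundary ↔ ∃ i, i ∈ P.edgesAt x := by
  simp [boundary, edgesAt]

/-- Near a point, the boundary consists of the edges through this point. -/
theorem exists_edgesAt_near (z : Pt) : ∃ r > 0, ∀ y, dist y z < r → ∀ i ∈ P.edgesAt y,
    i ∈ P.edgesAt z := by
  set T := ⋃ i ∈ {i | i < P.n ∧ i ∉ P.edgesAt z}, segment ℝ (P.vtx i) (P.vtx (i + 1)) with hT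
  have hcl : IsClosed T := ((Set.finite_Iio P.n).subset fun _ h => h.1).isClosed_biUnion
    fun i _ => (isCompact_segment _ _).isClosed
  have hz : z ∉ T := by
    simp only [hT, Set.mem_iUnion, not_exists]
    rintro i ⟨hi, hiz⟩ h
    exact hiz ⟨hi, h⟩
  obtain ⟨r, hr, h⟩ := exists_ball_disjoint hcl hz
  refine ⟨r, hr, fun y hy i hi => ?_⟩
  by_contra hiz
  exact h y (Set.mem_biUnion (show i ∈ {i | i < P.n ∧ i ∉ P.edgesAt z} from ⟨hi.1, hiz⟩) hi.2) hy

/-- Two consecutive edges do not overlap. -/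
theorem consecutive_edges (k : ℕ) :
    (∃ t < (0 : ℝ), P.vtx k - P.vtx (k + 1) = t • (P.vtx (k + 2) - P.vtx (k + 1))) ∨
      det2 (P.vtx (k + 2) - P.vtx (k + 1)) (P.vtx k - P.vtx (k + 1)) ≠ 0 := by
  by_cases hdet : det2 (P.vtx (k + 2) - P.vtx (k + 1)) (P.vtx k - P.vtx (k + 1)) = 0
  · left
    have hne : P.vtx (k + 2) - P.vtx (k + 1) ≠ 0 := by
      rw [sub_ne_zero, Ne, P.vtx_eq_iff]; exact (P.mod_ne_mod_add_one (k + 1)).symm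
    have hne' : P.vtx k - P.vtx (k + 1) ≠ 0 := by
      rw [sub_ne_zero, Ne, P.vtx_eq_iff]; exact P.mod_ne_mod_add_one k
    obtain ⟨t, ht⟩ := eq_smul_of_det2_eq_zero hne hdet
    refine ⟨t, ?_, ht⟩
    by_contra! h0
    rcases le_total 1 t with h1 | h1
    · have hmem : P.vtx (k + 2) ∈ segment ℝ (P.vtx (k + 1)) (P.vtx k) := by
        rw [segment_eq_image']
        refine ⟨t⁻¹, ⟨by positivity, inv_le_one_of_one_le₀ h1⟩, ?_⟩
        simp only [ht, smul_smul, inv_mul_cancel₀ (by linarith : t ≠ 0), one_smul]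
        abel
      rw [segment_symm] at hmem
      exact P.not_three_consecutive hmem (right_mem_segment _ _ _) (left_mem_segment _ _ _)
    · have hmem : P.vtx k ∈ segment ℝ (P.vtx (k + 1)) (P.vtx (k + 2)) := by
        rw [segment_eq_image']
        exact ⟨t, ⟨h0, h1⟩, by simp only [← ht]; abel⟩
      have e : ∀ m, P.vtx (k + P.n - 1 + (m + 1)) = P.vtx (k + m) := by
        intro m
        rw [← P.periodic (k + m)]
        congr 1
        have := P.n_pos
        omega
      refine P.not_three_consecutive (i := k + P.n - 1) (x := P.vtx k) ?_ ?_ ?_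
      · rw [e 0]; exact right_mem_segment _ _ _
      · rw [e 0, e 1]; exact left_mem_segment _ _ _
      · rw [e 1, e 2]; exact hmem
  · exact Or.inr hdet

/-- Near a boundary point, the boundary consists of two segments. -/
theorem boundary_near {z : Pt} (hz : z ∈ P.boundary) :
    ∃ p q : Pt, p ≠ z ∧ q ≠ z ∧
      (∃ r > 0, ∀ y, dist y z < r → (y ∈ P.boundary ↔ y ∈ segment ℝ z p ∪ segment ℝ z q)) ∧
      ((∃ t < (0 : ℝ), q - z = t • (p - z)) ∨ det2 (p - z) (q - z) ≠ 0) ∧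
      (z ∉ P.vertexSet → ∃ t < (0 : ℝ), q - z = t • (p - z)) := by
  obtain ⟨r, hr, hnear⟩ := P.exists_edgesAt_near z
  by_cases hv : z ∈ P.vertexSet
  · obtain ⟨k, hk⟩ : ∃ k, z = P.vtx (k + 1) := by
      obtain ⟨i, -, rfl⟩ := hv
      refine ⟨i + P.n - 1, ?_⟩
      rw [← P.periodic i]
      congr 1
      have := P.n_pos
      omega
    subst hk
    refine ⟨P.vtx (k + 2), P.vtx k, ?_, ?_, ⟨r, hr, fun y hy => ⟨fun h => ?_, ?_⟩⟩,
      P.consecutive_edges k, fun h => absurd hv h⟩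
    · rw [Ne, P.vtx_eq_iff]; exact (P.mod_ne_mod_add_one (k + 1)).symm
    · rw [Ne, P.vtx_eq_iff]; exact P.mod_ne_mod_add_one k
    · obtain ⟨i, hi⟩ := P.mem_boundary_iff.1 h
      have hiz := hnear y hy i hi
      have hk0 := P.mod_mem_edgesAt (right_mem_segment ℝ (P.vtx k) (P.vtx (k + 1)))
      have hk1 := P.mod_mem_edgesAt (left_mem_segment ℝ (P.vtx (k + 1)) (P.vtx (k + 1 + 1)))
      by_cases h0 : i = k % P.n
      · right
        have := hi.2
        rw [h0, vtx_mod, vtx_mod_add_one] at this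
        rwa [segment_symm]
      · by_cases h1 : i = (k + 1) % P.n
        · left
          have := hi.2
          rwa [h1, vtx_mod, vtx_mod_add_one] at this
        · exact (P.not_three_edges hiz hk0 hk1 h0 h1 (P.mod_ne_mod_add_one k)).elim
    · rintro (h | h)
      · exact P.mem_boundary_iff.2 ⟨_, P.mod_mem_edgesAt h⟩
      · rw [segment_symm] at h
        exact P.mem_boundary_iff.2 ⟨_, P.mod_mem_edgesAt h⟩
  · obtain ⟨i, hi⟩ := P.mem_boundary_iff.1 hz
    have hzi : z ≠ P.vtx i := fun h => hv (h ▸ P.vtx_mem i)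
    have hzi' : z ≠ P.vtx (i + 1) := fun h => hv (h ▸ P.vtx_mem (i + 1))
    have huniq : ∀ j ∈ P.edgesAt z, j = i := by
      intro j hj
      by_contra hji
      have h2 : (P.edgesAt z).ncard = 2 := by
        refine le_antisymm (P.simple z) ?_
        rw [← Set.ncard_pair hji]
        exact Set.ncard_le_ncard (by rintro l (rfl | rfl) <;> assumption) (P.finite_edgesAt z)
      exact hv (P.vtx_of_two z h2)
    have hex : ∃ t < (0 : ℝ), P.vtx (i + 1) - z = t • (P.vtx i - z) := by
      obtain ⟨α, β, hα, hβ, hαβ, h⟩ := hi.2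
      have hα0 : α ≠ 0 := by
        rintro rfl
        apply hzi'
        rw [zero_add] at hαβ
        rw [← h, hαβ]; simp
      have hβ0 : β ≠ 0 := by
        rintro rfl
        apply hzi
        rw [add_zero] at hαβ
        rw [← h, hαβ]; simp
      refine ⟨-(α / β), neg_lt_zero.2 (div_pos (hα.lt_of_ne' hα0) (hβ.lt_of_ne' hβ0)), ?_⟩
      have hβα : β = 1 - α := by linarith
      subst hβα
      have key : (1 - α) • (P.vtx (i + 1) - z) = -α • (P.vtx i - z) := by
        rw [← h]
        module
      rw [neg_smul, div_eq_inv_mul, mul_smul, ← smul_neg, ← neg_smul, ← key, smul_smul,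
        inv_mul_cancel₀ hβ0, one_smul]
    refine ⟨P.vtx i, P.vtx (i + 1), hzi.symm, hzi'.symm, ⟨r, hr, fun y hy => ?_⟩, Or.inl hex,
      fun _ => hex⟩
    have hz' : z ∈ segment ℝ (P.vtx i) (P.vtx (i + 1)) := hi.2
    constructor
    · intro h
      obtain ⟨j, hj⟩ := P.mem_boundary_iff.1 h
      have := huniq j (hnear y hy j hj)
      subst this
      have := segment_subset_union_segment hz' hj.2
      rwa [segment_symm ℝ (P.vtx j) z] at this
    · rintro (h | h)
      · exact P.mem_boundary_iff.2 ⟨i, hi.1,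
          (convex_segment _ _).segment_subset hz' (left_mem_segment _ _ _) h⟩
      · exact P.mem_boundary_iff.2 ⟨i, hi.1,
          (convex_segment _ _).segment_subset hz' (right_mem_segment _ _ _) h⟩

end SimplePolygon

/-- A set closed under addition and positive scaling. -/
def AddCone (C : Set Pt) : Prop :=
  (∀ y ∈ C, ∀ t : ℝ, 0 < t → t • y ∈ C) ∧ ∀ y ∈ C, ∀ z ∈ C, y + z ∈ C

/-- Near `z`, the set `R` looks like the cone `C`. -/
def ConeAt (R : Set Pt) (z : Pt) (C : Set Pt) : Prop :=
  (∃ r > 0, ∀ y, dist y z < r → (y ∈ R ↔ y - z ∈ C)) ∧ ∀ y ∈ C, ∀ t : ℝ, 0 < t → t • y ∈ C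

theorem det2_add_right (u v w : Pt) : det2 u (v + w) = det2 u v + det2 u w := by
  simp [det2]; ring

theorem det2_add_left (u v w : Pt) : det2 (u + v) w = det2 u w + det2 v w := by
  simp [det2]; ring

namespace SimplePolygon

variable (P : SimplePolygon)

/-- Convex sets off the boundary are inside or outside of the polygon. -/
theorem forall_mem_or_forall_notMem {W : Set Pt} (hW : Convex ℝ W)
    (h : ∀ y ∈ W, y ∉ P.boundary) :
    (∀ y ∈ W, y ∈ P.region) ∨ ∀ y ∈ W, y ∉ P.region := by
  have hco : IsOpen (P.interiorᶜ \ P.boundary) := by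
    convert P.isOpen_compl_region using 1
    ext y; simp only [region, Set.mem_sdiff, Set.mem_compl_iff, Set.mem_union]; tauto
  rcases subset_or_disjoint_of_convex P.isOpen_interior hco hW
    (Set.disjoint_left.2 h) with h' | h'
  · exact Or.inl fun y hy => Or.inr (h' hy)
  · refine Or.inr fun y hy hyR => hyR.elim (h y hy) fun hyI => ?_
    exact Set.disjoint_left.1 h' hy hyI

theorem coneAt_straight {z d : Pt} {r : ℝ} (hr : 0 < r)
    (h : ∀ y, dist y z < r → (y ∈ P.boundary ↔ det2 d (y - z) = 0)) :
    ∃ C, AddCone C ∧ ConeAt P.region z C := by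
  have side : ∀ d' : Pt, (∀ y, det2 d (y - z) = 0 → det2 d' (y - z) = 0) →
      (∀ y, dist y z < r → 0 < det2 d' (y - z) → y ∈ P.region) ∨
      (∀ y, dist y z < r → 0 < det2 d' (y - z) → y ∉ P.region) := by
    intro d' hd'
    rcases P.forall_mem_or_forall_notMem ((convex_ball z r).inter (convex_det2_pos d' z))
      (fun y hy hb => hy.2.ne' (hd' y ((h y hy.1).1 hb))) with h' | h'
    · exact Or.inl fun y h1 h2 => h' y ⟨h1, h2⟩
    · exact Or.inr fun y h1 h2 => h' y ⟨h1, h2⟩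
  have s1 := side d fun y hy => hy
  have s2 := side (-d) fun y hy => by rw [det2_neg_left, hy, neg_zero]
  simp only [det2_neg_left, Left.neg_pos_iff] at s2
  have hline : ∀ y, dist y z < r → det2 d (y - z) = 0 → y ∈ P.region := fun y h1 h2 =>
    P.boundary_subset_region ((h y h1).2 h2)
  rcases s1 with s1 | s1 <;> rcases s2 with s2 | s2
  · refine ⟨Set.univ, ⟨fun _ _ _ _ => trivial, fun _ _ _ _ => trivial⟩, ⟨r, hr, fun y hy => ?_⟩,
      fun _ _ _ _ => trivial⟩
    rcases lt_trichotomy (det2 d (y - z)) 0 with h' | h' | h'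
    · simpa using s2 y hy h'
    · simpa using hline y hy h'
    · simpa using s1 y hy h'
  · have hC : AddCone {y | 0 ≤ det2 d y} := by
      refine ⟨fun y hy t ht => ?_, fun y hy w hw => ?_⟩
      · rw [Set.mem_ofPred_eq, det2_smul_right]; exact mul_nonneg ht.le hy
      · rw [Set.mem_ofPred_eq, det2_add_right]; exact add_nonneg hy hw
    refine ⟨_, hC, ⟨r, hr, fun y hy => ?_⟩, hC.1⟩
    rw [Set.mem_ofPred_eq]
    rcases lt_trichotomy (det2 d (y - z)) 0 with h' | h' | h'
    · exact iff_of_false (s2 y hy h') (not_le.2 h')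
    · exact iff_of_true (hline y hy h') h'.ge
    · exact iff_of_true (s1 y hy h') h'.le
  · have hC : AddCone {y | det2 d y ≤ 0} := by
      refine ⟨fun y hy t ht => ?_, fun y hy w hw => ?_⟩
      · rw [Set.mem_ofPred_eq, det2_smul_right]; exact mul_nonpos_of_nonneg_of_nonpos ht.le hy
      · rw [Set.mem_ofPred_eq, det2_add_right]; exact add_nonpos hy hw
    refine ⟨_, hC, ⟨r, hr, fun y hy => ?_⟩, hC.1⟩
    rw [Set.mem_ofPred_eq]
    rcases lt_trichotomy (det2 d (y - z)) 0 with h' | h' | h'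
    · exact iff_of_true (s2 y hy h') h'.le
    · exact iff_of_true (hline y hy h') h'.le
    · exact iff_of_false (s1 y hy h') (not_le.2 h')
  · have hC : AddCone {y | det2 d y = 0} := by
      refine ⟨fun y hy t ht => ?_, fun y hy w hw => ?_⟩
      · rw [Set.mem_ofPred_eq, det2_smul_right, show det2 d y = 0 from hy, mul_zero]
      · rw [Set.mem_ofPred_eq, det2_add_right, show det2 d y = 0 from hy,
          show det2 d w = 0 from hw, add_zero]
    refine ⟨_, hC, ⟨r, hr, fun y hy => ?_⟩, hC.1⟩
    rw [Set.mem_ofPred_eq]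
    rcases lt_trichotomy (det2 d (y - z)) 0 with h' | h' | h'
    · exact iff_of_false (s2 y hy h') h'.ne
    · exact iff_of_true (hline y hy h') h'
    · exact iff_of_false (s1 y hy h') h'.ne'

theorem coneAt_corner {z d₁ d₂ : Pt} (hd : 0 < det2 d₁ d₂) {r : ℝ} (hr : 0 < r)
    (h : ∀ y, dist y z < r → (y ∈ P.boundary ↔
      (∃ t : ℝ, 0 ≤ t ∧ y - z = t • d₁) ∨ ∃ t : ℝ, 0 ≤ t ∧ y - z = t • d₂)) :
    ∃ C, (AddCone C ∨ (AddCone Cᶜ ∧ (0 : Pt) ∈ C) ∨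
      ∀ y ∈ C, (∃ t : ℝ, 0 ≤ t ∧ y = t • d₁) ∨ ∃ t : ℝ, 0 ≤ t ∧ y = t • d₂) ∧
      ConeAt P.region z C := by
  have hb1 : ∀ y, dist y z < r → y ∈ P.boundary → 0 ≤ det2 d₁ (y - z) ∧ 0 ≤ det2 (y - z) d₂ ∧
      (det2 d₁ (y - z) = 0 ∨ det2 (y - z) d₂ = 0) := by
    intro y hy hyb
    rcases (h y hy).1 hyb with ⟨t, ht, e⟩ | ⟨t, ht, e⟩
    · rw [e, det2_smul_left, det2_smul_right, det2_self, mul_zero]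
      exact ⟨le_rfl, by positivity, Or.inl rfl⟩
    · rw [e, det2_smul_left, det2_smul_right, det2_self, mul_zero]
      exact ⟨by positivity, le_rfl, Or.inr rfl⟩
  have hb2 : ∀ v : Pt, 0 ≤ det2 d₁ v → 0 ≤ det2 v d₂ → (det2 d₁ v = 0 ∨ det2 v d₂ = 0) →
      (∃ t : ℝ, 0 ≤ t ∧ v = t • d₁) ∨ ∃ t : ℝ, 0 ≤ t ∧ v = t • d₂ := by
    intro v h1 h2 h3
    have e := eq_comb_of_det2_ne_zero hd.ne' v
    rcases h3 with h3 | h3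
    · left
      rw [h3, zero_div, zero_smul, add_zero] at e
      exact ⟨_, div_nonneg h2 hd.le, e⟩
    · right
      rw [h3, zero_div, zero_smul, zero_add] at e
      exact ⟨_, div_nonneg h1 hd.le, e⟩
  have hray : ∀ y, dist y z < r → 0 ≤ det2 d₁ (y - z) → 0 ≤ det2 (y - z) d₂ →
      (det2 d₁ (y - z) = 0 ∨ det2 (y - z) d₂ = 0) → y ∈ P.region := fun y hy h1 h2 h3 =>
    P.boundary_subset_region ((h y hy).2 (hb2 _ h1 h2 h3))
  have conv : ∀ d : Pt, Convex ℝ {y : Pt | 0 < det2 (y - z) d} := by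
    intro d
    have : {y : Pt | 0 < det2 (y - z) d} = {y : Pt | 0 < det2 (-d) (y - z)} := by
      ext y; simp only [Set.mem_ofPred_eq, det2_neg_left, det2_swap d (y - z)]
    rw [this]; exact convex_det2_pos _ _
  have s1 : (∀ y, dist y z < r → 0 < det2 d₁ (y - z) → 0 < det2 (y - z) d₂ → y ∈ P.region) ∨
      (∀ y, dist y z < r → 0 < det2 d₁ (y - z) → 0 < det2 (y - z) d₂ → y ∉ P.region) := by
    rcases P.forall_mem_or_forall_notMem ((convex_ball z r).inter
      ((convex_det2_pos d₁ z).inter (conv d₂)))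
      (fun y hy hb => (hb1 y hy.1 hb).2.2.elim hy.2.1.ne' hy.2.2.ne') with h' | h'
    · exact Or.inl fun y h1 h2 h3 => h' y ⟨h1, h2, h3⟩
    · exact Or.inr fun y h1 h2 h3 => h' y ⟨h1, h2, h3⟩
  have s2 : (∀ y, dist y z < r → det2 d₁ (y - z) < 0 ∨ det2 (y - z) d₂ < 0 → y ∈ P.region) ∨
      (∀ y, dist y z < r → det2 d₁ (y - z) < 0 ∨ det2 (y - z) d₂ < 0 → y ∉ P.region) := by
    obtain ⟨t, ht, -, htr⟩ := dist_add_smul_lt (a := z) (d := -d₁ - d₂) hr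
    have e1 : 0 < det2 (-d₁) (z + t • (-d₁ - d₂) - z) := by
      have : det2 (-d₁) (z + t • (-d₁ - d₂) - z) = t * det2 d₁ d₂ := by simp [det2]; ring
      rw [this]; positivity
    have e2 : 0 < det2 (z + t • (-d₁ - d₂) - z) (-d₂) := by
      have : det2 (z + t • (-d₁ - d₂) - z) (-d₂) = t * det2 d₁ d₂ := by simp [det2]; ring
      rw [this]; positivity
    generalize z + t • (-d₁ - d₂) = m at *
    have a1 := P.forall_mem_or_forall_notMem ((convex_ball z r).inter (convex_det2_pos (-d₁) z))
      (fun y hy hb => by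
        have h1 := hy.2
        rw [Set.mem_ofPred_eq, det2_neg_left] at h1
        linarith [(hb1 y hy.1 hb).1])
    have a2 := P.forall_mem_or_forall_notMem ((convex_ball z r).inter (conv (-d₂)))
      (fun y hy hb => by
        have h1 := hy.2
        rw [Set.mem_ofPred_eq, det2_neg_right] at h1
        linarith [(hb1 y hy.1 hb).2.1])
    rcases a1 with a1 | a1 <;> rcases a2 with a2 | a2
    · refine Or.inl fun y hy h' => h'.elim (fun h' => a1 y ⟨hy, ?_⟩) fun h' => a2 y ⟨hy, ?_⟩
      · rw [Set.mem_ofPred_eq, det2_neg_left]; linarith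
      · rw [Set.mem_ofPred_eq, det2_neg_right]; linarith
    · exact absurd (a1 m ⟨htr, e1⟩) (a2 m ⟨htr, e2⟩)
    · exact absurd (a2 m ⟨htr, e2⟩) (a1 m ⟨htr, e1⟩)
    · refine Or.inr fun y hy h' => h'.elim (fun h' => a1 y ⟨hy, ?_⟩) fun h' => a2 y ⟨hy, ?_⟩
      · rw [Set.mem_ofPred_eq, det2_neg_left]; linarith
      · rw [Set.mem_ofPred_eq, det2_neg_right]; linarith
  have tri : ∀ v : Pt, (0 < det2 d₁ v ∧ 0 < det2 v d₂) ∨ (det2 d₁ v < 0 ∨ det2 v d₂ < 0) ∨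
      (0 ≤ det2 d₁ v ∧ 0 ≤ det2 v d₂ ∧ (det2 d₁ v = 0 ∨ det2 v d₂ = 0)) := by
    intro v
    rcases lt_trichotomy (det2 d₁ v) 0 with h1 | h1 | h1
    · exact Or.inr (Or.inl (Or.inl h1))
    · rcases lt_or_ge (det2 v d₂) 0 with h2 | h2
      · exact Or.inr (Or.inl (Or.inr h2))
      · exact Or.inr (Or.inr ⟨h1.ge, h2, Or.inl h1⟩)
    · rcases lt_trichotomy (det2 v d₂) 0 with h2 | h2 | h2
      · exact Or.inr (Or.inl (Or.inr h2))
      · exact Or.inr (Or.inr ⟨h1.le, h2.ge, Or.inr h2⟩)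
      · exact Or.inl ⟨h1, h2⟩
  rcases s1 with s1 | s1 <;> rcases s2 with s2 | s2
  · refine ⟨Set.univ, Or.inl ⟨fun _ _ _ _ => trivial, fun _ _ _ _ => trivial⟩,
      ⟨r, hr, fun y hy => iff_of_true ?_ trivial⟩, fun _ _ _ _ => trivial⟩
    rcases tri (y - z) with h' | h' | h'
    · exact s1 y hy h'.1 h'.2
    · exact s2 y hy h'
    · exact hray y hy h'.1 h'.2.1 h'.2.2
  · have hC : AddCone {y | 0 ≤ det2 d₁ y ∧ 0 ≤ det2 y d₂} := by
      refine ⟨fun y hy t ht => ?_, fun y hy w hw => ?_⟩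
      · rw [Set.mem_ofPred_eq, det2_smul_right, det2_smul_left]
        exact ⟨mul_nonneg ht.le hy.1, mul_nonneg ht.le hy.2⟩
      · rw [Set.mem_ofPred_eq, det2_add_right, det2_add_left]
        exact ⟨add_nonneg hy.1 hw.1, add_nonneg hy.2 hw.2⟩
    refine ⟨_, Or.inl hC, ⟨r, hr, fun y hy => ?_⟩, hC.1⟩
    rw [Set.mem_ofPred_eq]
    rcases tri (y - z) with h' | h' | h'
    · exact iff_of_true (s1 y hy h'.1 h'.2) ⟨h'.1.le, h'.2.le⟩
    · exact iff_of_false (s2 y hy h') fun hn => h'.elim hn.1.not_gt hn.2.not_gt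
    · exact iff_of_true (hray y hy h'.1 h'.2.1 h'.2.2) ⟨h'.1, h'.2.1⟩
  · have hC : AddCone {y | 0 < det2 d₁ y ∧ 0 < det2 y d₂} := by
      refine ⟨fun y hy t ht => ?_, fun y hy w hw => ?_⟩
      · rw [Set.mem_ofPred_eq, det2_smul_right, det2_smul_left]
        exact ⟨mul_pos ht hy.1, mul_pos ht hy.2⟩
      · rw [Set.mem_ofPred_eq, det2_add_right, det2_add_left]
        exact ⟨add_pos hy.1 hw.1, add_pos hy.2 hw.2⟩
    refine ⟨{y | 0 < det2 d₁ y ∧ 0 < det2 y d₂}ᶜ, Or.inr (Or.inl ⟨by rwa [compl_compl], ?_⟩),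
      ⟨r, hr, fun y hy => ?_⟩, fun y hy t ht hty => hy ?_⟩
    · simp [det2]
    · rw [Set.mem_compl_iff, Set.mem_ofPred_eq]
      rcases tri (y - z) with h' | h' | h'
      · exact iff_of_false (s1 y hy h'.1 h'.2) (not_not.2 h')
      · exact iff_of_true (s2 y hy h') fun hn => h'.elim hn.1.not_gt hn.2.not_gt
      · exact iff_of_true (hray y hy h'.1 h'.2.1 h'.2.2) fun hn =>
          h'.2.2.elim hn.1.ne' hn.2.ne'
    · rw [Set.mem_ofPred_eq, det2_smul_right, det2_smul_left] at hty
      exact ⟨(mul_pos_iff_of_pos_left ht).1 hty.1, (mul_pos_iff_of_pos_left ht).1 hty.2⟩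
  · refine ⟨{y | 0 ≤ det2 d₁ y ∧ 0 ≤ det2 y d₂ ∧ (det2 d₁ y = 0 ∨ det2 y d₂ = 0)},
      Or.inr (Or.inr fun y hy => hb2 y hy.1 hy.2.1 hy.2.2), ⟨r, hr, fun y hy => ?_⟩,
      fun y hy t ht => ?_⟩
    · rw [Set.mem_ofPred_eq]
      rcases tri (y - z) with h' | h' | h'
      · exact iff_of_false (s1 y hy h'.1 h'.2) fun hn => hn.2.2.elim h'.1.ne' h'.2.ne'
      · exact iff_of_false (s2 y hy h') fun hn => h'.elim hn.1.not_gt hn.2.1.not_gt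
      · exact iff_of_true (hray y hy h'.1 h'.2.1 h'.2.2) h'
    · rw [Set.mem_ofPred_eq, det2_smul_right, det2_smul_left]
      exact ⟨mul_nonneg ht.le hy.1, mul_nonneg ht.le hy.2.1,
        hy.2.2.imp (fun h => by rw [h, mul_zero]) fun h => by rw [h, mul_zero]⟩

/-- A simple polygon is locally a cone of a special kind. -/
theorem exists_coneAt {z : Pt} (hz : z ∈ P.region) :
    ∃ C, ConeAt P.region z C ∧ (AddCone C ∨ (AddCone Cᶜ ∧ (0 : Pt) ∈ C) ∨
      ∃ d₁ d₂ : Pt, ∀ y ∈ C, (∃ t : ℝ, 0 ≤ t ∧ y = t • d₁) ∨ ∃ t : ℝ, 0 ≤ t ∧ y = t • d₂) ∧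
      (z ∉ P.vertexSet → AddCone C) := by
  rcases hz with hz | hz
  · obtain ⟨p, q, hp, hq, ⟨r, hr, hpq⟩, hd, hv⟩ := P.boundary_near hz
    have hray : ∀ y, dist y z < min r (min (dist z p) (dist z q)) → (y ∈ P.boundary ↔
        (∃ t : ℝ, 0 ≤ t ∧ y - z = t • (p - z)) ∨ ∃ t : ℝ, 0 ≤ t ∧ y - z = t • (q - z)) := by
      intro y hy
      rw [lt_min_iff, lt_min_iff] at hy
      rw [hpq y hy.1, Set.mem_union, mem_segment_iff_of_dist_lt hp.symm hy.2.1,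
        mem_segment_iff_of_dist_lt hq.symm hy.2.2]
      simp only [sub_eq_iff_eq_add']
    have hr' : 0 < min r (min (dist z p) (dist z q)) :=
      lt_min hr (lt_min (dist_pos.2 hp.symm) (dist_pos.2 hq.symm))
    by_cases hs : ∃ t < (0 : ℝ), q - z = t • (p - z)
    · obtain ⟨t, ht, hqp⟩ := hs
      obtain ⟨C, h1, h2⟩ := P.coneAt_straight hr' fun y hy => by
        rw [hray y hy]
        constructor
        · rintro (⟨u, -, h⟩ | ⟨u, -, h⟩)
          · rw [h, det2_smul_right, det2_self, mul_zero]
          · rw [h, hqp, det2_smul_right, det2_smul_right, det2_self, mul_zero, mul_zero]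
        · intro h
          obtain ⟨u, hu⟩ := eq_smul_of_det2_eq_zero (sub_ne_zero.2 hp) h
          rcases le_total 0 u with h0 | h0
          · exact Or.inl ⟨u, h0, hu⟩
          · refine Or.inr ⟨u / t, div_nonneg_of_nonpos h0 ht.le, ?_⟩
            rw [hqp, smul_smul, div_mul_cancel₀ _ ht.ne, hu]
      exact ⟨C, h2, Or.inl h1, fun _ => h1⟩
    · have hdet := hd.resolve_left hs
      rcases hdet.lt_or_gt with hdet | hdet
      · rw [det2_swap, neg_lt_zero] at hdet
        obtain ⟨C, h1, h2⟩ := P.coneAt_corner hdet hr' fun y hy => (hray y hy).trans or_comm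
        exact ⟨C, h2, h1.imp_right (Or.imp_right fun h => ⟨_, _, h⟩), fun h => absurd (hv h) hs⟩
      · obtain ⟨C, h1, h2⟩ := P.coneAt_corner hdet hr' hray
        exact ⟨C, h2, h1.imp_right (Or.imp_right fun h => ⟨_, _, h⟩), fun h => absurd (hv h) hs⟩
  · have h : AddCone Set.univ := ⟨fun _ _ _ _ => trivial, fun _ _ _ _ => trivial⟩
    obtain ⟨r, hr, hb⟩ := Metric.isOpen_iff.1 P.isOpen_interior z hz
    exact ⟨Set.univ, ⟨⟨r, hr, fun y hy => iff_of_true (Or.inr (hb hy)) trivial⟩, h.1⟩,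
      Or.inl h, fun _ => h⟩

end SimplePolygon

/-! ### Cones and tight sectors -/

namespace AddCone

variable {U : Set Pt} {e₁ e₂ e₃ : Pt}

theorem comb_mem (hU : AddCone U) {x y : Pt} (hx : x ∈ U) (hy : y ∈ U) {s t : ℝ} (hs : 0 < s)
    (ht : 0 < t) : s • x + t • y ∈ U := hU.2 _ (hU.1 x hx s hs) _ (hU.1 y hy t ht)

theorem mem_of_smul_mem (hU : AddCone U) {x : Pt} {s : ℝ} (hs : 0 < s) (hx : s • x ∈ U) :
    x ∈ U := by
  have := hU.1 _ hx s⁻¹ (inv_pos.2 hs)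
  rwa [smul_smul, inv_mul_cancel₀ hs.ne', one_smul] at this

theorem mem_of_between (hU : AddCone U) {a b : ℝ} (ha : 0 < a) (hb : 0 < b)
    (he : e₃ = a • e₁ + b • e₂)
    (h₁ : ∃ s t : ℝ, 0 < s ∧ 0 < t ∧ s • e₁ + t • e₃ ∈ U)
    (h₂ : ∃ s t : ℝ, 0 < s ∧ 0 < t ∧ s • e₂ + t • e₃ ∈ U) : e₃ ∈ U := by
  obtain ⟨s, t, hs, ht, h⟩ := h₁
  obtain ⟨s', t', hs', ht', h'⟩ := h₂
  have key := hU.comb_mem h h' (div_pos ha hs) (div_pos hb hs')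
  have : (a / s) • (s • e₁ + t • e₃) + (b / s') • (s' • e₂ + t' • e₃) =
      (1 + a / s * t + b / s' * t') • e₃ := by
    rw [smul_add, smul_add, smul_smul, smul_smul, smul_smul, smul_smul, div_mul_cancel₀ _ hs.ne',
      div_mul_cancel₀ _ hs'.ne']
    rw [add_smul, add_smul, one_smul, add_add_add_comm, ← he, add_assoc]
  rw [this] at key
  exact hU.mem_of_smul_mem (by positivity) key

theorem not_of_opposite (hU : AddCone U) (h0 : (0 : Pt) ∉ U) (h₁ : e₁ ∉ U) (h₂ : e₂ ∉ U)
    {a b : ℝ} (ha : 0 < a) (hb : 0 < b) (he : e₃ = -a • e₁ + -b • e₂)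
    (h₁₂ : ∃ s t : ℝ, 0 < s ∧ 0 < t ∧ s • e₁ + t • e₂ ∈ U)
    (h₁₃ : ∃ s t : ℝ, 0 < s ∧ 0 < t ∧ s • e₁ + t • e₃ ∈ U)
    (h₂₃ : ∃ s t : ℝ, 0 < s ∧ 0 < t ∧ s • e₂ + t • e₃ ∈ U) : False := by
  obtain ⟨p, q, hp, hq, hpq⟩ := h₁₂
  obtain ⟨s, t, hs, ht, hst⟩ := h₁₃
  obtain ⟨s', t', hs', ht', hst'⟩ := h₂₃
  have hta := mul_pos ht ha
  have htb := mul_pos ht hb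
  have hta' := mul_pos ht' ha
  have htb' := mul_pos ht' hb
  have e13 : s • e₁ + t • e₃ = (s - t * a) • e₁ - (t * b) • e₂ := by rw [he]; module
  have e23 : s' • e₂ + t' • e₃ = -(t' * a) • e₁ + (s' - t' * b) • e₂ := by rw [he]; module
  rw [e13] at hst
  rw [e23] at hst'
  have c1 : s - t * a ≤ 0 := by
    by_contra! hc
    refine h₁ (hU.mem_of_smul_mem (s := (t * b) * p + q * (s - t * a)) (by positivity) ?_)
    convert hU.comb_mem hpq hst htb hq using 1
    module
  have c2 : s' - t' * b ≤ 0 := by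
    by_contra! hc
    refine h₂ (hU.mem_of_smul_mem (s := (t' * a) * q + p * (s' - t' * b)) (by positivity) ?_)
    convert hU.comb_mem hpq hst' hta' hp using 1
    module
  obtain ⟨m, n, hm, hn, hmn⟩ : ∃ m n : ℝ, 0 < m ∧ 0 < n ∧ -m • e₁ + -n • e₂ ∈ U := by
    refine ⟨t' * a - (s - t * a), t * b - (s' - t' * b), by linarith, by linarith, ?_⟩
    convert hU.2 _ hst _ hst' using 1
    module
  rcases lt_trichotomy (m * q) (p * n) with h | h | h
  · refine h₁ (hU.mem_of_smul_mem (s := p * n - m * q) (by linarith) ?_)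
    convert hU.comb_mem hpq hmn hn hq using 1
    module
  · apply h0
    convert hU.comb_mem hpq hmn hm hp using 1
    have : m • (p • e₁ + q • e₂) + p • (-m • e₁ + -n • e₂) = (m * q - p * n) • e₂ := by module
    rw [this, h, sub_self, zero_smul]
  · refine h₂ (hU.mem_of_smul_mem (s := m * q - p * n) (by linarith) ?_)
    convert hU.comb_mem hpq hmn hm hp using 1
    module

theorem not_tripod (hU : AddCone U) (h0 : (0 : Pt) ∉ U) (h₁ : e₁ ∉ U) (h₂ : e₂ ∉ U) (h₃ : e₃ ∉ U)
    (d₁₂ : det2 e₁ e₂ ≠ 0) (d₁₃ : det2 e₁ e₃ ≠ 0) (d₂₃ : det2 e₂ e₃ ≠ 0)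
    (h₁₂ : ∃ s t : ℝ, 0 < s ∧ 0 < t ∧ s • e₁ + t • e₂ ∈ U)
    (h₁₃ : ∃ s t : ℝ, 0 < s ∧ 0 < t ∧ s • e₁ + t • e₃ ∈ U)
    (h₂₃ : ∃ s t : ℝ, 0 < s ∧ 0 < t ∧ s • e₂ + t • e₃ ∈ U) : False := by
  have swap : ∀ {x y : Pt}, (∃ s t : ℝ, 0 < s ∧ 0 < t ∧ s • x + t • y ∈ U) →
      ∃ s t : ℝ, 0 < s ∧ 0 < t ∧ s • y + t • x ∈ U := by
    rintro x y ⟨s, t, hs, ht, h⟩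
    exact ⟨t, s, ht, hs, by rwa [add_comm]⟩
  have he := eq_comb_of_det2_ne_zero d₁₂ e₃
  have ha : det2 e₃ e₂ / det2 e₁ e₂ ≠ 0 := by
    refine div_ne_zero ?_ d₁₂
    rw [det2_swap]; exact neg_ne_zero.2 d₂₃
  have hb : det2 e₁ e₃ / det2 e₁ e₂ ≠ 0 := div_ne_zero d₁₃ d₁₂
  generalize det2 e₃ e₂ / det2 e₁ e₂ = a at *
  generalize det2 e₁ e₃ / det2 e₁ e₂ = b at *
  rcases ha.lt_or_gt with ha' | ha' <;> rcases hb.lt_or_gt with hb' | hb'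
  · exact hU.not_of_opposite h0 h₁ h₂ (neg_pos.2 ha') (neg_pos.2 hb') (by simpa using he)
      h₁₂ h₁₃ h₂₃
  · refine h₂ (hU.mem_of_between (a := -a / b) (b := 1 / b) (e₁ := e₁) (e₂ := e₃)
      (div_pos (neg_pos.2 ha') hb') (by positivity) ?_ h₁₂ (swap h₂₃))
    rw [he, smul_add, smul_smul, smul_smul, one_div, inv_mul_cancel₀ hb, one_smul, ← add_assoc,
      ← add_smul]
    rw [show -a / b + b⁻¹ * a = 0 by field_simp; ring, zero_smul, zero_add]
  · refine h₁ (hU.mem_of_between (a := -b / a) (b := 1 / a) (e₁ := e₂) (e₂ := e₃)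
      (div_pos (neg_pos.2 hb') ha') (by positivity) ?_ (swap h₁₂) (swap h₁₃))
    rw [he, smul_add, smul_smul, smul_smul, one_div, inv_mul_cancel₀ ha, one_smul, add_left_comm,
      ← add_smul]
    rw [show -b / a + a⁻¹ * b = 0 by field_simp; ring, zero_smul, add_zero]
  · exact h₃ (hU.mem_of_between ha' hb' he h₁₃ h₂₃)

end AddCone

namespace ConeAt

variable {R C : Set Pt} {z p q : Pt}

theorem sub_mem (h : ConeAt R z C) (hp : segment ℝ z p ⊆ R) : p - z ∈ C := by
  obtain ⟨⟨r, hr, h1⟩, h2⟩ := h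
  obtain ⟨t, ht0, ht1, htr⟩ := dist_add_smul_lt (a := z) (d := p - z) hr
  have hmem : z + t • (p - z) ∈ R := hp (by
    rw [segment_eq_image']; exact ⟨t, ⟨ht0.le, ht1.le⟩, rfl⟩)
  have := h2 _ ((h1 _ htr).1 hmem) t⁻¹ (inv_pos.2 ht0)
  rwa [add_sub_cancel_left, smul_smul, inv_mul_cancel₀ ht0.ne', one_smul] at this

theorem exists_of_tight (h : ConeAt R z C) {d₁ d₂ : Pt} (ht : Tight R z d₁ d₂) :
    ∃ s t : ℝ, 0 < s ∧ 0 < t ∧ s • d₁ + t • d₂ ∈ Cᶜ := by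
  obtain ⟨⟨r, hr, h1⟩, h2⟩ := h
  obtain ⟨ε, hε, h3⟩ := exists_sector_near (e := z) (d₁ := d₁) (d₂ := d₂) hr
  obtain ⟨α, β, hα, hα', hβ, hβ', hR⟩ := ht ε hε
  refine ⟨α, β, hα, hβ, fun hC => hR ((h1 _ (h3 α β hα hα' hβ hβ')).2 ?_)⟩
  rwa [add_assoc, add_sub_cancel_left]

theorem exists_star (h : ConeAt R z C) (hz : z ∈ R) :
    ∃ r > 0, ∀ y ∈ R, dist y z < r → segment ℝ z y ⊆ R := by
  obtain ⟨⟨r, hr, h1⟩, h2⟩ := h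
  refine ⟨r, hr, fun y hy hd => ?_⟩
  rw [segment_eq_image']
  rintro _ ⟨t, ⟨ht0, ht1⟩, rfl⟩
  rcases ht0.eq_or_lt with rfl | ht0
  · simpa using hz
  · refine (h1 _ ?_).2 ?_
    · rw [dist_eq_norm, add_sub_cancel_left, norm_smul, Real.norm_of_nonneg ht0.le,
        ← dist_eq_norm]
      calc t * dist y z ≤ 1 * dist y z := by gcongr
        _ < r := by rwa [one_mul]
    · rw [add_sub_cancel_left]
      exact h2 _ ((h1 y hd).1 hy) t ht0

end ConeAt

namespace SimplePolygon

variable (P : SimplePolygon) {z p q e₁ e₂ e₃ : Pt}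

theorem exists_star (hz : z ∈ P.region) :
    ∃ r > 0, ∀ y ∈ P.region, dist y z < r → segment ℝ z y ⊆ P.region := by
  obtain ⟨C, hC, -⟩ := P.exists_coneAt hz
  exact hC.exists_star hz

variable {P}

/-- Tight corners are vertices of the polygon. -/
theorem mem_vertexSet_of_tight (hp : segment ℝ z p ⊆ P.region) (hq : segment ℝ z q ⊆ P.region)
    (h : Tight P.region z (p - z) (q - z)) : z ∈ P.vertexSet := by
  by_contra hz
  obtain ⟨C, hC, -, hv⟩ := P.exists_coneAt (hp (left_mem_segment _ _ _))
  obtain ⟨s, t, hs, ht, hst⟩ := hC.exists_of_tight h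
  exact hst ((hv hz).comb_mem (hC.sub_mem hp) (hC.sub_mem hq) hs ht)

/-- There are no three pairwise tight directions. -/
theorem not_three_tight (h₁ : segment ℝ z e₁ ⊆ P.region) (h₂ : segment ℝ z e₂ ⊆ P.region)
    (h₃ : segment ℝ z e₃ ⊆ P.region) (d₁₂ : det2 (e₁ - z) (e₂ - z) ≠ 0)
    (d₁₃ : det2 (e₁ - z) (e₃ - z) ≠ 0) (d₂₃ : det2 (e₂ - z) (e₃ - z) ≠ 0)
    (t₁₂ : Tight P.region z (e₁ - z) (e₂ - z)) (t₁₃ : Tight P.region z (e₁ - z) (e₃ - z))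
    (t₂₃ : Tight P.region z (e₂ - z) (e₃ - z)) : False := by
  obtain ⟨C, hC, hcases, -⟩ := P.exists_coneAt (h₁ (left_mem_segment _ _ _))
  have m₁ := hC.sub_mem h₁
  have m₂ := hC.sub_mem h₂
  have m₃ := hC.sub_mem h₃
  rcases hcases with h | ⟨h, h0⟩ | ⟨f₁, f₂, h⟩
  · obtain ⟨s, t, hs, ht, hst⟩ := hC.exists_of_tight t₁₂
    exact hst (h.comb_mem m₁ m₂ hs ht)
  · exact h.not_tripod (not_not.2 h0) (not_not.2 m₁) (not_not.2 m₂) (not_not.2 m₃) d₁₂ d₁₃ d₂₃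
      (hC.exists_of_tight t₁₂) (hC.exists_of_tight t₁₃) (hC.exists_of_tight t₂₃)
  · have par : ∀ (f : Pt) (s t : ℝ), det2 (s • f) (t • f) = 0 := fun f s t => by
      rw [det2_smul_left, det2_smul_right, det2_self, mul_zero, mul_zero]
    rcases h _ m₁ with ⟨t₁, -, g₁⟩ | ⟨t₁, -, g₁⟩ <;> rcases h _ m₂ with ⟨t₂, -, g₂⟩ | ⟨t₂, -, g₂⟩ <;>
      rcases h _ m₃ with ⟨t₃, -, g₃⟩ | ⟨t₃, -, g₃⟩ <;> rw [g₁, g₂] at d₁₂ <;>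
      rw [g₁, g₃] at d₁₃ <;> rw [g₂, g₃] at d₂₃ <;>
      first
        | exact d₁₂ (par _ _ _)
        | exact d₁₃ (par _ _ _)
        | exact d₂₃ (par _ _ _)

end SimplePolygon

/-! ### Geodesic triangles in simple polygons -/

namespace IsShortest

variable {P : SimplePolygon} {S : Set Pt} {s t p q r z a b c e : Pt} {A B C N D : List Pt}

/-- A proper corner of a shortest polyline is a vertex of the polygon. -/
theorem mem_vertexSet (h : IsShortest P.region s t (A ++ z :: e :: b :: B))
    (hdet : det2 (z - e) (b - e) ≠ 0) : e ∈ P.vertexSet := by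
  have hm := h.middle
  refine SimplePolygon.mem_vertexSet_of_tight ?_ ?_ (tight_of_isShortest hm hdet)
  · rw [segment_symm]
    exact Set.subset_union_left.trans hm.subset
  · exact (Set.subset_union_left.trans Set.subset_union_right).trans hm.subset

theorem det2_ne_zero (hS : NoThreeCollinear S) (h : IsShortest P.region s t (A ++ z :: a :: b :: B))
    (hc : List.IsChain (· ≠ ·) (A ++ z :: a :: b :: B)) (hm : ∀ x ∈ A ++ z :: a :: b :: B, x ∈ S) :
    det2 (z - a) (b - a) ≠ 0 := by
  have hc' := (List.isChain_append.1 hc).2.1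
  rw [List.isChain_cons_cons] at hc'
  have hz := h.right.notMem_tail hc'.1 hc'.2
  have hzb : z ≠ b := by
    rintro rfl
    exact hz (subset_polylineSet (by simp))
  exact hS a (hm a (by simp)) z (hm z (by simp)) b (hm b (by simp)) hc'.1.symm
    (List.isChain_cons_cons.1 hc'.2).1 hzb

/-- The branching point of two geodesics does not lie on the third side of the triangle. -/
theorem branch_notMem (hS : NoThreeCollinear S) (hp : p ∉ P.vertexSet)
    (h₁ : IsShortest P.region p q (D ++ a :: b :: A))
    (h₃ : IsShortest P.region p r (D ++ a :: c :: C)) (h₂ : IsShortest P.region q r N)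
    (hc₁ : List.IsChain (· ≠ ·) (D ++ a :: b :: A)) (hc₃ : List.IsChain (· ≠ ·) (D ++ a :: c :: C))
    (hc₂ : List.IsChain (· ≠ ·) N)
    (hS₁ : ∀ x ∈ D ++ a :: b :: A, x ∈ S) (hS₃ : ∀ x ∈ D ++ a :: c :: C, x ∈ S)
    (hdet : det2 (b - a) (c - a) ≠ 0) : a ∉ polylineSet N := by
  intro ha
  obtain ⟨X, Y, hXY, -, -⟩ := h₂.exists_split hc₂ ha
  have hrev := h₁.right.reverse
  rw [List.reverse_cons] at hrev
  have hsp := hXY.splice hrev h₃.right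
  rw [List.reverse_cons, List.append_assoc, List.singleton_append] at hsp
  have hbc := hsp.middle
  have tbc := tight_of_isShortest hbc hdet
  have sb : segment ℝ a b ⊆ P.region := by
    rw [segment_symm]
    exact Set.subset_union_left.trans hbc.subset
  have sc : segment ℝ a c ⊆ P.region :=
    (Set.subset_union_left.trans Set.subset_union_right).trans hbc.subset
  rcases D.eq_nil_or_concat with rfl | ⟨D, z, rfl⟩
  · have : a = p := by simpa using h₁.head
    exact hp (this ▸ SimplePolygon.mem_vertexSet_of_tight sb sc tbc)
  · simp only [List.concat_eq_append, List.append_assoc, List.singleton_append] at h₁ h₃ hc₁ hc₃ hS₁ hS₃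
    have d₁ := h₁.det2_ne_zero hS hc₁ hS₁
    have d₃ := h₃.det2_ne_zero hS hc₃ hS₃
    have sz : segment ℝ a z ⊆ P.region := by
      rw [segment_symm]
      exact Set.subset_union_left.trans h₁.middle.subset
    exact SimplePolygon.not_three_tight sz sb sc d₁ d₃ hdet (tight_of_isShortest h₁.middle d₁)
      (tight_of_isShortest h₃.middle d₃) tbc

/-- A geodesic triangle whose sides at `p` branch with a left turn winds counterclockwise. -/
theorem triangle (hS : NoThreeCollinear S) (hp : p ∉ P.vertexSet)
    (h₁ : IsShortest P.region p q (D ++ a :: b :: A))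
    (h₃ : IsShortest P.region p r (D ++ a :: c :: C)) (h₂ : IsShortest P.region q r N)
    (hc₁ : List.IsChain (· ≠ ·) (D ++ a :: b :: A)) (hc₃ : List.IsChain (· ≠ ·) (D ++ a :: c :: C))
    (hc₂ : List.IsChain (· ≠ ·) N)
    (hS₁ : ∀ x ∈ D ++ a :: b :: A, x ∈ S) (hS₃ : ∀ x ∈ D ++ a :: c :: C, x ∈ S)
    (hS₂ : ∀ x ∈ N, x ∈ S) (hdet : 0 < det2 (b - a) (c - a)) :
    (∀ y, y ∉ polylineSet (D ++ a :: b :: A) → y ∉ polylineSet N →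
      y ∉ polylineSet (D ++ a :: c :: C) →
      0 ≤ polylineAngle (D ++ a :: b :: A) y + polylineAngle N y -
        polylineAngle (D ++ a :: c :: C) y) ∧
    ∃ U : Set Pt, IsOpen U ∧ U.Nonempty ∧ ∀ y ∈ U,
      0 < polylineAngle (D ++ a :: b :: A) y + polylineAngle N y -
        polylineAngle (D ++ a :: c :: C) y := by
  have key : ∀ y, polylineAngle (D ++ a :: b :: A) y + polylineAngle N y -
      polylineAngle (D ++ a :: c :: C) y =
      polylineAngle (a :: b :: A) y + polylineAngle N y - polylineAngle (a :: c :: C) y := by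
    intro y
    rw [polylineAngle_append D a (b :: A), polylineAngle_append D a (c :: C)]
    ring
  simp only [key]
  have ha := branch_notMem hS hp h₁ h₃ h₂ hc₁ hc₃ hc₂ hS₁ hS₃ hdet.ne'
  have hcr₁ := (List.isChain_append.1 hc₁).2.1
  have hcr₃ := (List.isChain_append.1 hc₃).2.1
  obtain ⟨hnn, hpos⟩ := triangle_of_apex P.fullSet_region hS h₁.right h₃.right h₂ hcr₁ hcr₃ hc₂
    (fun x hx => hS₁ x (List.mem_append_right _ hx))
    (fun x hx => hS₃ x (List.mem_append_right _ hx)) hS₂ hdet ha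
  refine ⟨fun y y1 y2 y3 => hnn y ?_, _, (isLoop_triangle h₁.right h₃.right h₂).isOpen_pos, hpos,
    fun y hy => hy.2⟩
  rintro ((h | h) | h)
  · exact y1 (by rw [polylineSet_append]; exact Or.inr h)
  · exact y2 h
  · exact y3 (by rw [polylineSet_append]; exact Or.inr h)

end IsShortest

/-! ### Thin triangles -/

namespace SimplePolygon

variable {P : SimplePolygon} {z c w : Pt}

/-- Near a boundary point which is not a vertex, the boundary is a line. -/
theorem boundary_near_of_notMem (hz : z ∈ P.boundary) (hv : z ∉ P.vertexSet) :
    ∃ d : Pt, d ≠ 0 ∧ ∃ r > 0, ∀ y, dist y z < r → (y ∈ P.boundary ↔ det2 d (y - z) = 0) := by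
  obtain ⟨p, q, hp, hq, ⟨r, hr, hpq⟩, -, hd⟩ := P.boundary_near hz
  obtain ⟨t, ht, hqp⟩ := hd hv
  refine ⟨p - z, sub_ne_zero.2 hp, min r (min (dist z p) (dist z q)),
    lt_min hr (lt_min (dist_pos.2 hp.symm) (dist_pos.2 hq.symm)), fun y hy => ?_⟩
  rw [lt_min_iff, lt_min_iff] at hy
  rw [hpq y hy.1, Set.mem_union, mem_segment_iff_of_dist_lt hp.symm hy.2.1,
    mem_segment_iff_of_dist_lt hq.symm hy.2.2]
  simp only [← sub_eq_iff_eq_add']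
  constructor
  · rintro (⟨u, -, h⟩ | ⟨u, -, h⟩)
    · rw [h, det2_smul_right, det2_self, mul_zero]
    · rw [h, hqp, det2_smul_right, det2_smul_right, det2_self, mul_zero, mul_zero]
  · intro h
    obtain ⟨u, hu⟩ := eq_smul_of_det2_eq_zero (sub_ne_zero.2 hp) h
    rcases le_total 0 u with h0 | h0
    · exact Or.inl ⟨u, h0, hu⟩
    · refine Or.inr ⟨u / t, div_nonneg_of_nonpos h0 ht.le, ?_⟩
      rw [hqp, smul_smul, div_mul_cancel₀ _ ht.ne, hu]

/-- Near a boundary point which is not a vertex, the complement contains a half disc. -/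
theorem exists_half_disc {D : Set Pt} (hD : ∀ y ∈ D, y ∉ P.region) (hz : z ∈ P.region)
    (hzD : z ∈ closure D) (hv : z ∉ P.vertexSet) :
    ∃ d : Pt, d ≠ 0 ∧ ∃ r > 0, (∀ y, dist y z < r → 0 < det2 d (y - z) → y ∉ P.region) ∧
      ∃ y ∈ D, 0 < det2 d (y - z) := by
  have hzb : z ∈ P.boundary := by
    refine hz.resolve_right fun h => ?_
    obtain ⟨y, hy, hyD⟩ := mem_closure_iff.1 hzD _ P.isOpen_interior h
    exact hD y hyD (P.interior_subset_region hy)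
  obtain ⟨d, hd, r, hr, hb⟩ := boundary_near_of_notMem hzb hv
  obtain ⟨y, hyD, hyr⟩ := Metric.mem_closure_iff.1 hzD r hr
  rw [dist_comm] at hyr
  have key : ∀ d' : Pt, (∀ y, det2 d (y - z) = 0 → det2 d' (y - z) = 0) →
      0 < det2 d' (y - z) → ∀ y, dist y z < r → 0 < det2 d' (y - z) → y ∉ P.region := by
    intro d' hd' hy x hx hx'
    rcases P.forall_mem_or_forall_notMem ((convex_ball z r).inter (convex_det2_pos d' z))
      (fun y hy h => hy.2.ne' (hd' y ((hb y hy.1).1 h))) with h' | h'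
    · exact absurd (h' y ⟨hyr, hy⟩) (hD y hyD)
    · exact h' x ⟨hx, hx'⟩
  have h0 : det2 d (y - z) ≠ 0 := fun h =>
    hD y hyD (P.boundary_subset_region ((hb y hyr).2 h))
  rcases h0.lt_or_gt with h0 | h0
  · rw [← neg_pos, ← det2_neg_left] at h0
    exact ⟨-d, neg_ne_zero.2 hd, r, hr,
      key _ (fun y hy => by rw [det2_neg_left, hy, neg_zero]) h0, y, hyD, h0⟩
  · exact ⟨d, hd, r, hr, key _ (fun y hy => hy) h0, y, hyD, h0⟩

/-- If `z` is a point of a triangle where `D` contains a half disc cut by the triangle, then the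
points on the line bounding the half disc are limits of points of `D`. -/
theorem mem_closure_of_half_disc {D T : Set Pt} {e d y h : Pt} {r : ℝ} (hT : Convex ℝ T)
    (hD : ∀ y ∈ T, dist y e < r → 0 < det2 d (y - e) → y ∈ D) (hy : y ∈ T)
    (hyd : 0 < det2 d (y - e)) (hh : e + h ∈ T) (hhr : dist (e + h) e < r)
    (hdh : det2 d h = 0) : e + h ∈ closure D := by
  have hlim : Filter.Tendsto (fun t : ℝ => AffineMap.lineMap (e + h) y t)
      (nhdsWithin 0 (Set.Ioi 0)) (nhds (e + h)) := by
    have : Continuous fun t : ℝ => AffineMap.lineMap (e + h) y t := AffineMap.lineMap_continuous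
    simpa using (this.tendsto 0).mono_left nhdsWithin_le_nhds
  refine mem_closure_of_tendsto hlim ?_
  have n1 : ∀ᶠ t : ℝ in nhdsWithin 0 (Set.Ioi 0), dist (AffineMap.lineMap (e + h) y t) e < r :=
    hlim.eventually (Metric.isOpen_ball.mem_nhds hhr)
  have n2 : ∀ᶠ t : ℝ in nhdsWithin 0 (Set.Ioi 0), t ∈ Set.Ioo (0 : ℝ) 1 :=
    Ioo_mem_nhdsGT one_pos
  filter_upwards [n1, n2] with t h1 h2
  refine hD _ (hT.lineMap_mem hh hy ⟨h2.1.le, h2.2.le⟩) h1 ?_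
  have e1 : AffineMap.lineMap (e + h) y t - e = (1 - t) • h + t • (y - e) := by
    rw [AffineMap.lineMap_apply_module']; module
  rw [e1, det2_add_right, det2_smul_right, det2_smul_right, hdh]
  simpa using mul_pos h2.1 hyd

theorem convex_triangle (z a b : Pt) : Convex ℝ
    {y : Pt | ∃ p q : ℝ, 0 ≤ p ∧ 0 ≤ q ∧ p + q ≤ 1 ∧ y = z + p • a + q • b} := by
  rintro _ ⟨p, q, hp, hq, hpq, rfl⟩ _ ⟨p', q', hp', hq', hpq', rfl⟩ s t hs ht hst
  refine ⟨s * p + t * p', s * q + t * q', by positivity, by positivity, ?_, ?_⟩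
  · nlinarith
  · obtain rfl : s = 1 - t := by linarith
    module

theorem isCompact_triangle (z a b : Pt) : IsCompact
    {y : Pt | ∃ p q : ℝ, 0 ≤ p ∧ 0 ≤ q ∧ p + q ≤ 1 ∧ y = z + p • a + q • b} := by
  have h : IsCompact {x : ℝ × ℝ | 0 ≤ x.1 ∧ 0 ≤ x.2 ∧ x.1 + x.2 ≤ 1} := by
    refine ((isCompact_Icc (a := (0 : ℝ)) (b := 1)).prod
      (isCompact_Icc (a := (0 : ℝ)) (b := 1))).of_isClosed_subset ?_ ?_
    · exact (isClosed_le continuous_const continuous_fst).inter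
        ((isClosed_le continuous_const continuous_snd).inter
        (isClosed_le (continuous_fst.add continuous_snd) continuous_const))
    · rintro ⟨p, q⟩ ⟨hp, hq, hpq⟩
      simp only at hp hq hpq
      exact ⟨⟨hp, by dsimp; linarith⟩, ⟨hq, by dsimp; linarith⟩⟩
  convert h.image (f := fun x : ℝ × ℝ => z + x.1 • a + x.2 • b) (by fun_prop) using 1
  ext y
  constructor
  · rintro ⟨p, q, hp, hq, hpq, rfl⟩
    exact ⟨(p, q), ⟨hp, hq, hpq⟩, rfl⟩
  · rintro ⟨⟨p, q⟩, ⟨hp, hq, hpq⟩, rfl⟩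
    exact ⟨p, q, hp, hq, hpq, rfl⟩

end SimplePolygon

namespace SimplePolygon

variable {P : SimplePolygon} {z c w : Pt}

theorem eventually_nonneg_add {p d : ℝ} (hp : 0 ≤ p) (h : p = 0 → 0 ≤ d) :
    ∀ᶠ ε : ℝ in nhdsWithin 0 (Set.Ioi 0), 0 ≤ p + ε * d := by
  rcases hp.eq_or_lt with rfl | hp
  · filter_upwards [self_mem_nhdsWithin] with ε hε
    rw [zero_add]
    exact mul_nonneg (le_of_lt hε) (h rfl)
  · have hc : Continuous fun ε : ℝ => p + ε * d := by fun_prop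
    have h0 := hc.tendsto 0
    rw [zero_mul, add_zero] at h0
    exact (h0.mono_left nhdsWithin_le_nhds).eventually (Ici_mem_nhds hp)

/-- A strictly convex function has no maximum in the middle of a segment. -/
theorem not_isMaxOn_of_add_smul {D : Set Pt} {φ : Pt → ℝ} {η : ℝ} (hη : 0 < η)
    (hφ : ∀ e h, φ (e + h) + φ (e - h) = 2 * φ e + 2 * η * (h 0 ^ 2 + h 1 ^ 2)) {e d : Pt}
    (hd : d ≠ 0) (hmax : IsMaxOn φ D e)
    (h : ∀ᶠ ε : ℝ in nhdsWithin 0 (Set.Ioi 0), e + ε • d ∈ D ∧ e - ε • d ∈ D) : False := by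
  obtain ⟨ε, ⟨h1, h2⟩, hε⟩ := (h.and self_mem_nhdsWithin).exists
  have h3 := hmax h1
  have h4 := hmax h2
  have h5 := hφ e (ε • d)
  rw [Set.mem_ofPred_eq] at h3 h4
  have h6 : (ε • d) 0 ^ 2 + (ε • d) 1 ^ 2 ≤ 0 := by nlinarith
  have hε' : ε ≠ 0 := ne_of_gt hε
  apply hd
  refine Pt.ext' ?_ ?_
  · have : (ε • d) 0 ^ 2 = 0 := by nlinarith [sq_nonneg ((ε • d) 0), sq_nonneg ((ε • d) 1)]
    simpa [hε'] using this
  · have : (ε • d) 1 ^ 2 = 0 := by nlinarith [sq_nonneg ((ε • d) 0), sq_nonneg ((ε • d) 1)]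
    simpa [hε'] using this

/-- If two sides of a triangle are contained in the polygon and the triangle contains no vertices
off the third side, then the third side is contained in the polygon. -/
theorem segment_subset_of_triangle (hcz : segment ℝ z c ⊆ P.region)
    (hzw : segment ℝ z w ⊆ P.region) (hdet : det2 (c - z) (w - z) ≠ 0)
    (hV : ∀ p q : ℝ, 0 ≤ p → 0 ≤ q → p + q < 1 →
      z + p • (c - z) + q • (w - z) ∉ P.vertexSet) : segment ℝ c w ⊆ P.region := by
  by_contra hcw
  obtain ⟨y₀, hy₀, hy₀R⟩ := Set.not_subset.1 hcw
  rw [segment_eq_image'] at hcz hzw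
  have hcz' : ∀ p : ℝ, 0 ≤ p → p ≤ 1 → z + p • (c - z) ∈ P.region := fun p h0 h1 =>
    hcz ⟨p, ⟨h0, h1⟩, rfl⟩
  have hzw' : ∀ p : ℝ, 0 ≤ p → p ≤ 1 → z + p • (w - z) ∈ P.region := fun p h0 h1 =>
    hzw ⟨p, ⟨h0, h1⟩, rfl⟩
  obtain ⟨a, rfl⟩ : ∃ a, c = z + a := ⟨c - z, by abel⟩
  obtain ⟨b, rfl⟩ : ∃ b, w = z + b := ⟨w - z, by abel⟩
  simp only [add_sub_cancel_left] at *
  set T : Set Pt := {y : Pt | ∃ p q : ℝ, 0 ≤ p ∧ 0 ≤ q ∧ p + q ≤ 1 ∧ y = z + p • a + q • b} with hT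
  have hTcomp : IsCompact T := isCompact_triangle z a b
  have hTconv : Convex ℝ T := convex_triangle z a b
  set D := T \ P.region with hD
  set f : Pt → ℝ := fun y => det2 (b - a) (y - (z + a)) / det2 a b with hf
  set Q : Pt → ℝ := fun y => (y 0 - (z + a) 0) * (y 0 - (z + b) 0) +
    (y 1 - (z + a) 1) * (y 1 - (z + b) 1) with hQ
  have hfv : ∀ p q : ℝ, f (z + p • a + q • b) = 1 - p - q := by
    intro p q
    rw [hf, div_eq_iff hdet]
    simp [det2]; ring
  obtain ⟨y₁, hy₁, hy₁'⟩ : ∃ y ∈ D, 0 < f y := by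
    obtain ⟨s, t, hs, ht, hst, rfl⟩ := hy₀
    obtain ⟨r, hr, hb⟩ := Metric.isOpen_iff.1 P.isOpen_compl_region _ hy₀R
    obtain ⟨ε, h0, h1, hε⟩ := dist_add_smul_lt (a := s • (z + a) + t • (z + b))
      (d := z - (s • (z + a) + t • (z + b))) hr
    have e1 : s • (z + a) + t • (z + b) + ε • (z - (s • (z + a) + t • (z + b))) =
        z + ((1 - ε) * s) • a + ((1 - ε) * t) • b := by
      obtain rfl : s = 1 - t := by linarith
      module
    have h2 := hb hε
    rw [e1] at h2
    refine ⟨_, ⟨⟨(1 - ε) * s, (1 - ε) * t, mul_nonneg (by linarith) hs,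
      mul_nonneg (by linarith) ht, ?_, rfl⟩, h2⟩, ?_⟩
    · rw [← mul_add, hst]; linarith
    · rw [hfv, sub_sub, ← mul_add, hst]; linarith
  obtain ⟨η, hη, hη'⟩ : ∃ η > 0, 0 < f y₁ + η * Q y₁ := by
    refine ⟨f y₁ / (2 * (1 + |Q y₁|)), by positivity, ?_⟩
    have h1 : f y₁ / (2 * (1 + |Q y₁|)) * (2 * (1 + |Q y₁|)) = f y₁ :=
      div_mul_cancel₀ _ (by positivity)
    have h2 : 0 < f y₁ / (2 * (1 + |Q y₁|)) := by positivity
    nlinarith [neg_abs_le (Q y₁)]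
  set φ : Pt → ℝ := fun y => f y + η * Q y with hφ
  have hφc : Continuous φ := by
    simp only [hφ, hf, hQ, det2]
    fun_prop
  have hφ2 : ∀ e h, φ (e + h) + φ (e - h) = 2 * φ e + 2 * η * (h 0 ^ 2 + h 1 ^ 2) := by
    intro e h
    simp only [hφ, hf, hQ, det2, PiLp.add_apply, PiLp.sub_apply]
    ring
  have hDT : closure D ⊆ T := closure_minimal Set.sdiff_subset hTcomp.isClosed
  obtain ⟨e, heD, hmax⟩ := (hTcomp.of_isClosed_subset isClosed_closure hDT).exists_isMaxOn
    ⟨y₁, subset_closure hy₁⟩ hφc.continuousOn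
  have hφe : 0 < φ e := hη'.trans_le (hmax (subset_closure hy₁))
  obtain ⟨p, q, hp, hq, hpq, rfl⟩ := hDT heD
  have hpq' : p + q < 1 := by
    refine lt_of_le_of_ne hpq fun h => ?_
    obtain rfl : p = 1 - q := by linarith
    simp only [hφ, hfv, hQ, PiLp.add_apply, PiLp.smul_apply, smul_eq_mul] at hφe
    have h1 : 0 ≤ q * (1 - q) * ((a 0 - b 0) ^ 2 + (a 1 - b 1) ^ 2) := by positivity
    have h2 := mul_nonneg hη.le h1
    nlinarith
  have hstay : ∀ d₁ d₂ : ℝ, (p = 0 → 0 ≤ d₁) → (q = 0 → 0 ≤ d₂) →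
      ∀ᶠ ε : ℝ in nhdsWithin 0 (Set.Ioi 0), z + p • a + q • b + ε • (d₁ • a + d₂ • b) ∈ T := by
    intro d₁ d₂ h1 h2
    filter_upwards [eventually_nonneg_add hp h1, eventually_nonneg_add hq h2,
      eventually_nonneg_add (p := 1 - p - q) (d := -(d₁ + d₂)) (by linarith)
        (fun h => by linarith)] with ε g1 g2 g3
    exact ⟨_, _, g1, g2, by linarith, by module⟩
  by_cases heR : z + p • a + q • b ∈ P.region
  · obtain ⟨d, hd, r, hr, hhalf, y, hyD, hyd⟩ := exists_half_disc (fun y hy => hy.2) heR heD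
      (hV p q hp hq hpq')
    obtain ⟨d₁, d₂, rfl⟩ : ∃ d₁ d₂ : ℝ, d = d₁ • a + d₂ • b :=
      ⟨_, _, eq_comb_of_det2_ne_zero hdet d⟩
    have hball : ∀ h : Pt, ∀ᶠ ε : ℝ in nhdsWithin 0 (Set.Ioi 0),
        dist (z + p • a + q • b + ε • h) (z + p • a + q • b) < r := by
      intro h
      have hc : Continuous fun ε : ℝ => dist (z + p • a + q • b + ε • h) (z + p • a + q • b) := by
        fun_prop
      have h0 := hc.tendsto 0
      rw [zero_smul, add_zero, dist_self] at h0
      exact (h0.mono_left nhdsWithin_le_nhds).eventually (gt_mem_nhds hr)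
    have hsign : ∀ h : Pt, (∀ᶠ ε : ℝ in nhdsWithin 0 (Set.Ioi 0),
        z + p • a + q • b + ε • h ∈ P.region) → det2 (d₁ • a + d₂ • b) h ≤ 0 := by
      intro h hh
      by_contra! hpos
      obtain ⟨ε, ⟨g1, g2⟩, hε⟩ := ((hh.and (hball h)).and self_mem_nhdsWithin).exists
      refine hhalf _ g2 ?_ g1
      rw [add_sub_cancel_left, det2_smul_right]
      exact mul_pos hε hpos
    have hpb : p = 0 → det2 (d₁ • a + d₂ • b) b ≤ 0 := by
      rintro rfl
      refine hsign b ?_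
      filter_upwards [eventually_nonneg_add hq (d := 1) (fun _ => zero_le_one),
        eventually_nonneg_add (p := 1 - q) (d := -1) (by linarith) (fun h => by linarith)]
        with ε g1 g2
      convert hzw' (q + ε * 1) g1 (by linarith) using 1
      module
    have hqa : q = 0 → det2 (d₁ • a + d₂ • b) a ≤ 0 := by
      rintro rfl
      refine hsign a ?_
      filter_upwards [eventually_nonneg_add hp (d := 1) (fun _ => zero_le_one),
        eventually_nonneg_add (p := 1 - p) (d := -1) (by linarith) (fun h => by linarith)]
        with ε g1 g2
      convert hcz' (p + ε * 1) g1 (by linarith) using 1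
      module
    have hpqb : p = 0 → 0 < q → 0 ≤ det2 (d₁ • a + d₂ • b) b := by
      rintro rfl hq0
      rw [← neg_nonpos, ← det2_neg_right]
      refine hsign (-b) ?_
      filter_upwards [eventually_nonneg_add hq (d := -1) (fun h => absurd h hq0.ne'),
        self_mem_nhdsWithin] with ε g1 (g2 : 0 < ε)
      convert hzw' (q + ε * -1) g1 (by linarith) using 1
      module
    have hqpa : q = 0 → 0 < p → 0 ≤ det2 (d₁ • a + d₂ • b) a := by
      rintro rfl hq0
      rw [← neg_nonpos, ← det2_neg_right]
      refine hsign (-a) ?_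
      filter_upwards [eventually_nonneg_add hp (d := -1) (fun h => absurd h hq0.ne'),
        self_mem_nhdsWithin] with ε g1 (g2 : 0 < ε)
      convert hcz' (p + ε * -1) g1 (by linarith) using 1
      module
    have hnot : ¬ (p = 0 ∧ q = 0) := by
      rintro ⟨rfl, rfl⟩
      obtain ⟨⟨p', q', hp', hq', -, rfl⟩, -⟩ := hyD
      rw [show z + p' • a + q' • b - (z + (0 : ℝ) • a + (0 : ℝ) • b) = p' • a + q' • b by module,
        det2_add_right, det2_smul_right, det2_smul_right] at hyd
      nlinarith [mul_nonneg hp' (neg_nonneg.2 (hqa rfl)), mul_nonneg hq' (neg_nonneg.2 (hpb rfl))]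
    have hd1 : p = 0 → d₁ = 0 := by
      intro h
      have h1 : det2 (d₁ • a + d₂ • b) b = d₁ * det2 a b := by
        rw [det2_add_left, det2_smul_left, det2_smul_left, det2_self]; ring
      have h2 := le_antisymm (hpb h) (hpqb h (lt_of_le_of_ne hq fun h' => hnot ⟨h, h'.symm⟩))
      rw [h1] at h2
      exact (mul_eq_zero.1 h2).resolve_right hdet
    have hd2 : q = 0 → d₂ = 0 := by
      intro h
      have h1 : det2 (d₁ • a + d₂ • b) a = -(d₂ * det2 a b) := by
        rw [det2_add_left, det2_smul_left, det2_smul_left, det2_self, det2_swap]; ring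
      have h2 := le_antisymm (hqa h) (hqpa h (lt_of_le_of_ne hp fun h' => hnot ⟨h'.symm, h⟩))
      rw [h1, neg_eq_zero] at h2
      exact (mul_eq_zero.1 h2).resolve_right hdet
    refine not_isMaxOn_of_add_smul hη hφ2 hd hmax ?_
    have hDhalf : ∀ y ∈ T, dist y (z + p • a + q • b) < r →
        0 < det2 (d₁ • a + d₂ • b) (y - (z + p • a + q • b)) → y ∈ D :=
      fun y h1 h2 h3 => ⟨h1, hhalf y h2 h3⟩
    filter_upwards [hstay d₁ d₂ (fun h => (hd1 h).ge) (fun h => (hd2 h).ge),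
      hstay (-d₁) (-d₂) (fun h => by rw [hd1 h, neg_zero]) (fun h => by rw [hd2 h, neg_zero]),
      hball (d₁ • a + d₂ • b), hball (-d₁ • a + -d₂ • b)] with ε g1 g2 g3 g4
    constructor
    · exact mem_closure_of_half_disc hTconv hDhalf hyD.1 hyd g1 g3
        (by rw [det2_smul_right, det2_self, mul_zero])
    · rw [show z + p • a + q • b - ε • (d₁ • a + d₂ • b) =
        z + p • a + q • b + ε • (-d₁ • a + -d₂ • b) by module]
      refine mem_closure_of_half_disc hTconv hDhalf hyD.1 hyd g2 g4 ?_
      rw [show -d₁ • a + -d₂ • b = -(d₁ • a + d₂ • b) by module, det2_smul_right, det2_neg_right,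
        det2_self, neg_zero, mul_zero]
  · have hp0 : p ≠ 0 := by
      rintro rfl
      exact heR (by simpa using hzw' q hq (by linarith))
    have hq0 : q ≠ 0 := by
      rintro rfl
      exact heR (by simpa using hcz' p hp (by linarith))
    have ha : a ≠ 0 := by
      rintro rfl
      simp [det2] at hdet
    refine not_isMaxOn_of_add_smul hη hφ2 ha hmax ?_
    have hR : ∀ h : Pt, ∀ᶠ ε : ℝ in nhdsWithin 0 (Set.Ioi 0),
        z + p • a + q • b + ε • h ∈ P.regionᶜ := by
      intro h
      have hc : Continuous fun ε : ℝ => z + p • a + q • b + ε • h := by fun_prop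
      have h0 := hc.tendsto 0
      rw [zero_smul, add_zero] at h0
      exact (h0.mono_left nhdsWithin_le_nhds).eventually (P.isOpen_compl_region.mem_nhds heR)
    filter_upwards [hstay 1 0 (fun h => absurd h hp0) (fun h => absurd h hq0),
      hstay (-1) 0 (fun h => absurd h hp0) (fun h => absurd h hq0), hR a, hR (-a)]
      with ε g1 g2 g3 g4
    constructor
    · refine subset_closure ⟨?_, g3⟩
      convert g1 using 1
      module
    · refine subset_closure ⟨?_, ?_⟩
      · convert g2 using 1
        module
      · rwa [show z + p • a + q • b - ε • a = z + p • a + q • b + ε • -a by module]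

end SimplePolygon

/-! ### Shortening paths to polylines through vertices -/

namespace SimplePolygon

variable {P : SimplePolygon} {W : Set Pt} {s z c w : Pt} {K : ℝ}

theorem finite_vertexSet (P : SimplePolygon) : P.vertexSet.Finite := by
  refine ((Set.finite_lt_nat P.n).image P.vtx).subset ?_
  rintro _ ⟨i, hi, rfl⟩
  exact ⟨i, hi, rfl⟩

theorem exists_segment_subset_of_dist_lt (hz : z ∈ P.region)
    (hcz : segment ℝ c z ⊆ P.region) (hV : ∀ v ∈ P.vertexSet, v ∈ segment ℝ c z → v = c) :
    ∃ r > 0, ∀ w ∈ P.region, dist w z < r → segment ℝ c w ⊆ P.region := by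
  obtain ⟨r, hr, hstar⟩ := P.exists_star hz
  obtain ⟨δ, hδ, hdist⟩ : ∃ δ > 0, ∀ v ∈ P.vertexSet, v ≠ c → ∀ y ∈ segment ℝ c z,
      ¬ dist y v < δ := by
    have h : ∀ᶠ δ : ℝ in nhdsWithin 0 (Set.Ioi 0), ∀ v ∈ P.vertexSet, v ≠ c →
        ∀ y ∈ segment ℝ c z, ¬ dist y v < δ := by
      refine (Filter.eventually_all_finite P.finite_vertexSet).2 fun v hv => ?_
      by_cases hvc : v = c
      · exact Filter.Eventually.of_forall fun _ h => absurd hvc h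
      obtain ⟨δ, hδ, h⟩ := exists_ball_disjoint (isCompact_segment c z).isClosed
        fun h => hvc (hV v hv h)
      filter_upwards [Ioo_mem_nhdsGT hδ] with ε hε _ y hy hyv
      exact h y hy (hyv.trans hε.2)
    obtain ⟨δ, h1, h2⟩ := (h.and self_mem_nhdsWithin).exists
    exact ⟨δ, h2, h1⟩
  refine ⟨min r δ, lt_min hr hδ, fun w hw hwz => ?_⟩
  rw [lt_min_iff] at hwz
  have hzw := hstar w hw hwz.1
  by_cases hdet : det2 (c - z) (w - z) = 0
  · by_cases hcz' : c = z
    · exact hcz' ▸ hzw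
    obtain ⟨t, ht⟩ := eq_smul_of_det2_eq_zero (sub_ne_zero.2 hcz') hdet
    rw [sub_eq_iff_eq_add] at ht
    rcases le_total t 0 with h0 | h0
    · have hz' : z ∈ segment ℝ c w := by
        refine ⟨-t / (1 - t), 1 / (1 - t), div_nonneg (by linarith) (by linarith),
          div_nonneg (by linarith) (by linarith), ?_, ?_⟩
        · rw [← add_div, div_eq_one_iff_eq (by linarith)]; ring
        · have h1 : (1 - t) ≠ 0 := by linarith
          have e1 : (1 - t) * (-t / (1 - t)) = -t := by field_simp
          have e2 : (1 - t) * (1 / (1 - t)) = 1 := by field_simp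
          apply smul_right_injective _ h1
          simp only [smul_add, smul_smul, e1, e2]
          rw [ht]
          module
      exact (segment_subset_union_segment hz').trans (Set.union_subset hcz hzw)
    rcases le_total t 1 with h1 | h1
    · have hw' : w ∈ segment ℝ c z := ⟨t, 1 - t, h0, by linarith, by ring, by rw [ht]; module⟩
      exact ((convex_segment c z).segment_subset (left_mem_segment ℝ c z) hw').trans hcz
    · have hc' : c ∈ segment ℝ z w := by
        have ht0 : t ≠ 0 := by linarith
        refine ⟨1 - 1 / t, 1 / t, ?_, by positivity, by ring, ?_⟩
        · rw [sub_nonneg, div_le_one (by linarith)]; exact h1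
        · rw [ht, smul_add, smul_smul, one_div, inv_mul_cancel₀ ht0]; module
      exact ((convex_segment z w).segment_subset hc' (right_mem_segment ℝ z w)).trans hzw
  · refine segment_subset_of_triangle (segment_symm ℝ c z ▸ hcz) hzw hdet
      fun p q hp hq hpq hvV => ?_
    have hy : z + p • (c - z) ∈ segment ℝ c z :=
      ⟨p, 1 - p, hp, by linarith, by ring, by module⟩
    have hd : dist (z + p • (c - z)) (z + p • (c - z) + q • (w - z)) < δ := by
      rw [dist_self_add_right, norm_smul, Real.norm_of_nonneg hq, ← dist_eq_norm]
      exact (mul_le_of_le_one_left dist_nonneg (by linarith)).trans_lt hwz.2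
    have hvc : z + p • (c - z) + q • (w - z) = c := by
      by_contra hne
      exact hdist _ hvV hne _ hy hd
    have h1 : (1 - p) • (c - z) = q • (w - z) := by
      rw [← sub_eq_zero]
      have h2 : c - (z + p • (c - z) + q • (w - z)) = 0 := by rw [hvc, sub_self]
      rw [← h2]; module
    have h2 := congrArg (fun x => det2 x (w - z)) h1
    simp only [det2_smul_left, det2_self, mul_zero] at h2
    rcases mul_eq_zero.1 h2 with h3 | h3
    · linarith
    · exact hdet h3

/-- The point `y` can be reached from `s` by a polyline of length at most `K` through distinct
points of `W`. -/
def Access (P : SimplePolygon) (W : Set Pt) (s : Pt) (K : ℝ) (y : Pt) : Prop :=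
  ∃ (A : List Pt) (c : Pt), (A ++ [c]).Nodup ∧ (∀ x ∈ A ++ [c], x ∈ W) ∧
    (A ++ [c]).head? = some s ∧ polylineSet (A ++ [c]) ⊆ P.region ∧
    segment ℝ c y ⊆ P.region ∧ polylineLen (A ++ [c]) + dist c y ≤ K

theorem Access.mono {K' : ℝ} (h : P.Access W s K z) (hK : K ≤ K') : P.Access W s K' z := by
  obtain ⟨A, c, h1, h2, h3, h4, h5, h6⟩ := h
  exact ⟨A, c, h1, h2, h3, h4, h5, h6.trans hK⟩

theorem Access.exists_nodup (h : P.Access W s K z) (hz : z ∈ W) :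
    ∃ A : List Pt, (A ++ [z]).Nodup ∧ (∀ x ∈ A ++ [z], x ∈ W) ∧
      (A ++ [z]).head? = some s ∧ polylineSet (A ++ [z]) ⊆ P.region ∧
      polylineLen (A ++ [z]) ≤ K := by
  obtain ⟨A, c, h1, h2, h3, h4, h5, h6⟩ := h
  by_cases hzM : z ∈ A ++ [c]
  · obtain ⟨B, C, hBC⟩ := List.append_of_mem hzM
    rw [hBC] at h1 h2 h3 h4 h6
    refine ⟨B, ?_, fun x hx => h2 x ?_, ?_, ?_, ?_⟩
    · rw [List.append_cons] at h1
      exact h1.of_append_left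
    · rw [List.append_cons]; exact List.mem_append_left _ hx
    · rw [← h3]; exact head?_append_cons_eq
    · rw [polylineSet_append] at h4
      exact Set.subset_union_left.trans h4
    · rw [polylineLen_append] at h6
      have := polylineLen_nonneg (z :: C)
      have : 0 ≤ dist c z := dist_nonneg
      linarith
  · refine ⟨A ++ [c], ?_, ?_, ?_, ?_, ?_⟩
    · exact List.nodup_append_comm.1 (by simpa using ⟨by simpa using hzM, by simpa using h1⟩)
    · intro x hx
      rcases List.mem_append.1 hx with hx | hx
      · exact h2 x hx
      · rw [List.mem_singleton.1 hx]; exact hz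
    · rw [← h3, List.append_assoc]; exact head?_append_cons_eq
    · rw [List.append_assoc, List.singleton_append, polylineSet_append]
      refine Set.union_subset h4 (Set.union_subset h5 ?_)
      simpa [polylineSet] using h5 (right_mem_segment ℝ c z)
    · rw [List.append_assoc, List.singleton_append, polylineLen_append]
      simpa [polylineLen] using h6

theorem finite_nodup_lists (hW : W.Finite) : {M : List Pt | M.Nodup ∧ ∀ x ∈ M, x ∈ W}.Finite := by
  have := hW.fintype
  refine ((List.finite_length_le W (Fintype.card W)).image (List.map Subtype.val)).subset ?_
  rintro M ⟨h1, h2⟩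
  lift M to List W using h2
  exact ⟨M, (List.Nodup.of_map _ h1).length_le_card, rfl⟩

theorem isClosed_access (hW : W.Finite) : IsClosed {y | P.Access W s K y} := by
  have hfin : {x : List Pt × Pt | (x.1 ++ [x.2]).Nodup ∧ ∀ y ∈ x.1 ++ [x.2], y ∈ W}.Finite := by
    refine Set.Finite.of_finite_image ((finite_nodup_lists hW).subset ?_)
      (f := fun x : List Pt × Pt => x.1 ++ [x.2]) ?_
    · rintro _ ⟨x, hx, rfl⟩
      exact hx
    · rintro ⟨A, c⟩ - ⟨B, d⟩ - h
      simpa using h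
  convert hfin.isClosed_biUnion (f := fun x : List Pt × Pt =>
    {y : Pt | (x.1 ++ [x.2]).head? = some s ∧ polylineSet (x.1 ++ [x.2]) ⊆ P.region ∧
      segment ℝ x.2 y ⊆ P.region ∧ polylineLen (x.1 ++ [x.2]) + dist x.2 y ≤ K}) ?_ using 1
  · ext y
    simp only [Access, Set.mem_ofPred_eq, Set.mem_iUnion, Prod.exists, exists_prop, and_assoc]
  · rintro ⟨A, c⟩ -
    refine IsClosed.and isClosed_const (IsClosed.and isClosed_const (IsClosed.and ?_ ?_))
    · simp only [segment_eq_image', Set.image_subset_iff]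
      have : {y : Pt | Set.Icc (0 : ℝ) 1 ⊆ (fun t : ℝ => c + t • (y - c)) ⁻¹' P.region} =
          ⋂ t ∈ Set.Icc (0 : ℝ) 1, {y : Pt | c + t • (y - c) ∈ P.region} := by
        ext y
        simp [Set.subset_def]
      rw [this]
      exact isClosed_biInter fun t _ => P.isClosed_region.preimage (by fun_prop)
    · exact isClosed_le (by fun_prop) continuous_const

theorem Access.exists_nearest (h : P.Access W s K z) (hW : W.Finite) :
    ∃ (A : List Pt) (c : Pt), (A ++ [c]).Nodup ∧ (∀ x ∈ A ++ [c], x ∈ W) ∧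
      (A ++ [c]).head? = some s ∧ polylineSet (A ++ [c]) ⊆ P.region ∧
      segment ℝ c z ⊆ P.region ∧ polylineLen (A ++ [c]) + dist c z ≤ K ∧
      ∀ v ∈ W, v ∈ segment ℝ c z → v = c := by
  obtain ⟨A, c, h1, h2, h3, h4, h5, h6⟩ := h
  obtain ⟨c', ⟨hc'W, hc'⟩, hmin⟩ := Set.exists_min_image (W ∩ segment ℝ c z) (fun v => dist v z)
    (hW.inter_of_left _) ⟨c, h2 c (by simp), left_mem_segment ℝ c z⟩
  have hsub : segment ℝ c' z ⊆ segment ℝ c z :=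
    (convex_segment c z).segment_subset hc' (right_mem_segment ℝ c z)
  have hsub' : segment ℝ c c' ⊆ segment ℝ c z :=
    (convex_segment c z).segment_subset (left_mem_segment ℝ c z) hc'
  have hacc : P.Access W s (polylineLen (A ++ [c]) + dist c c') c' :=
    ⟨A, c, h1, h2, h3, h4, hsub'.trans h5, le_rfl⟩
  obtain ⟨B, g1, g2, g3, g4, g5⟩ := hacc.exists_nodup hc'W
  have hadd : dist c c' + dist c' z = dist c z := dist_add_dist_of_mem_segment hc'
  refine ⟨B, c', g1, g2, g3, g4, hsub.trans h5, by linarith, fun v hvW hv => ?_⟩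
  have h7 := hmin v ⟨hvW, hsub hv⟩
  have h8 := dist_add_dist_of_mem_segment hv
  have h9 : dist c' v ≤ 0 := by linarith
  exact (dist_le_zero.1 h9).symm

theorem Access.exists_step (h : P.Access W s K z) (hW : W.Finite) (hV : P.vertexSet ⊆ W) :
    ∃ r > 0, ∀ w ∈ P.region, dist w z < r → P.Access W s (K + dist z w) w := by
  obtain ⟨A, c, h1, h2, h3, h4, h5, h6, h7⟩ := h.exists_nearest hW
  have hz : z ∈ P.region := h5 (right_mem_segment ℝ c z)
  obtain ⟨r, hr, hw⟩ := exists_segment_subset_of_dist_lt hz h5 fun v hv => h7 v (hV hv)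
  refine ⟨r, hr, fun w hwR hwz => ⟨A, c, h1, h2, h3, h4, hw w hwR hwz, ?_⟩⟩
  linarith [dist_triangle c z w]

end SimplePolygon

/-! ### Geodesics and shortest polylines -/

namespace SimplePolygon

variable {P : SimplePolygon} {W S : Set Pt} {s t a b c : Pt} {K : ℝ} {L : List Pt}

theorem access_of_path {γ : ℝ → Pt} (hγ : γ ∈ P.pathsIn s t) (hW : W.Finite)
    (hV : P.vertexSet ⊆ W) (hs : s ∈ W) (hfin : eVariationOn γ (Set.Icc 0 1) ≠ ⊤) :
    P.Access W s (eVariationOn γ (Set.Icc 0 1)).toReal t := by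
  obtain ⟨hc, h0, h1, hR⟩ := hγ
  have hmem : ∀ τ ∈ Set.Icc (0 : ℝ) 1, γ τ ∈ P.region := fun τ hτ => hR ⟨τ, hτ, rfl⟩
  have hfin' : ∀ τ ≤ (1 : ℝ), eVariationOn γ (Set.Icc 0 τ) ≠ ⊤ := fun τ hτ =>
    ne_top_of_le_ne_top hfin (eVariationOn.mono γ (Set.Icc_subset_Icc_right hτ))
  set κ : ℝ → ℝ := fun τ => (eVariationOn γ (Set.Icc 0 τ)).toReal with hκ
  have hκmono : ∀ τ τ', τ ≤ τ' → τ' ≤ 1 → κ τ ≤ κ τ' := fun τ τ' h h' =>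
    ENNReal.toReal_mono (hfin' τ' h') (eVariationOn.mono γ (Set.Icc_subset_Icc_right h))
  have hκadd : ∀ τ τ', 0 ≤ τ → τ ≤ τ' → τ' ≤ 1 → κ τ + dist (γ τ) (γ τ') ≤ κ τ' := by
    intro τ τ' h0 h h'
    rw [hκ, dist_edist, ← ENNReal.toReal_add (hfin' τ (h.trans h')) (edist_ne_top _ _)]
    refine ENNReal.toReal_mono (hfin' τ' h') ?_
    have := eVariationOn.Icc_add_Icc γ (s := Set.univ) h0 h (Set.mem_univ _)
    simp only [Set.univ_inter] at this
    rw [← this]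
    gcongr
    exact eVariationOn.edist_le γ (Set.left_mem_Icc.2 h) (Set.right_mem_Icc.2 h)
  set A := {τ : ℝ | τ ∈ Set.Icc (0 : ℝ) 1 ∧ P.Access W s (κ τ) (γ τ)} with hA
  have h0A : (0 : ℝ) ∈ A := by
    have hsR : s ∈ P.region := h0 ▸ hmem 0 (by simp)
    refine ⟨by simp, [], s, by simp, by simpa using hs, rfl, ?_, ?_, ?_⟩
    · simpa [polylineSet] using hsR
    · rw [h0, segment_same]; simpa using hsR
    · rw [h0, dist_self]
      simp only [add_zero]
      exact ENNReal.toReal_nonneg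
  have hbdd : BddAbove A := ⟨1, fun τ hτ => hτ.1.2⟩
  have hTle : ∀ τ ∈ A, τ ≤ sSup A := fun τ hτ => le_csSup hbdd hτ
  have hTcl : sSup A ∈ closure A := csSup_mem_closure ⟨0, h0A⟩ hbdd
  have hT : sSup A ∈ Set.Icc (0 : ℝ) 1 := ⟨hTle 0 h0A, csSup_le ⟨0, h0A⟩ fun τ hτ => hτ.1.2⟩
  generalize sSup A = T at hTle hTcl hT
  have hTA : T ∈ A := by
    refine ⟨hT, ?_⟩
    have h2 := ((hc T hT).mono (fun τ hτ => hτ.1 : A ⊆ _)).mem_closure_image hTcl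
    refine closure_minimal ?_ (isClosed_access hW) h2
    rintro _ ⟨τ, hτ, rfl⟩
    exact hτ.2.mono (hκmono τ T (hTle τ hτ) hT.2)
  rcases hT.2.eq_or_lt with rfl | hT1
  · exact h1 ▸ hTA.2
  obtain ⟨r, hr, hstep⟩ := hTA.2.exists_step hW hV
  have hcT : Filter.Tendsto γ (nhdsWithin T (Set.Ioo T 1)) (nhds (γ T)) :=
    (hc T hT).mono fun τ hτ => ⟨hT.1.trans hτ.1.le, hτ.2.le⟩
  have : (nhdsWithin T (Set.Ioo T 1)).NeBot := left_nhdsWithin_Ioo_neBot hT1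
  obtain ⟨τ, hτr, hτ⟩ :=
    ((hcT.eventually (Metric.ball_mem_nhds _ hr)).and self_mem_nhdsWithin).exists
  have hτI : τ ∈ Set.Icc (0 : ℝ) 1 := ⟨hT.1.trans hτ.1.le, hτ.2.le⟩
  have hτA : τ ∈ A :=
    ⟨hτI, (hstep _ (hmem τ hτI) hτr).mono (hκadd T τ hT.1 hτ.1.le hτ.2.le)⟩
  exact absurd (hTle τ hτA) (not_le.2 hτ.1)

theorem exists_path_trans {γ₁ γ₂ : ℝ → Pt} (h₁ : γ₁ ∈ P.pathsIn a b) (h₂ : γ₂ ∈ P.pathsIn b c) :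
    ∃ γ ∈ P.pathsIn a c, eVariationOn γ (Set.Icc 0 1) ≤
      eVariationOn γ₁ (Set.Icc 0 1) + eVariationOn γ₂ (Set.Icc 0 1) := by
  obtain ⟨hc₁, h10, h11, hR₁⟩ := h₁
  obtain ⟨hc₂, h20, h21, hR₂⟩ := h₂
  set γ : ℝ → Pt := fun x => if x ≤ 1 / 2 then γ₁ (2 * x) else γ₂ (2 * x - 1) with hγ
  have e₁ : Set.EqOn γ (γ₁ ∘ fun x => 2 * x) (Set.Icc 0 (1 / 2)) := fun x hx => by
    simp only [hγ, if_pos hx.2, Function.comp]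
  have e₂ : Set.EqOn γ (γ₂ ∘ fun x => 2 * x - 1) (Set.Icc (1 / 2) 1) := fun x hx => by
    rcases hx.1.eq_or_lt with rfl | h
    · simp only [hγ, Function.comp, le_refl, if_true]
      norm_num [h11, h20]
    · simp only [hγ, if_neg (not_le.2 h), Function.comp]
  have m₁ : Set.MapsTo (fun x : ℝ => 2 * x) (Set.Icc 0 (1 / 2)) (Set.Icc 0 1) := fun x hx =>
    ⟨by linarith [hx.1], by linarith [hx.2]⟩
  have m₂ : Set.MapsTo (fun x : ℝ => 2 * x - 1) (Set.Icc (1 / 2) 1) (Set.Icc 0 1) := fun x hx =>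
    ⟨by linarith [hx.1], by linarith [hx.2]⟩
  have hU : Set.Icc (0 : ℝ) 1 = Set.Icc 0 (1 / 2) ∪ Set.Icc (1 / 2) 1 :=
    (Set.Icc_union_Icc_eq_Icc (by norm_num) (by norm_num)).symm
  refine ⟨γ, ⟨?_, ?_, ?_, ?_⟩, ?_⟩
  · rw [hU]
    refine ContinuousOn.union_of_isClosed ?_ ?_ isClosed_Icc isClosed_Icc
    · exact (hc₁.comp (by fun_prop) m₁).congr e₁
    · exact (hc₂.comp (by fun_prop) m₂).congr e₂
  · rw [e₁ (by norm_num)]; simpa using h10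
  · rw [e₂ (by norm_num)]; norm_num; exact h21
  · rintro _ ⟨x, hx, rfl⟩
    rw [hU] at hx
    rcases hx with hx | hx
    · rw [e₁ hx]; exact hR₁ ⟨_, m₁ hx, rfl⟩
    · rw [e₂ hx]; exact hR₂ ⟨_, m₂ hx, rfl⟩
  · have h := eVariationOn.Icc_add_Icc γ (s := Set.univ) (a := 0) (b := 1 / 2) (c := 1)
      (by norm_num) (by norm_num) (Set.mem_univ _)
    simp only [Set.univ_inter] at h
    rw [← h, eVariationOn.eq_of_eqOn e₁, eVariationOn.eq_of_eqOn e₂]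
    gcongr
    · exact eVariationOn.comp_le_of_monotoneOn _ _
        (fun x _ y _ h => by linarith) m₁
    · exact eVariationOn.comp_le_of_monotoneOn _ _
        (fun x _ y _ h => by linarith) m₂

theorem exists_path_segment (h : segment ℝ a b ⊆ P.region) :
    ∃ γ ∈ P.pathsIn a b, eVariationOn γ (Set.Icc 0 1) ≤ ENNReal.ofReal (dist a b) := by
  refine ⟨AffineMap.lineMap a b, ⟨AffineMap.lineMap_continuous.continuousOn, by simp, by simp,
    by rw [← segment_eq_image_lineMap]; exact h⟩, ?_⟩
  have h1 : LipschitzOnWith (nndist a b) (AffineMap.lineMap a b : ℝ → Pt) (Set.Icc 0 1) :=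
    (lipschitzWith_lineMap a b).lipschitzOnWith
  have h2 := h1.comp_eVariationOn_le (g := id) (s := Set.Icc (0 : ℝ) 1) fun x hx => hx
  have h3 := (monotoneOn_id (s := Set.Icc (0 : ℝ) 1)).eVariationOn_eq
    (Set.left_mem_Icc.2 zero_le_one) (Set.right_mem_Icc.2 zero_le_one)
  simp only [Set.inter_self, id, sub_zero, ENNReal.ofReal_one] at h3
  refine (h2.trans (mul_le_mul_right h3.le _)).trans ?_
  rw [mul_one, ← edist_nndist, edist_dist]

/-- Polylines are paths. -/
theorem exists_path_polyline : ∀ (L : List Pt) (s : Pt), L.head? = some s → L.getLast? = some t →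
    polylineSet L ⊆ P.region →
    ∃ γ ∈ P.pathsIn s t, eVariationOn γ (Set.Icc 0 1) ≤ ENNReal.ofReal (polylineLen L)
  | [], _, h, _, _ => by simp at h
  | [a], s, h, h', hR => by
    obtain rfl : a = s := by simpa using h
    obtain rfl : a = t := by simpa using h'
    simpa [polylineLen] using exists_path_segment (P := P) (a := a) (b := a)
      (by rw [segment_same]; exact hR)
  | a :: b :: l, s, h, h', hR => by
    obtain rfl : a = s := by simpa using h
    obtain ⟨γ₂, h₂, h₂'⟩ := exists_path_polyline (b :: l) b rfl (by simpa using h')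
      (Set.subset_union_right.trans hR)
    obtain ⟨γ₁, h₁, h₁'⟩ := exists_path_segment (Set.subset_union_left.trans hR)
    obtain ⟨γ, hγ, hγ'⟩ := exists_path_trans h₁ h₂
    refine ⟨γ, hγ, hγ'.trans ?_⟩
    rw [polylineLen, ENNReal.ofReal_add dist_nonneg (polylineLen_nonneg _)]
    exact add_le_add h₁' h₂'

theorem geodDist_le (h : L.head? = some s) (h' : L.getLast? = some t)
    (hR : polylineSet L ⊆ P.region) : P.geodDist s t ≤ ENNReal.ofReal (polylineLen L) := by
  obtain ⟨γ, hγ, hγ'⟩ := exists_path_polyline L s h h' hR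
  exact (iInf₂_le γ hγ).trans hγ'

theorem IsGeodesicChain.isShortest (h : P.IsGeodesicChain s t L) :
    IsShortest P.region s t L := by
  obtain ⟨h1, h2, -, -, h3, h4⟩ := h
  refine ⟨h1, h2, h3, fun M m1 m2 m3 => ?_⟩
  rw [← ENNReal.ofReal_le_ofReal_iff (polylineLen_nonneg M), h4]
  exact geodDist_le m1 m2 m3

theorem IsGeodesicChain.isChain (h : P.IsGeodesicChain s t L) : List.IsChain (· ≠ ·) L := h.2.2.1

/-- The inner vertices of a geodesic are vertices of the polygon. -/
theorem IsGeodesicChain.mem (h : P.IsGeodesicChain s t L) (hV : P.vertexSet ⊆ S) (hs : s ∈ S)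
    (ht : t ∈ S) : ∀ e ∈ L, e ∈ S := by
  intro e he
  obtain ⟨A, B, rfl⟩ := List.append_of_mem he
  have hsh := h.isShortest
  rcases B with _ | ⟨b, B⟩
  · have h2 := h.2.1
    rw [List.getLast?_append_cons] at h2
    obtain rfl : e = t := by simpa using h2
    exact ht
  rcases A.eq_nil_or_concat with rfl | ⟨A, z, rfl⟩
  · obtain rfl : e = s := by simpa using h.1
    exact hs
  · simp only [List.concat_eq_append, List.append_assoc, List.singleton_append] at h hsh
    refine hV (hsh.mem_vertexSet ?_)
    have h3 := h.2.2.2.1 A.length (by simp)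
    simp only [List.getD_eq_getElem?_getD, List.getElem?_append_right (Nat.le_add_right _ _),
      List.getElem?_append_right (le_refl _), Nat.sub_self, Nat.add_sub_cancel_left,
      List.getElem?_cons_zero, List.getElem?_cons_succ, Option.getD_some] at h3
    intro h4
    apply h3
    simp only [det2, PiLp.sub_apply] at h4 ⊢
    linarith

/-- Geodesics exist. -/
theorem exists_isGeodesicChain (hS : NoThreeCollinear S) (hV : P.vertexSet ⊆ S) (hs : s ∈ S)
    (ht : t ∈ S) {γ : ℝ → Pt} (hγ : γ ∈ P.pathsIn s t)
    (hfin : eVariationOn γ (Set.Icc 0 1) ≠ ⊤) : ∃ L, P.IsGeodesicChain s t L := by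
  have hW : (P.vertexSet ∪ {s, t}).Finite := P.finite_vertexSet.union (Set.toFinite _)
  have hWS : P.vertexSet ∪ {s, t} ⊆ S := by
    refine Set.union_subset hV ?_
    rintro x (rfl | rfl)
    exacts [hs, ht]
  set W := P.vertexSet ∪ {s, t} with hWdef
  set F := {M : List Pt | (M.Nodup ∧ ∀ x ∈ M, x ∈ W) ∧ M.head? = some s ∧ M.getLast? = some t ∧
    polylineSet M ⊆ P.region} with hF
  have hFfin : F.Finite := (finite_nodup_lists hW).subset fun M hM => hM.1
  have hex : ∀ γ ∈ P.pathsIn s t, eVariationOn γ (Set.Icc 0 1) ≠ ⊤ →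
      ∃ M ∈ F, polylineLen M ≤ (eVariationOn γ (Set.Icc 0 1)).toReal := by
    intro γ hγ hfin
    obtain ⟨A, h1, h2, h3, h4, h5⟩ := (access_of_path hγ hW Set.subset_union_left
      (by simp [hWdef]) hfin).exists_nodup (by simp [hWdef])
    exact ⟨A ++ [t], ⟨⟨h1, h2⟩, h3, by simp, h4⟩, h5⟩
  obtain ⟨M₀, hM₀, -⟩ := hex γ hγ hfin
  obtain ⟨L, hL, hmin⟩ := Set.exists_min_image F polylineLen hFfin ⟨M₀, hM₀⟩
  have hle : ∀ γ ∈ P.pathsIn s t, ENNReal.ofReal (polylineLen L) ≤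
      eVariationOn γ (Set.Icc 0 1) := by
    intro γ hγ
    by_cases hfin : eVariationOn γ (Set.Icc 0 1) = ⊤
    · rw [hfin]; exact le_top
    obtain ⟨M, hM, hM'⟩ := hex γ hγ hfin
    exact ENNReal.ofReal_le_of_le_toReal ((hmin M hM).trans hM')
  obtain ⟨⟨hL1, hL2⟩, hL3, hL4, hL5⟩ := hL
  have hsh : IsShortest P.region s t L := by
    refine ⟨hL3, hL4, hL5, fun M m1 m2 m3 => ?_⟩
    obtain ⟨γ', hγ', h⟩ := exists_path_polyline M s m1 m2 m3
    rw [← ENNReal.ofReal_le_ofReal_iff (polylineLen_nonneg M)]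
    exact (hle γ' hγ').trans h
  have hch : List.IsChain (· ≠ ·) L := hL1.isChain
  refine ⟨L, hL3, hL4, hch, fun i hi => ?_, hL5, le_antisymm (le_iInf₂ hle)
    (geodDist_le hL3 hL4 hL5)⟩
  have hsplit : L = L.take i ++ L[i] :: L[i + 1] :: L[i + 2] :: L.drop (i + 3) := by
    rw [List.getElem_cons_drop, List.getElem_cons_drop, List.getElem_cons_drop,
      List.take_append_drop]
  have h3 := IsShortest.det2_ne_zero hS (hsplit ▸ hsh) (hsplit ▸ hch)
    (fun x hx => hWS (hL2 x (hsplit ▸ hx)))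
  rw [List.getD_eq_getElem _ _ (by omega), List.getD_eq_getElem _ _ (by omega),
    List.getD_eq_getElem _ _ (by omega)]
  intro h4
  apply h3
  simp only [det2, PiLp.sub_apply] at h4 ⊢
  linarith

end SimplePolygon

/-! ### Interiority -/

open MeasureTheory in
theorem dense_compl_segment (a b : Pt) : Dense (segment ℝ a b)ᶜ := by
  have h : affineSpan ℝ {a, b} ≠ ⊤ := fun h => by
    have h1 := (collinear_pair ℝ a b).finrank_le_one
    rw [← direction_affineSpan, h, AffineSubspace.direction_top, finrank_top,
      finrank_euclideanSpace_fin] at h1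
    omega
  have h1 : (volume : Measure Pt) (segment ℝ a b) = 0 :=
    measure_mono_null (convexHull_pair (𝕜 := ℝ) a b ▸ convexHull_subset_affineSpan _)
      (Measure.addHaar_affineSubspace _ _ h)
  exact Measure.dense_of_ae (compl_mem_ae_iff.2 h1)

theorem dense_compl_polylineSet : ∀ L : List Pt, Dense (polylineSet L)ᶜ
  | [] => by simp [polylineSet]
  | [a] => by simpa [polylineSet, segment_same] using dense_compl_segment a a
  | a :: b :: l => by
    rw [polylineSet, Set.compl_union]
    exact (dense_compl_segment a b).inter_of_isOpen_left (dense_compl_polylineSet (b :: l))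
      (isCompact_segment a b).isClosed.isOpen_compl

theorem exists_mem_notMem_polylineSet {U : Set Pt} (hU : IsOpen U) :
    ∀ Ls : List (List Pt), U.Nonempty → ∃ y ∈ U, ∀ L ∈ Ls, y ∉ polylineSet L := by
  intro Ls
  induction Ls generalizing U with
  | nil => rintro ⟨y, hy⟩; exact ⟨y, hy, by simp⟩
  | cons L Ls ih =>
    intro hne
    obtain ⟨y, hy, h⟩ := ih (hU.inter (isCompact_polylineSet L).isClosed.isOpen_compl)
      ((dense_compl_polylineSet L).inter_open_nonempty U hU hne)
    exact ⟨y, hy.1, List.forall_mem_cons.2 ⟨hy.2, h⟩⟩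

theorem exists_eq_append_of_branch {L M : List Pt} {i : ℕ} {a b c : Pt} (hi : 0 < i)
    (h : ∀ j < i, L[j]? = M[j]?) (ha : L[i - 1]? = some a) (hb : L[i]? = some b)
    (hc : M[i]? = some c) : ∃ D A C, L = D ++ a :: b :: A ∧ M = D ++ a :: c :: C := by
  obtain ⟨k, rfl⟩ : ∃ k, i = k + 1 := ⟨i - 1, by omega⟩
  induction k generalizing L M with
  | zero =>
    have h0 := h 0 (by simp)
    match L, M with
    | [], _ => simp at ha
    | [_], _ => simp at hb
    | _ :: _ :: A, [] => simp at hc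
    | _ :: _ :: A, [_] => simp at hc
    | p :: q :: A, p' :: q' :: C =>
      simp at h0 ha hb hc
      subst h0 ha hb hc
      exact ⟨[], A, C, rfl, rfl⟩
  | succ k ih =>
    match L, M with
    | [], _ => simp at ha
    | _ :: _, [] => simp at hc
    | p :: L, p' :: M =>
      have h0 : p = p' := by simpa using h 0 (by simp)
      obtain ⟨D, A, C, rfl, rfl⟩ := ih (L := L) (M := M) (by simp)
        (fun j hj => by simpa using h (j + 1) (by omega)) (by simpa using ha) (by simpa using hb)
        (by simpa using hc)
      exact ⟨p :: D, A, C, by simp, by simp [h0]⟩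

namespace SimplePolygon

variable {P : SimplePolygon} {S : Set Pt} {p q r : Pt}

theorem notMem_vertexSet (hp : p ∈ P.interior) : p ∉ P.vertexSet := by
  rintro ⟨i, hi, rfl⟩
  refine hp.1 ?_
  simp only [boundary, Set.mem_iUnion]
  exact ⟨i, Finset.mem_range.2 hi, left_mem_segment _ _ _⟩

theorem exists_chain_of_chains {L M : List Pt} (hS : NoThreeCollinear S) (hV : P.vertexSet ⊆ S)
    (hq : q ∈ S) (hr : r ∈ S) (hL : P.IsGeodesicChain p q L) (hM : P.IsGeodesicChain p r M) :
    ∃ N, P.IsGeodesicChain q r N := by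
  obtain ⟨γ₁, h₁, h₁'⟩ := exists_path_polyline (P := P) L.reverse q
    hL.isShortest.reverse.head hL.isShortest.reverse.last hL.isShortest.reverse.subset
  obtain ⟨γ₂, h₂, h₂'⟩ := exists_path_polyline (P := P) M p hM.1 hM.2.1 hM.isShortest.subset
  obtain ⟨γ, hγ, hγ'⟩ := exists_path_trans h₁ h₂
  refine exists_isGeodesicChain hS hV hq hr hγ
    (ne_top_of_le_ne_top ?_ (hγ'.trans (add_le_add h₁' h₂')))
  exact ENNReal.add_ne_top.2 ⟨ENNReal.ofReal_ne_top, ENNReal.ofReal_ne_top⟩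

theorem exists_branch_of_chains {L M : List Pt} (hq : q ∉ P.vertexSet) (hr : r ∉ P.vertexSet)
    (hpq : p ≠ q) (hpr : p ≠ r) (hqr : q ≠ r) (hL : P.IsGeodesicChain p q L)
    (hM : P.IsGeodesicChain p r M) : ∃ (D : List Pt) (a b c : Pt) (A C : List Pt),
      L = D ++ a :: b :: A ∧ M = D ++ a :: c :: C ∧ b ≠ c := by
  rcases _root_.exists_branch hL.isShortest hM.isShortest with ⟨X, rfl⟩ | ⟨X, rfl⟩ | h
  · have h := hM.mem (S := insert p (insert r P.vertexSet)) (fun z hz => by simp [hz]) (by simp)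
      (by simp) q (List.mem_append_left _ (List.mem_of_getLast? hL.2.1))
    rcases h with h | h | h
    exacts [absurd h.symm hpq, absurd h hqr, absurd h hq]
  · have h := hL.mem (S := insert p (insert q P.vertexSet)) (fun z hz => by simp [hz]) (by simp)
      (by simp) r (List.mem_append_left _ (List.mem_of_getLast? hM.2.1))
    rcases h with h | h | h
    exacts [absurd h.symm hpr, absurd h.symm hqr, absurd h hr]
  · exact h

theorem IsGeodesicChain.unique {L M : List Pt} (hS : NoThreeCollinear S) (hV : P.vertexSet ⊆ S)
    (hp : p ∈ S) (hq : q ∈ S) (hL : P.IsGeodesicChain p q L) (hM : P.IsGeodesicChain p q M) :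
    L = M :=
  IsShortest.unique P.fullSet_region hS hL.isShortest hM.isShortest hL.isChain hM.isChain
    (hL.mem hV hp hq) (hM.mem hV hp hq)

/-- `IsShortest.triangle` for geodesics between points. -/
theorem geodesic_triangle {L M N : List Pt} {i : ℕ} {a b c : Pt} (hS : NoThreeCollinear S)
    (hV : P.vertexSet ⊆ S) (hpS : p ∈ S) (hqS : q ∈ S) (hrS : r ∈ S) (hp : p ∉ P.vertexSet)
    (hL : P.IsGeodesicChain p q L) (hM : P.IsGeodesicChain p r M)
    (hN : IsShortest P.region q r N) (hNc : List.IsChain (· ≠ ·) N) (hNS : ∀ e ∈ N, e ∈ S)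
    (hi : 0 < i) (h : ∀ j < i, L[j]? = M[j]?) (ha : L[i - 1]? = some a) (hb : L[i]? = some b)
    (hc : M[i]? = some c) (hdet : 0 < det2 (b - a) (c - a)) :
    (∀ y, y ∉ polylineSet L → y ∉ polylineSet N → y ∉ polylineSet M →
      0 ≤ polylineAngle L y + polylineAngle N y - polylineAngle M y) ∧
    ∃ U : Set Pt, IsOpen U ∧ U.Nonempty ∧ ∀ y ∈ U,
      0 < polylineAngle L y + polylineAngle N y - polylineAngle M y := by
  obtain ⟨D, A, C, rfl, rfl⟩ := exists_eq_append_of_branch hi h ha hb hc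
  exact IsShortest.triangle hS hp hL.isShortest hM.isShortest hN hL.isChain hM.isChain hNc
    (hL.mem hV hpS hqS) (hM.mem hV hpS hrS) hNS hdet

end SimplePolygon

/-- Interiority axiom for geodesic order types: if `x` is to the left of
the geodesics `uv`, `vw` and `wu`, then `(u,v,w)` is geodesically counterclockwise. -/
theorem geodesic_interiority
    (P : SimplePolygon) (x u v w : Pt)
    (hx : x ∈ P.interior) (hu : u ∈ P.interior) (hv : v ∈ P.interior) (hw : w ∈ P.interior)
    (hxu : x ≠ u) (hxv : x ≠ v) (hxw : x ≠ w) (huv : u ≠ v) (huw : u ≠ w) (hvw : v ≠ w)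
    (hgp : StrongGenPos (({x, u, v, w} : Set Pt) ∪ P.vertexSet))
    (h1 : geodesicCCW P x u v) (h2 : geodesicCCW P x v w) (h3 : geodesicCCW P x w u) :
    geodesicCCW P u v w := by
  have hS := hgp.1
  have hV : P.vertexSet ⊆ {x, u, v, w} ∪ P.vertexSet := Set.subset_union_right
  have hxS : x ∈ {x, u, v, w} ∪ P.vertexSet := by simp
  have huS : u ∈ {x, u, v, w} ∪ P.vertexSet := by simp
  have hvS : v ∈ {x, u, v, w} ∪ P.vertexSet := by simp
  have hwS : w ∈ {x, u, v, w} ∪ P.vertexSet := by simp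
  generalize ({x, u, v, w} ∪ P.vertexSet : Set Pt) = S at hS hV hxS huS hvS hwS
  have hxV := P.notMem_vertexSet hx
  have huV := P.notMem_vertexSet hu
  have hvV := P.notMem_vertexSet hv
  have hwV := P.notMem_vertexSet hw
  obtain ⟨Lu, Lv, hLu, hLv, i₁, hi₁, he₁, -, a₁, b₁, c₁, ha₁, hb₁, hc₁, hd₁⟩ := h1
  obtain ⟨Lv', Lw, hLv', hLw, i₂, hi₂, he₂, -, a₂, b₂, c₂, ha₂, hb₂, hc₂, hd₂⟩ := h2
  obtain ⟨Lw', Lu', hLw', hLu', i₃, hi₃, he₃, -, a₃, b₃, c₃, ha₃, hb₃, hc₃, hd₃⟩ := h3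
  obtain rfl := hLu.unique hS hV hxS huS hLu'
  obtain rfl := hLv.unique hS hV hxS hvS hLv'
  obtain rfl := hLw.unique hS hV hxS hwS hLw'
  obtain ⟨Luv, hLuv⟩ := SimplePolygon.exists_chain_of_chains hS hV huS hvS hLu hLv
  obtain ⟨Luw, hLuw⟩ := SimplePolygon.exists_chain_of_chains hS hV huS hwS hLu hLw
  obtain ⟨Lvw, hLvw⟩ := SimplePolygon.exists_chain_of_chains hS hV hvS hwS hLv hLw
  have hUV := hLuv.mem hV huS hvS
  have hUW := hLuw.mem hV huS hwS
  have hVW := hLvw.mem hV hvS hwS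
  obtain ⟨t₁, -⟩ := SimplePolygon.geodesic_triangle hS hV hxS huS hvS hxV hLu hLv hLuv.isShortest
    hLuv.isChain hUV hi₁ he₁ ha₁ hb₁ hc₁ hd₁
  obtain ⟨t₂, -⟩ := SimplePolygon.geodesic_triangle hS hV hxS hvS hwS hxV hLv hLw hLvw.isShortest
    hLvw.isChain hVW hi₂ he₂ ha₂ hb₂ hc₂ hd₂
  obtain ⟨t₃, -⟩ := SimplePolygon.geodesic_triangle hS hV hxS hwS huS hxV hLw hLu
    hLuw.isShortest.reverse (isChain_ne_reverse hLuw.isChain)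
    (fun e he => hUW e (List.mem_reverse.1 he)) hi₃ he₃ ha₃ hb₃ hc₃ hd₃
  obtain ⟨D, a, b, c, A, C, hD, hD', hbc⟩ :=
    SimplePolygon.exists_branch_of_chains hvV hwV huv huw hvw hLuv hLuw
  have hdet : det2 (b - a) (c - a) ≠ 0 :=
    det2_ne_zero_of_branch hS (hD ▸ hUV) (hD' ▸ hUW) (hD ▸ hLuv.isChain)
      (hD' ▸ hLuw.isChain) hbc
  have e₁ : ∀ j < D.length + 1, Luv[j]? = Luw[j]? := by
    intro j hj
    rcases (Nat.lt_succ_iff.1 hj).lt_or_eq with h | rfl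
    · rw [hD, hD', List.getElem?_append_left h, List.getElem?_append_left h]
    · simp [hD, hD']
  have e₂ : Luv[D.length + 1 - 1]? = some a := by simp [hD]
  have e₃ : Luv[D.length + 1]? = some b := by simp [hD]
  have e₄ : Luw[D.length + 1]? = some c := by simp [hD']
  rcases hdet.lt_or_gt with hneg | hpos
  · exfalso
    obtain ⟨-, U, hU, hne, t⟩ := SimplePolygon.geodesic_triangle hS hV huS hwS hvS huV hLuw hLuv
      hLvw.isShortest.reverse (isChain_ne_reverse hLvw.isChain)
      (fun e he => hVW e (List.mem_reverse.1 he)) D.length.succ_pos (fun j hj => (e₁ j hj).symm)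
      (by rw [← e₁ _ (by simp), e₂]) e₄ e₃ (by rw [det2_swap]; linarith)
    obtain ⟨y, hy, h⟩ := exists_mem_notMem_polylineSet hU [Lu, Lv, Lw, Luv, Luw, Lvw] hne
    simp only [List.forall_mem_cons] at h
    obtain ⟨yu, yv, yw, yuv, yuw, yvw, -⟩ := h
    have s := t y hy
    have s₁ := t₁ y yu yuv yv
    have s₂ := t₂ y yv yvw yw
    have s₃ := t₃ y yw (by rwa [polylineSet_reverse]) yu
    rw [polylineAngle_reverse yuw] at s₃
    rw [polylineAngle_reverse yvw] at s
    linarith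
  · exact ⟨Luv, Luw, hLuv, hLuw, D.length + 1, D.length.succ_pos, e₁, by simp [e₃, e₄, hbc],
      a, b, c, e₂, e₃, e₄, hpos⟩
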